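/- Let u ∈ C^0(Ω;ℝ^n) ∩ W^{n/(n+1),n+1}(Ω;ℝ^n) and assume |Ju|_TV < ∞. Then for almost every a ∈ ℝ^n the map u^a belongs to W^{(n−1)/n,n}(Ω;ℝ^n), the distribution Ju^a has finite total variation |Ju^a|_TV, and the strong coarea formula |Ju|_TV = (1/ω_n) ∫_{ℝ^n} |Ju^a|_TV da holds. -/

import Mathlib

open MeasureTheory Metric Filter Topology

noncomputable section

abbrev Euc (n : ℕ) := EuclideanSpace ℝ (Fin n)

/-- The Jacobian matrix `∇u(x)` of a map `u : ℝⁿ → ℝⁿ`, with entries `∂_j u_i (x)`. -/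
def jacMat (n : ℕ) (u : Euc n → Euc n) (x : Euc n) : Matrix (Fin n) (Fin n) ℝ :=
  Matrix.of fun i j => fderiv ℝ u x (EuclideanSpace.single j 1) i

/-- The vector field `j u := (1/n) (cof ∇u)ᵀ u` (componentwise); note that
`(cof A)ᵀ = adjugate A`. -/
def jvec (n : ℕ) (u : Euc n → Euc n) (x : Euc n) : Fin n → ℝ :=
  fun i => (n : ℝ)⁻¹ * Matrix.mulVec (Matrix.adjugate (jacMat n u x)) (fun j => u x j) i

/-- The pointwise pairing `j u (x) · ∇ψ(x)`. -/
def jPair (n : ℕ) (u : Euc n → Euc n) (ψ : Euc n → ℝ) (x : Euc n) : ℝ :=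
  ∑ i, jvec n u x i * fderiv ℝ ψ x (EuclideanSpace.single i 1)

/-- `ψ ∈ C¹_c(Ω)`. -/
def Cc1 (n : ℕ) (Ω : Set (Euc n)) (ψ : Euc n → ℝ) : Prop :=
  ContDiff ℝ 1 ψ ∧ HasCompactSupport ψ ∧ tsupport ψ ⊆ Ω

/-- The fractional Sobolev seminorm `[u]_{W^{s,p}(Ω)}`. -/
def sobSemi (n : ℕ) (s p : ℝ) (Ω : Set (Euc n)) {F : Type*} [NormedAddCommGroup F]
    (u : Euc n → F) : ℝ :=
  (∫ x in Ω, ∫ y in Ω, ‖u x - u y‖ ^ p / dist x y ^ ((n : ℝ) + s * p)) ^ (1 / p)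

/-- The fractional Sobolev norm `‖u‖_{W^{s,p}(Ω)} = ‖u‖_{L^p(Ω)} + [u]_{W^{s,p}(Ω)}`. -/
def sobNorm (n : ℕ) (s p : ℝ) (Ω : Set (Euc n)) {F : Type*} [NormedAddCommGroup F]
    (u : Euc n → F) : ℝ :=
  (∫ x in Ω, ‖u x‖ ^ p) ^ (1 / p) + sobSemi n s p Ω u

/-- Membership `u ∈ W^{s,p}(Ω; F)`: `u ∈ L^p(Ω)` and the double integral defining
`[u]_{W^{s,p}(Ω)}^p` is finite. -/
def MemWsp (n : ℕ) (s p : ℝ) (Ω : Set (Euc n)) {F : Type*} [NormedAddCommGroup F]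
    (u : Euc n → F) : Prop :=
  AEStronglyMeasurable u (volume.restrict Ω) ∧
  Integrable (fun x => ‖u x‖ ^ p) (volume.restrict Ω) ∧
  Integrable (fun q : Euc n × Euc n => ‖u q.1 - u q.2‖ ^ p / dist q.1 q.2 ^ ((n : ℝ) + s * p))
    ((volume.restrict Ω).prod (volume.restrict Ω))

/-- `Ω` has smooth boundary: it is a sublevel set of a smooth function whose
differential does not vanish on the boundary. -/
def SmoothBoundary (n : ℕ) (Ω : Set (Euc n)) : Prop :=
  ∃ f : Euc n → ℝ, ContDiff ℝ (⊤ : ℕ∞) f ∧ Ω = f ⁻¹' Set.Iio 0 ∧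
    ∀ x ∈ frontier Ω, fderiv ℝ f x ≠ 0

/-- `u^a(x) = (u(x) - a)/|u(x) - a|`. -/
def proj (n : ℕ) (u : Euc n → Euc n) (a : Euc n) : Euc n → Euc n :=
  fun x => ‖u x - a‖⁻¹ • (u x - a)

/-- The set of Hölder quotients of `u` on `Ω`. -/
def holderSet (n : ℕ) (α : ℝ) (Ω : Set (Euc n)) {F : Type*} [NormedAddCommGroup F]
    (u : Euc n → F) : Set ℝ :=
  {r | ∃ x ∈ Ω, ∃ y ∈ Ω, x ≠ y ∧ r = ‖u x - u y‖ / dist x y ^ α}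

/-- The Hölder seminorm `[u]_{C^{0,α}(Ω)}`. -/
def holderSemi (n : ℕ) (α : ℝ) (Ω : Set (Euc n)) {F : Type*} [NormedAddCommGroup F]
    (u : Euc n → F) : ℝ :=
  sSup (holderSet n α Ω u)

/-- The Hölder norm `‖u‖_{C^{0,α}(Ω)} = sup_Ω ‖u‖ + [u]_{C^{0,α}(Ω)}`. -/
def holderNorm (n : ℕ) (α : ℝ) (Ω : Set (Euc n)) {F : Type*} [NormedAddCommGroup F]
    (u : Euc n → F) : ℝ :=
  sSup {r | ∃ x ∈ Ω, r = ‖u x‖} + holderSemi n α Ω u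

/-- the volume `ω_n` of the unit ball of `ℝⁿ`. -/
def ballVol (n : ℕ) : ℝ := (volume (ball (0 : Euc n) 1)).toReal

/-- `⟨Jv, ψ⟩ = J` for `v ∈ W^{(n-1)/n, n}(Ω; ℝⁿ)`: approximating sequences of maps which are
`C¹` up to the boundary exist, and for every such sequence the Jacobian integrals converge
to `J`. -/
def JPairing (n : ℕ) (Ω : Set (Euc n)) (v : Euc n → Euc n) (ψ : Euc n → ℝ) (J : ℝ) : Prop :=
  (∃ vk : ℕ → Euc n → Euc n, (∀ k, ContDiffOn ℝ 1 (vk k) (closure Ω)) ∧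
      Tendsto (fun k => sobNorm n (((n : ℝ) - 1) / n) n Ω (vk k - v)) atTop (𝓝 0) ∧
      Tendsto (fun k => ∫ x in Ω, (jacMat n (vk k) x).det * ψ x) atTop (𝓝 J)) ∧
  (∀ vk : ℕ → Euc n → Euc n, (∀ k, ContDiffOn ℝ 1 (vk k) (closure Ω)) →
      Tendsto (fun k => sobNorm n (((n : ℝ) - 1) / n) n Ω (vk k - v)) atTop (𝓝 0) →
      Tendsto (fun k => ∫ x in Ω, (jacMat n (vk k) x).det * ψ x) atTop (𝓝 J))

/-- The set of values `⟨Jv, ψ⟩` over test functions `ψ ∈ C¹_c(Ω)` with `|ψ| ≤ 1`;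
its supremum is the total variation `|Jv|_{TV}`. -/
def TVset (n : ℕ) (Ω : Set (Euc n)) (v : Euc n → Euc n) : Set ℝ :=
  {r | ∃ ψ : Euc n → ℝ, Cc1 n Ω ψ ∧ (∀ x, |ψ x| ≤ 1) ∧ JPairing n Ω v ψ r}

/-- `⟨Jv, ψ⟩ = -∫_Ω j v · ∇ψ` for (pointwise defined) `v`. -/
def jpairOn (n : ℕ) (Ω : Set (Euc n)) (v : Euc n → Euc n) (ψ : Euc n → ℝ) : ℝ :=
  -∫ x in Ω, jPair n v ψ x

/-- The `W^{-1,1}(Ω)` distance between two functionals on test functions: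
`sup { S ψ - T ψ : ψ ∈ C¹_c(Ω), Lip ψ ≤ 1 }`. -/
def Wm11dist (n : ℕ) (Ω : Set (Euc n)) (S T : (Euc n → ℝ) → ℝ) : ℝ :=
  sSup {r | ∃ ψ : Euc n → ℝ, Cc1 n Ω ψ ∧ LipschitzWith 1 ψ ∧ r = S ψ - T ψ}

section

/-! ### Determinant calculus -/

/-- Determinant as a continuous multilinear map of the rows. -/
def detCM (n : ℕ) : ContinuousMultilinearMap ℝ (fun _ : Fin n => (Fin n → ℝ)) ℝ where
  toMultilinearMap := (Matrix.detRowAlternating (R := ℝ) (n := Fin n)).toMultilinearMap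
  cont := by
    change Continuous (fun M : Fin n → Fin n → ℝ => Matrix.det (Matrix.of M))
    exact Continuous.matrix_det continuous_id

lemma detCM_apply (n : ℕ) (M : Matrix (Fin n) (Fin n) ℝ) : detCM n M = M.det := rfl

lemma hasFDerivAt_det {n : ℕ} {E : Type*} [NormedAddCommGroup E] [NormedSpace ℝ E]
    {R : E → Matrix (Fin n) (Fin n) ℝ} {R' : Fin n → E →L[ℝ] (Fin n → ℝ)} {x : E}
    (h : ∀ i, HasFDerivAt (fun y => R y i) (R' i) x) :
    ∃ D : E →L[ℝ] ℝ, HasFDerivAt (fun y => (R y).det) D x ∧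
      ∀ v, D v = ∑ i, ((R x).updateRow i (R' i v)).det := by
  have := HasFDerivAt.multilinear_comp (f := detCM n) (g := fun i y => R y i) h
  refine ⟨_, this, fun v => ?_⟩
  simp only [sum_apply, ContinuousLinearMap.comp_apply]
  rfl

lemma hasDerivAt_det {n : ℕ} {R : ℝ → Matrix (Fin n) (Fin n) ℝ} {R' : Fin n → (Fin n → ℝ)} {t : ℝ}
    (h : ∀ i, HasDerivAt (fun y => R y i) (R' i) t) :
    HasDerivAt (fun y => (R y).det) (∑ i, ((R t).updateRow i (R' i)).det) t := by
  obtain ⟨D, hD, hDv⟩ := hasFDerivAt_det (fun i => (h i).hasFDerivAt)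
  have := hD.hasDerivAt
  rw [hDv] at this
  simpa using this

lemma det_updateRow_expand {n : ℕ} (A : Matrix (Fin n) (Fin n) ℝ) (j : Fin n) (g : Fin n → ℝ) :
    (A.updateRow j g).det = ∑ i, g i * (A.updateRow j (Pi.single i 1)).det := by
  rw [← Matrix.cramer_transpose_apply, Matrix.cramer_eq_adjugate_mulVec, Matrix.mulVec, dotProduct]
  refine Finset.sum_congr rfl fun i _ => ?_
  rw [← Matrix.adjugate_transpose, Matrix.transpose_apply, Matrix.adjugate_apply, mul_comm]

lemma det_swap_rows {n : ℕ} (A : Matrix (Fin n) (Fin n) ℝ) {j k : Fin n} (hjk : j ≠ k)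
    (a b : Fin n → ℝ) :
    ((A.updateRow j a).updateRow k b).det = - ((A.updateRow j b).updateRow k a).det := by
  have h := (Matrix.detRowAlternating (R := ℝ) (n := Fin n)).map_swap
    ((A.updateRow j b).updateRow k a) hjk
  have e : (((A.updateRow j b).updateRow k a) ∘ (Equiv.swap j k) : Fin n → Fin n → ℝ)
      = ((A.updateRow j a).updateRow k b) := by
    ext i l
    simp only [Function.comp]
    by_cases h1 : i = j
    · subst h1; simp [Matrix.updateRow_apply, hjk]
    · by_cases h2 : i = k
      · subst h2; simp [Matrix.updateRow_apply, hjk]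
      · rw [Equiv.swap_apply_of_ne_of_ne h1 h2]; simp [Matrix.updateRow_apply, h1, h2]
  rw [e] at h
  exact h

lemma sum_sym_antisym {n : ℕ} (H B : Fin n → Fin n → ℝ) (hH : ∀ i l, H i l = H l i)
    (hB : ∀ i l, B i l = - B l i) : ∑ i, ∑ l, H i l * B i l = 0 := by
  have : ∑ i, ∑ l, H i l * B i l = - ∑ i, ∑ l, H i l * B i l := by
    conv_lhs => rw [Finset.sum_comm]
    rw [← Finset.sum_neg_distrib]
    refine Finset.sum_congr rfl fun i _ => ?_
    rw [← Finset.sum_neg_distrib]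
    refine Finset.sum_congr rfl fun l _ => ?_
    rw [hH, hB]; ring
  linarith

abbrev ebase {n : ℕ} (i : Fin n) : Euc n := EuclideanSpace.single i 1

/-- the gradient row -/
def gradRow (n : ℕ) (h : Euc n → ℝ) (x : Euc n) : Fin n → ℝ := fun i => fderiv ℝ h x (ebase i)

lemma jacMat_row {n : ℕ} {V : Euc n → Euc n} {x : Euc n} (hV : DifferentiableAt ℝ V x) (k : Fin n) :
    jacMat n V x k = gradRow n (fun y => V y k) x := by
  ext i
  have h1 : HasFDerivAt (fun y => V y k) ((EuclideanSpace.proj k : Euc n →L[ℝ] ℝ).comp (fderiv ℝ V x)) x :=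
    (EuclideanSpace.proj k : Euc n →L[ℝ] ℝ).hasFDerivAt.comp x hV.hasFDerivAt
  simp only [jacMat, gradRow, Matrix.of_apply, h1.fderiv]
  rfl

lemma contDiff_gradRow {n : ℕ} {h : Euc n → ℝ} {m k : WithTop ℕ∞} (hh : ContDiff ℝ m h) (hk : k + 1 ≤ m) :
    ContDiff ℝ k (gradRow n h) := by
  rw [contDiff_pi]
  intro i
  exact (hh.fderiv_right hk).clm_apply contDiff_const

lemma integral_det_row_eq_zero {n : ℕ} {V : Euc n → Euc n} (hV : ContDiff ℝ 2 V)
    {h : Euc n → ℝ} (hh : ContDiff ℝ 1 h) (hc : HasCompactSupport h) (j : Fin n) :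
    ∫ x, ((jacMat n V x).updateRow j (gradRow n h x)).det = 0 := by
  have hVd : Differentiable ℝ V := hV.differentiable (by norm_num)
  have hVk : ∀ k, ContDiff ℝ 2 (fun y => V y k) := fun k =>
    (EuclideanSpace.proj k : Euc n →L[ℝ] ℝ).contDiff.comp hV
  have hrow : ∀ k, ContDiff ℝ 1 (gradRow n (fun y => V y k)) := fun k =>
    contDiff_gradRow (hVk k) (by norm_num)
  have hjac : ∀ x, jacMat n V x = Matrix.of (fun k => gradRow n (fun y => V y k) x) := by
    intro x; ext k i; rw [jacMat_row (hVd x)]; rfl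
  -- cofactor functions
  set c : Fin n → Euc n → ℝ := fun i x => ((jacMat n V x).updateRow j (Pi.single i 1)).det with hc_def
  -- second derivatives
  set S : Fin n → Euc n → Euc n →L[ℝ] (Fin n → ℝ) := fun k x => fderiv ℝ (gradRow n (fun y => V y k)) x
  have hcd : ∀ i x, ∃ D : Euc n →L[ℝ] ℝ, HasFDerivAt (c i) D x ∧ ∀ v, D v = ∑ k,
      (((jacMat n V x).updateRow j (Pi.single i 1)).updateRow k
        ((if k = j then (0 : Euc n →L[ℝ] (Fin n → ℝ)) else S k x) v)).det := by
    intro i x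
    refine hasFDerivAt_det (R' := fun k => if k = j then 0 else S k x) (fun k => ?_)
    by_cases hk : k = j
    · subst hk
      simp only [Matrix.updateRow_self, if_true]
      exact hasFDerivAt_const _ _
    · simp only [hk, if_false]
      have : (fun y => (jacMat n V y).updateRow j (Pi.single i 1) k) = gradRow n (fun y => V y k) := by
        ext y : 1
        rw [Matrix.updateRow_ne hk, jacMat_row (hVd y)]
      rw [this]
      exact ((hrow k).differentiable (by norm_num) x).hasFDerivAt
  have hcont : ∀ i, Continuous (c i) := fun i => by
    rw [continuous_iff_continuousAt]; intro x; obtain ⟨D, hD, -⟩ := hcd i x; exact hD.continuousAt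
  have hdiv : ∀ x, ∑ i, fderiv ℝ (c i) x (ebase i) = 0 := by
    intro x
    have h1 : ∀ i, fderiv ℝ (c i) x (ebase i) = ∑ k, (((jacMat n V x).updateRow j (Pi.single i 1)).updateRow k
        ((if k = j then (0 : Euc n →L[ℝ] (Fin n → ℝ)) else S k x) (ebase i))).det := by
      intro i; obtain ⟨D, hD, hDv⟩ := hcd i x; rw [hD.fderiv, hDv]
    simp_rw [h1]
    rw [Finset.sum_comm]
    refine Finset.sum_eq_zero fun k _ => ?_
    by_cases hk : k = j
    · simp only [hk, if_true]
      refine Finset.sum_eq_zero fun i _ => ?_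
      apply Matrix.det_eq_zero_of_row_eq_zero j
      intro l; simp
    · simp only [hk, if_false]
      have : ∀ i, (((jacMat n V x).updateRow j (Pi.single i 1)).updateRow k (S k x (ebase i))).det
          = ∑ l, S k x (ebase i) l *
            (((jacMat n V x).updateRow j (Pi.single i 1)).updateRow k (Pi.single l 1)).det :=
        fun i => det_updateRow_expand _ _ _
      simp_rw [this]
      apply sum_sym_antisym (fun i l => S k x (ebase i) l)
      · intro i l
        have hS : ∀ i l, S k x (ebase i) l = fderiv ℝ (fderiv ℝ (fun y => V y k)) x (ebase i) (ebase l) := by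
          intro i l
          have hd : DifferentiableAt ℝ (fderiv ℝ (fun y => V y k)) x :=
            (((hVk k).fderiv_right (m := 1) (by norm_num)).differentiable (by norm_num)) x
          have h2 : HasFDerivAt (gradRow n (fun y => V y k)) (ContinuousLinearMap.pi fun l =>
              ((ContinuousLinearMap.apply ℝ ℝ (ebase l)).comp (fderiv ℝ (fderiv ℝ (fun y => V y k)) x))) x := by
            rw [hasFDerivAt_pi]
            intro l
            exact (ContinuousLinearMap.apply ℝ ℝ (ebase l)).hasFDerivAt.comp x hd.hasFDerivAt
          simp only [S, h2.fderiv]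
          rfl
        rw [hS, hS]
        have hsym : IsSymmSndFDerivAt ℝ (fun y => V y k) x :=
          (hVk k).contDiffAt.isSymmSndFDerivAt (by simp)
        exact hsym.eq _ _
      · intro i l
        exact det_swap_rows _ (Ne.symm hk) _ _
  -- now integrate by parts
  have hexp : ∀ x, ((jacMat n V x).updateRow j (gradRow n h x)).det
      = ∑ i, fderiv ℝ h x (ebase i) * c i x := fun x => det_updateRow_expand _ _ _
  simp_rw [hexp]
  have hcC : ∀ i, Differentiable ℝ (c i) := fun i x => by
    obtain ⟨D, hD, -⟩ := hcd i x; exact hD.differentiableAt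
  have hcC1 : ∀ i, ContDiff ℝ 1 (c i) := by
    intro i
    have : ContDiff ℝ 1 (fun x => detCM n ((jacMat n V x).updateRow j (Pi.single i 1))) := by
      apply (detCM n).contDiff.comp
      refine contDiff_pi' (Φ := fun x k => ((jacMat n V x).updateRow j (Pi.single i 1)) k) (fun k => ?_)
      by_cases hk : k = j
      · subst hk; simp only [Matrix.updateRow_self]; exact contDiff_const
      · have : (fun y => (jacMat n V y).updateRow j (Pi.single i 1) k) = gradRow n (fun y => V y k) := by
          ext y : 1
          rw [Matrix.updateRow_ne hk, jacMat_row (hVd y)]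
        rw [this]; exact hrow k
    exact this
  have hfc : ∀ i, Continuous (fun x => fderiv ℝ h x (ebase i)) := fun i =>
    (hh.continuous_fderiv (by norm_num)).clm_apply continuous_const
  have hfs : ∀ i, HasCompactSupport (fun x => fderiv ℝ h x (ebase i)) := fun i =>
    hc.fderiv_apply (𝕜 := ℝ) (ebase i)
  have hcf : ∀ i, Continuous (fun x => fderiv ℝ (c i) x (ebase i)) := fun i =>
    ((hcC1 i).continuous_fderiv (by norm_num)).clm_apply continuous_const
  have i1 : ∀ i, Integrable (fun x => fderiv ℝ h x (ebase i) * c i x) := fun i =>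
    ((hfc i).mul (hcont i)).integrable_of_hasCompactSupport (hfs i).mul_right
  have i2 : ∀ i, Integrable (fun x => h x * fderiv ℝ (c i) x (ebase i)) := fun i =>
    ((hh.continuous).mul (hcf i)).integrable_of_hasCompactSupport hc.mul_right
  have i3 : ∀ i, Integrable (fun x => h x * c i x) := fun i =>
    ((hh.continuous).mul (hcont i)).integrable_of_hasCompactSupport hc.mul_right
  rw [integral_finsetSum _ (fun i _ => i1 i)]
  have : ∀ i, ∫ x, fderiv ℝ h x (ebase i) * c i x = - ∫ x, h x * fderiv ℝ (c i) x (ebase i) := by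
    intro i
    rw [integral_mul_fderiv_eq_neg_fderiv_mul_of_integrable (i1 i) (i2 i) (i3 i)
      (fun x _ => hh.differentiable (by norm_num) x) (fun x _ => hcC i x), neg_neg]
  simp_rw [this]
  rw [Finset.sum_neg_distrib, ← integral_finsetSum _ (fun i _ => i2 i)]
  simp_rw [← Finset.mul_sum, hdiv]
  simp

end

section

/-! ### The extension to one more variable -/

/-- the standard bump -/
def bump0 (n : ℕ) : ContDiffBump (0 : Euc n) := ⟨1 / 2, 1, by norm_num, by norm_num⟩

def eta (n : ℕ) : Euc n → ℝ := (bump0 n).normed volume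

lemma eta_contDiff (n : ℕ) {k : ℕ∞} : ContDiff ℝ k (eta n) := (bump0 n).contDiff_normed
lemma eta_nonneg (n : ℕ) (z : Euc n) : 0 ≤ eta n z := (bump0 n).nonneg_normed z
lemma eta_integral (n : ℕ) : ∫ z, eta n z = 1 := (bump0 n).integral_normed
lemma eta_compact (n : ℕ) : HasCompactSupport (eta n) := (bump0 n).hasCompactSupport_normed
lemma eta_tsupport (n : ℕ) : tsupport (eta n) = closedBall 0 1 := (bump0 n).tsupport_normed_eq
lemma eta_zero {n : ℕ} {z : Euc n} (hz : z ∉ closedBall (0 : Euc n) 1) : eta n z = 0 :=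
  image_eq_zero_of_notMem_tsupport (by rwa [eta_tsupport])

/-- Differentiable parametric integrals with compact support. -/
lemma contDiff_integral_param {n : ℕ} {P F : Type*} [NormedAddCommGroup P] [NormedSpace ℝ P]
    [NormedAddCommGroup F] [NormedSpace ℝ F] [CompleteSpace F]
    {k : ℕ∞} {G : P → Euc n → F} (hG : ContDiff ℝ k (fun q : P × Euc n => G q.1 q.2))
    {K : Set (Euc n)} (hK : IsCompact K) (hGK : ∀ p z, z ∉ K → G p z = 0) :
    ContDiff ℝ k (fun p => ∫ z, G p z) := by
  have h := contDiffOn_convolution_right_with_param_comp (𝕜 := ℝ) (μ := (volume : Measure (Euc n)))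
    (n := k) (ContinuousLinearMap.lsmul ℝ ℝ : ℝ →L[ℝ] F →L[ℝ] F)
    (s := (Set.univ : Set P)) (v := fun _ => (0 : Euc n)) contDiffOn_const (f := fun _ => (1 : ℝ))
    (g := fun p z => G p (-z)) (k := -K) isOpen_univ hK.neg
    (fun p x _ hx => hGK p _ (by simpa using hx)) (locallyIntegrable_const 1)
    (by
      have : ContDiff ℝ k (fun q : P × Euc n => G q.1 (-q.2)) :=
        hG.comp (contDiff_fst.prodMk contDiff_snd.neg)
      exact this.contDiffOn)
  rw [contDiffOn_univ] at h
  convert h using 2 with p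
  simp [MeasureTheory.convolution]

variable {F : Type*} [NormedAddCommGroup F] [NormedSpace ℝ F]

def extv (n : ℕ) (v : Euc n → F) (p : Euc n × ℝ) : F := ∫ z, eta n z • v (p.1 + p.2 • z)

lemma contDiff_extv {n : ℕ} [CompleteSpace F] {v : Euc n → F} {k : ℕ∞} (hv : ContDiff ℝ k v) :
    ContDiff ℝ k (extv n v) := by
  refine contDiff_integral_param (G := fun (p : Euc n × ℝ) z => eta n z • v (p.1 + p.2 • z)) ?_
    (isCompact_closedBall (0 : Euc n) 1) (fun p z hz => by simp [eta_zero hz])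
  have h1 : ContDiff ℝ k (fun q : (Euc n × ℝ) × Euc n => eta n q.2) := (eta_contDiff n).comp contDiff_snd
  exact h1.smul (hv.comp (by fun_prop))

lemma extv_zero {n : ℕ} [CompleteSpace F] (v : Euc n → F) (x : Euc n) : extv n v (x, 0) = v x := by
  simp only [extv, zero_smul, add_zero]
  rw [integral_smul_const, eta_integral, one_smul]

lemma extv_sub {n : ℕ} {v w : Euc n → F} (hv : Continuous v) (hw : Continuous w) :
    extv n (v - w) = extv n v - extv n w := by
  ext p
  simp only [extv, Pi.sub_apply, smul_sub]
  have hη : Continuous (eta n) := (eta_contDiff n (k := 0)).continuous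
  rw [integral_sub]
  · exact (hη.smul (hv.comp (by fun_prop))).integrable_of_hasCompactSupport (eta_compact n).smul_right
  · exact (hη.smul (hw.comp (by fun_prop))).integrable_of_hasCompactSupport (eta_compact n).smul_right

lemma hasFDerivAt_integral_param {n : ℕ} {P : Type*} [NormedAddCommGroup P] [NormedSpace ℝ P]
    [FiniteDimensional ℝ P]
    [CompleteSpace F] {G : P → Euc n → F} {G' : P → Euc n → P →L[ℝ] F}
    (hG : ∀ p z, HasFDerivAt (fun p => G p z) (G' p z) p)
    (hGc : Continuous (fun q : P × Euc n => G q.1 q.2))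
    (hGc' : Continuous (fun q : P × Euc n => G' q.1 q.2))
    {K : Set (Euc n)} (hK : IsCompact K) (hGK : ∀ p z, z ∉ K → G p z = 0)
    (hGK' : ∀ p z, z ∉ K → G' p z = 0) (p : P) :
    HasFDerivAt (fun p => ∫ z, G p z) (∫ z, G' p z) p := by
  have : ProperSpace P := FiniteDimensional.proper ℝ P
  obtain ⟨M, hM⟩ := ((isCompact_closedBall p 1).prod hK).bddAbove_image hGc'.norm.continuousOn
  have hc1 : ∀ p, Continuous (G p) := fun p => hGc.comp (by fun_prop : Continuous fun z => (p, z))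
  have hc2 : ∀ p, Continuous (G' p) := fun p => hGc'.comp (by fun_prop : Continuous fun z => (p, z))
  have hs1 : ∀ p, HasCompactSupport (G p) := fun p => HasCompactSupport.intro hK (hGK p)
  have hs2 : ∀ p, HasCompactSupport (G' p) := fun p => HasCompactSupport.intro hK (hGK' p)
  refine hasFDerivAt_integral_of_dominated_of_fderiv_le (s := closedBall p 1)
    (bound := K.indicator fun _ => M) (closedBall_mem_nhds p one_pos)
    (Eventually.of_forall fun q => (hc1 q).aestronglyMeasurable)
    ((hc1 p).integrable_of_hasCompactSupport (hs1 p)) (hc2 p).aestronglyMeasurable ?_ ?_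
    (Eventually.of_forall fun z q _ => hG q z)
  · refine Eventually.of_forall fun z q hq => ?_
    by_cases hz : z ∈ K
    · rw [Set.indicator_of_mem hz]
      exact hM ⟨(q, z), ⟨hq, hz⟩, rfl⟩
    · rw [hGK' q z hz, Set.indicator_of_notMem hz, norm_zero]
  · rw [integrable_indicator_iff hK.measurableSet]
    exact (integrableOn_const_iff (by simp)).2 (Or.inr hK.measure_lt_top)

lemma fderiv_extv_apply {n : ℕ} [CompleteSpace F] {v : Euc n → F} (hv : ContDiff ℝ 1 v)
    (p w : Euc n × ℝ) :
    fderiv ℝ (extv n v) p w = ∫ z, eta n z • fderiv ℝ v (p.1 + p.2 • z) (w.1 + w.2 • z) := by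
  have hη : Continuous (eta n) := (eta_contDiff n (k := 0)).continuous
  let A : Euc n → (Euc n × ℝ) →L[ℝ] Euc n := fun z =>
    ContinuousLinearMap.fst ℝ (Euc n) ℝ + (ContinuousLinearMap.snd ℝ (Euc n) ℝ).smulRight z
  have hA : Continuous A := by
    refine continuous_const.add ?_
    exact (ContinuousLinearMap.smulRightL ℝ (Euc n × ℝ) (Euc n) (ContinuousLinearMap.snd ℝ (Euc n) ℝ)).continuous
  have hv' : Continuous (fderiv ℝ v) := hv.continuous_fderiv (by norm_num)
  have h := hasFDerivAt_integral_param (n := n) (P := Euc n × ℝ)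
    (G := fun p z => eta n z • v (p.1 + p.2 • z))
    (G' := fun p z => eta n z • (fderiv ℝ v (p.1 + p.2 • z)).comp (A z))
    (fun p z => by
      refine HasFDerivAt.const_smul ?_ _
      have h1 : HasFDerivAt (fun p : Euc n × ℝ => p.1 + p.2 • z) (A z) p := (A z).hasFDerivAt
      exact ((hv.differentiable (by norm_num) _).hasFDerivAt).comp p h1)
    (by
      have := hv.continuous
      fun_prop)
    (by
      refine Continuous.smul (hη.comp continuous_snd) ?_
      have hh : Continuous (fun q : (Euc n × ℝ) × Euc n => q.1.1 + q.1.2 • q.2) := by fun_prop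
      exact (hv'.comp hh).clm_comp (hA.comp continuous_snd))
    (isCompact_closedBall (0 : Euc n) 1) (fun p z hz => by simp [eta_zero hz])
    (fun p z hz => by simp [eta_zero hz]) p
  have h2 : fderiv ℝ (extv n v) p = ∫ z, eta n z • (fderiv ℝ v (p.1 + p.2 • z)).comp (A z) := h.fderiv
  rw [h2, ContinuousLinearMap.integral_apply]
  · rfl
  · refine Continuous.integrable_of_hasCompactSupport ?_ (eta_compact n).smul_right
    exact hη.smul ((hv'.comp (by fun_prop)).clm_comp hA)

lemma ibp_kernel {n : ℕ} {k : Euc n → ℝ} (hk : ContDiff ℝ 1 k) (hkc : HasCompactSupport k)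
    {v : Euc n → F} (hv : ContDiff ℝ 1 v) (x e : Euc n) {t : ℝ} (ht : t ≠ 0) :
    ∫ z, k z • fderiv ℝ v (x + t • z) e
      = - t⁻¹ • ∫ z, fderiv ℝ k z e • (v (x + t • z) - v x) := by
  set g : Euc n → F := fun z => v (x + t • z) - v x with hg
  have hg1 : ContDiff ℝ 1 g := (hv.comp (by fun_prop)).sub contDiff_const
  have hgd : ∀ z, fderiv ℝ g z e = t • fderiv ℝ v (x + t • z) e := by
    intro z
    have h1 : HasFDerivAt (fun z : Euc n => x + t • z) (t • ContinuousLinearMap.id ℝ (Euc n)) z :=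
      ((ContinuousLinearMap.id ℝ (Euc n)).hasFDerivAt.const_smul t).const_add x
    have h2 := (((hv.differentiable (by norm_num) (x + t • z)).hasFDerivAt).comp z h1).sub_const (v x)
    have h3 : HasFDerivAt g ((fderiv ℝ v (x + t • z)).comp (t • ContinuousLinearMap.id ℝ (Euc n))) z := h2
    rw [h3.fderiv]
    simp
  have hkf : Continuous (fun z => fderiv ℝ k z e) := (hk.continuous_fderiv (by norm_num)).clm_apply continuous_const
  have hgf : Continuous (fun z => fderiv ℝ g z e) := (hg1.continuous_fderiv (by norm_num)).clm_apply continuous_const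
  have key := integral_smul_fderiv_eq_neg_fderiv_smul_of_integrable (𝕜 := ℝ) (μ := (volume : Measure (Euc n)))
    (f := k) (g := g) (v := e)
    ((hkf.smul hg1.continuous).integrable_of_hasCompactSupport ((hkc.fderiv_apply (𝕜 := ℝ) e).smul_right))
    ((hk.continuous.smul hgf).integrable_of_hasCompactSupport hkc.smul_right)
    ((hk.continuous.smul hg1.continuous).integrable_of_hasCompactSupport hkc.smul_right)
    (fun z _ => hk.differentiable (by norm_num) z) (fun z _ => hg1.differentiable (by norm_num) z)
  have h4 : ∫ z, k z • fderiv ℝ g z e = t • ∫ z, k z • fderiv ℝ v (x + t • z) e := by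
    rw [← integral_smul]
    congr 1; ext z; rw [hgd, smul_comm]
  rw [h4] at key
  have := congrArg (fun y => t⁻¹ • y) key
  simp only [smul_smul, inv_mul_cancel₀ ht, one_smul] at this
  rw [this, smul_neg, neg_smul]

lemma exists_kernel_bound (n : ℕ) : ∃ M : ℝ, 0 ≤ M ∧ ∀ (i : Fin n) (z : Euc n),
    |fderiv ℝ (eta n) z (ebase i)| ≤ M ∧ |fderiv ℝ (fun z => z i * eta n z) z (ebase i)| ≤ M := by
  have h1 : ∀ k : Euc n → ℝ, ContDiff ℝ 1 k → HasCompactSupport k → ∀ i : Fin n, ∃ M : ℝ,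
      ∀ z, |fderiv ℝ k z (ebase i)| ≤ M := by
    intro k hk hkc i
    have hkf : Continuous (fun z => fderiv ℝ k z (ebase i)) :=
      (hk.continuous_fderiv (by norm_num)).clm_apply continuous_const
    obtain ⟨M, hM⟩ := hkf.bounded_above_of_compact_support (hkc.fderiv_apply (𝕜 := ℝ) (ebase i))
    exact ⟨M, hM⟩
  have hc : ∀ i : Fin n, ContDiff ℝ 1 (fun z : Euc n => z i * eta n z) := fun i =>
    (EuclideanSpace.proj i : Euc n →L[ℝ] ℝ).contDiff.mul (eta_contDiff n (k := 1))
  choose M1 hM1 using h1 (eta n) (eta_contDiff n (k := 1)) (eta_compact n)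
  choose M2 hM2 using fun i => h1 (fun z : Euc n => z i * eta n z) (hc i) (eta_compact n).mul_left i
  refine ⟨∑ i, (|M1 i| + |M2 i|), by positivity, fun i z => ?_⟩
  have hle : |M1 i| + |M2 i| ≤ ∑ i, (|M1 i| + |M2 i|) :=
    Finset.single_le_sum (f := fun i => |M1 i| + |M2 i|) (fun _ _ => by positivity) (Finset.mem_univ i)
  constructor
  · linarith [hM1 i z, le_abs_self (M1 i), abs_nonneg (M2 i)]
  · linarith [hM2 i z, le_abs_self (M2 i), abs_nonneg (M1 i)]

lemma euc_sum {n : ℕ} (h : Euc n) : h = ∑ i, h i • (ebase i : Euc n) := by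
  have := (EuclideanSpace.basisFun (Fin n) ℝ).sum_repr h
  simpa using this.symm

lemma clm_euc_sum {n : ℕ} {F : Type*} [NormedAddCommGroup F] [NormedSpace ℝ F] (L : Euc n →L[ℝ] F)
    (h : Euc n) : L h = ∑ i, h i • L (ebase i) := by
  conv_lhs => rw [euc_sum h]
  rw [map_sum]
  simp only [map_smul]

lemma exists_fderiv_extv_bound (n : ℕ) : ∃ C : ℝ, 0 ≤ C ∧
    ∀ {F : Type} [NormedAddCommGroup F] [NormedSpace ℝ F] [CompleteSpace F] (v : Euc n → F)
      (_ : ContDiff ℝ 1 v) (x : Euc n) (t : ℝ) (_ : 0 < t),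
      ‖fderiv ℝ (extv n v) (x, t)‖ ≤ C * t⁻¹ * ∫ z in closedBall (0 : Euc n) 1, ‖v (x + t • z) - v x‖ := by
  obtain ⟨M, hM0, hM⟩ := exists_kernel_bound n
  refine ⟨∑ _i : Fin n, (M + M), by positivity, ?_⟩
  intro F _ _ _ v hv x t ht
  set I := ∫ z in closedBall (0 : Euc n) 1, ‖v (x + t • z) - v x‖ with hI
  have hvc := hv.continuous
  have hI0 : 0 ≤ I := integral_nonneg fun _ => norm_nonneg _
  have hv' : Continuous (fderiv ℝ v) := hv.continuous_fderiv (by norm_num)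
  have hη : Continuous (eta n) := (eta_contDiff n (k := 0)).continuous
  -- the kernel estimate
  have hker : ∀ (k : Euc n → ℝ), ContDiff ℝ 1 k → HasCompactSupport k → (∀ z, z ∉ closedBall (0 : Euc n) 1 → k z = 0)
      → ∀ i : Fin n, (∀ z, |fderiv ℝ k z (ebase i)| ≤ M) →
      ‖∫ z, k z • fderiv ℝ v (x + t • z) (ebase i)‖ ≤ M * t⁻¹ * I := by
    intro k hk hkc hk0 i hkM
    rw [ibp_kernel hk hkc hv x _ ht.ne', norm_smul, norm_neg, norm_inv, Real.norm_of_nonneg ht.le]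
    have hts : tsupport k ⊆ closedBall 0 1 := closure_minimal
      (fun z hz => by by_contra h; exact hz (hk0 z h)) isClosed_closedBall
    have : ‖∫ z, fderiv ℝ k z (ebase i) • (v (x + t • z) - v x)‖ ≤ M * I := by
      have e : ∫ z, fderiv ℝ k z (ebase i) • (v (x + t • z) - v x)
          = ∫ z in closedBall 0 1, fderiv ℝ k z (ebase i) • (v (x + t • z) - v x) := by
        rw [setIntegral_eq_integral_of_forall_compl_eq_zero]
        intro z hz
        have : fderiv ℝ k z = 0 := by
          by_contra h
          exact hz (hts (support_fderiv_subset ℝ h))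
        simp [this]
      rw [e, hI, ← integral_const_mul]
      refine norm_integral_le_of_norm_le ?_ (Eventually.of_forall fun z => ?_)
      · exact (Continuous.continuousOn (by fun_prop)).integrableOn_compact (isCompact_closedBall _ _)
      · rw [norm_smul]
        exact mul_le_mul_of_nonneg_right (hkM z) (norm_nonneg _)
    calc t⁻¹ * _ ≤ t⁻¹ * (M * I) := by gcongr
      _ = _ := by ring
  refine ContinuousLinearMap.opNorm_le_bound _ (by positivity) fun w => ?_
  rw [fderiv_extv_apply hv]
  have hdec : ∀ z, eta n z • fderiv ℝ v (x + t • z) (w.1 + w.2 • z)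
      = ∑ i, (w.1 i • (eta n z • fderiv ℝ v (x + t • z) (ebase i))
        + w.2 • ((z i * eta n z) • fderiv ℝ v (x + t • z) (ebase i))) := by
    intro z
    rw [map_add, map_smul, clm_euc_sum _ w.1, clm_euc_sum _ z, Finset.smul_sum, ← Finset.sum_add_distrib, Finset.smul_sum]
    refine Finset.sum_congr rfl fun i _ => ?_
    simp only [smul_add, smul_smul]
    congr 2 <;> ring
  have hi : ∀ (k : Euc n → ℝ), Continuous k → HasCompactSupport k → ∀ i : Fin n,
      Integrable (fun z => k z • fderiv ℝ v (x + t • z) (ebase i)) := by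
    intro k hk hkc i
    refine Continuous.integrable_of_hasCompactSupport ?_ hkc.smul_right
    exact hk.smul ((hv'.comp (by fun_prop)).clm_apply continuous_const)
  have hzc : ∀ i : Fin n, ContDiff ℝ 1 (fun z : Euc n => z i * eta n z) := fun i =>
    (EuclideanSpace.proj i : Euc n →L[ℝ] ℝ).contDiff.mul (eta_contDiff n (k := 1))
  have hint1 := fun i => (hi (eta n) hη (eta_compact n) i)
  have hint2 := fun i => (hi (fun z => z i * eta n z) (hzc i).continuous (eta_compact n).mul_left i)
  simp_rw [hdec]
  have hint3 : ∀ i, Integrable (fun z => w.1 i • (eta n z • fderiv ℝ v (x + t • z) (ebase i))) :=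
    fun i => (hint1 i).smul (w.1 i)
  have hint4 : ∀ i, Integrable (fun z => w.2 • ((z i * eta n z) • fderiv ℝ v (x + t • z) (ebase i))) :=
    fun i => (hint2 i).smul w.2
  have hintg : ∀ i, Integrable (fun z => w.1 i • (eta n z • fderiv ℝ v (x + t • z) (ebase i))
        + w.2 • ((z i * eta n z) • fderiv ℝ v (x + t • z) (ebase i))) :=
    fun i => (hint3 i).add (hint4 i)
  rw [integral_finsetSum _ (fun i _ => hintg i)]
  have hw : ∀ i, ‖∫ z, (w.1 i • (eta n z • fderiv ℝ v (x + t • z) (ebase i))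
        + w.2 • ((z i * eta n z) • fderiv ℝ v (x + t • z) (ebase i)))‖ ≤ (M + M) * t⁻¹ * I * ‖w‖ := by
    intro i
    rw [integral_add (hint3 i) (hint4 i), integral_smul, integral_smul]
    have b1 : |w.1 i| ≤ ‖w‖ := (PiLp.norm_apply_le w.1 i).trans (norm_fst_le w)
    have b2 : |w.2| ≤ ‖w‖ := norm_snd_le w
    have k1 := hker (eta n) (eta_contDiff n (k := 1)) (eta_compact n) (fun z hz => eta_zero hz) i (fun z => (hM i z).1)
    have k2 := hker _ (hzc i) (eta_compact n).mul_left (fun z hz => by simp [eta_zero hz]) i (fun z => (hM i z).2)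
    calc _ ≤ |w.1 i| * ‖∫ z, eta n z • fderiv ℝ v (x + t • z) (ebase i)‖
          + |w.2| * ‖∫ z, (z i * eta n z) • fderiv ℝ v (x + t • z) (ebase i)‖ := by
          refine (norm_add_le _ _).trans ?_
          rw [norm_smul, norm_smul]; rfl
      _ ≤ ‖w‖ * (M * t⁻¹ * I) + ‖w‖ * (M * t⁻¹ * I) := by gcongr
      _ = _ := by ring
  refine (norm_sum_le _ _).trans ((Finset.sum_le_sum fun i _ => hw i).trans (le_of_eq ?_))
  rw [← Finset.sum_mul, ← Finset.sum_mul, ← Finset.sum_mul]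

end

section

/-! ### The divergence identity on the half space -/

def slc (n : ℕ) (L : (Euc n × ℝ) →L[ℝ] Euc n) : Matrix (Fin n) (Fin n) ℝ :=
  Matrix.of fun k i => L (ebase i, 0) k

def Dform (n : ℕ) (L : (Euc n × ℝ) →L[ℝ] Euc n) (l : (Euc n × ℝ) →L[ℝ] ℝ) : ℝ :=
  l (0, 1) * (slc n L).det
    - ∑ j, L (0, 1) j * ((slc n L).updateRow j (fun i => l (ebase i, 0))).det

lemma continuous_slc (n : ℕ) : Continuous (slc n) := by
  refine continuous_matrix fun k i => ?_
  exact (EuclideanSpace.proj k : Euc n →L[ℝ] ℝ).continuous.comp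
    (ContinuousLinearMap.apply ℝ (Euc n) ((ebase i, 0) : Euc n × ℝ)).continuous

lemma continuous_Dform (n : ℕ) : Continuous (fun q : ((Euc n × ℝ) →L[ℝ] Euc n) × ((Euc n × ℝ) →L[ℝ] ℝ) =>
    Dform n q.1 q.2) := by
  have h2 : ∀ w : Euc n × ℝ, Continuous (fun q : ((Euc n × ℝ) →L[ℝ] Euc n) × ((Euc n × ℝ) →L[ℝ] ℝ) => q.2 w) :=
    fun w => (ContinuousLinearMap.apply ℝ ℝ w).continuous.comp continuous_snd
  have h1 : ∀ (w : Euc n × ℝ) (j : Fin n), Continuous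
      (fun q : ((Euc n × ℝ) →L[ℝ] Euc n) × ((Euc n × ℝ) →L[ℝ] ℝ) => q.1 w j) :=
    fun w j => (EuclideanSpace.proj j : Euc n →L[ℝ] ℝ).continuous.comp
      ((ContinuousLinearMap.apply ℝ (Euc n) w).continuous.comp continuous_fst)
  have hs := (continuous_slc n).comp
    (continuous_fst (X := (Euc n × ℝ) →L[ℝ] Euc n) (Y := (Euc n × ℝ) →L[ℝ] ℝ))
  refine ((h2 _).mul hs.matrix_det).sub (continuous_finsetSum _ fun j _ => (h1 _ j).mul ?_)
  exact (hs.matrix_updateRow j (continuous_pi fun i => h2 _)).matrix_det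

lemma norm_slc_le {n : ℕ} (L : (Euc n × ℝ) →L[ℝ] Euc n) {X : ℝ} (hL : ‖L‖ ≤ X) (k : Fin n) :
    ‖(slc n L) k‖ ≤ X := by
  have hX : 0 ≤ X := (norm_nonneg L).trans hL
  rw [pi_norm_le_iff_of_nonneg hX]
  intro i
  calc ‖L (ebase i, 0) k‖ ≤ ‖L (ebase i, 0)‖ := PiLp.norm_apply_le _ k
    _ ≤ ‖L‖ * ‖((ebase i, 0) : Euc n × ℝ)‖ := L.le_opNorm _
    _ ≤ X := by simpa [Prod.norm_def] using hL

lemma norm_dt_le {n : ℕ} (L : (Euc n × ℝ) →L[ℝ] Euc n) {X : ℝ} (hL : ‖L‖ ≤ X) (k : Fin n) :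
    |L (0, 1) k| ≤ X := by
  calc ‖L (0, 1) k‖ ≤ ‖L (0, 1)‖ := PiLp.norm_apply_le _ k
    _ ≤ ‖L‖ * ‖((0, 1) : Euc n × ℝ)‖ := L.le_opNorm _
    _ ≤ X := by simpa [Prod.norm_def] using hL

lemma detCM_bounds (n : ℕ) {X Y : ℝ} (hX : 0 ≤ X) (hY : 0 ≤ Y) (A B : Matrix (Fin n) (Fin n) ℝ)
    (hA : ∀ k, ‖A k‖ ≤ X) (hB : ∀ k, ‖B k‖ ≤ X) (hAB : ∀ k, ‖A k - B k‖ ≤ Y) :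
    |A.det| ≤ ‖detCM n‖ * X ^ n ∧
    |A.det - B.det| ≤ ‖detCM n‖ * n * X ^ (n - 1) * Y := by
  have hA' : ‖(show Fin n → Fin n → ℝ from A)‖ ≤ X := (pi_norm_le_iff_of_nonneg hX).2 hA
  have hB' : ‖(show Fin n → Fin n → ℝ from B)‖ ≤ X := (pi_norm_le_iff_of_nonneg hX).2 hB
  have hAB' : ‖(show Fin n → Fin n → ℝ from A - B)‖ ≤ Y := (pi_norm_le_iff_of_nonneg hY).2 hAB
  constructor
  · have := (detCM n).le_opNorm A
    refine this.trans ?_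
    gcongr
    refine (Finset.prod_le_prod (fun _ _ => norm_nonneg _) (fun k _ => hA k)).trans ?_
    simp
  · have := (detCM n).norm_image_sub_le A B
    refine this.trans ?_
    rw [Fintype.card_fin]
    gcongr
    · exact le_max_of_le_left (norm_nonneg _)
    · exact max_le hA' hB'
    · exact hAB'

lemma Dform_sub_le (n : ℕ) (hn : 1 ≤ n) : ∃ C : ℝ, 0 ≤ C ∧ ∀ (L L' : (Euc n × ℝ) →L[ℝ] Euc n)
    (l : (Euc n × ℝ) →L[ℝ] ℝ) (X Y : ℝ), ‖L‖ ≤ X → ‖L'‖ ≤ X → ‖L - L'‖ ≤ Y →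
    |Dform n L l - Dform n L' l| ≤ C * X ^ (n - 1) * Y * ‖l‖ := by
  set c := ‖detCM n‖ with hc
  have hc0 : 0 ≤ c := norm_nonneg _
  refine ⟨c * n + n * (c + c * n), by positivity, ?_⟩
  intro L L' l X Y hL hL' hLL
  have hX : 0 ≤ X := (norm_nonneg L).trans hL
  have hY : 0 ≤ Y := (norm_nonneg _).trans hLL
  rcases hX.eq_or_lt with h0 | hXpos
  · have e1 : L = 0 := by rw [← norm_le_zero_iff]; linarith
    have e2 : L' = 0 := by rw [← norm_le_zero_iff]; linarith
    rw [e1, e2, sub_self, abs_zero]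
    positivity
  rcases (norm_nonneg l).eq_or_lt with h0 | hlpos
  · have e1 : l = 0 := by rw [← norm_le_zero_iff]; linarith
    have hz0 : ∀ L : (Euc n × ℝ) →L[ℝ] Euc n, Dform n L 0 = 0 := by
      intro L
      have hz : ∀ j, ((slc n L).updateRow j (fun i => (0 : (Euc n × ℝ) →L[ℝ] ℝ) (ebase i, 0))).det = 0 := fun j =>
        Matrix.det_eq_zero_of_row_eq_zero j (fun i => by simp)
      simp only [Dform, hz]
      simp
    rw [e1, hz0, hz0, sub_self, abs_zero]
    positivity
  -- normalise
  set m : (Euc n × ℝ) →L[ℝ] ℝ := (X / ‖l‖) • l with hm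
  have hlm : l = (‖l‖ / X) • m := by
    rw [hm, smul_smul]; field_simp; simp
  have hmX : ‖m‖ ≤ X := by
    rw [hm, norm_smul, norm_div, norm_norm, Real.norm_of_nonneg hX]
    field_simp; exact le_rfl
  have hhom : ∀ L : (Euc n × ℝ) →L[ℝ] Euc n, Dform n L l = (‖l‖ / X) * Dform n L m := by
    intro L
    set a := ‖l‖ / X
    rw [hlm]
    have : ∀ j, ((slc n L).updateRow j (fun i => (a • m) (ebase i, 0))).det
        = a * ((slc n L).updateRow j (fun i => m (ebase i, 0))).det := by
      intro j
      have := Matrix.det_updateRow_smul (slc n L) j a (fun i => m (ebase i, 0))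
      exact this
    simp only [Dform, this, mul_sub, Finset.mul_sum]
    congr 1
    · simp [mul_assoc]
    · refine Finset.sum_congr rfl fun j _ => by ring
  rw [hhom, hhom, ← mul_sub, abs_mul, abs_of_nonneg (by positivity)]
  have hrows : ∀ k, ‖slc n L k - slc n L' k‖ ≤ Y := fun k => norm_slc_le (L - L') hLL k
  have hp : ‖(fun i : Fin n => m (ebase i, 0))‖ ≤ X := by
    rw [pi_norm_le_iff_of_nonneg hX]
    intro i
    refine (m.le_opNorm _).trans ?_
    simpa [Prod.norm_def] using hmX
  have hq : |m (0, 1)| ≤ X := by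
    refine (m.le_opNorm _).trans ?_
    simpa [Prod.norm_def] using hmX
  have hd0 := detCM_bounds n hX hY (slc n L) (slc n L') (norm_slc_le L hL) (norm_slc_le L' hL') hrows
  have hdj : ∀ j, _ := fun j => detCM_bounds n hX hY
    ((slc n L).updateRow j (fun i => m (ebase i, 0))) ((slc n L').updateRow j (fun i => m (ebase i, 0)))
    (fun k => by
      by_cases h : k = j
      · subst h; rw [Matrix.updateRow_self]; exact hp
      · rw [Matrix.updateRow_ne h]; exact norm_slc_le L hL k)
    (fun k => by
      by_cases h : k = j
      · subst h; rw [Matrix.updateRow_self]; exact hp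
      · rw [Matrix.updateRow_ne h]; exact norm_slc_le L' hL' k)
    (fun k => by
      by_cases h : k = j
      · subst h; rw [Matrix.updateRow_self, Matrix.updateRow_self, sub_self, norm_zero]; exact hY
      · rw [Matrix.updateRow_ne h, Matrix.updateRow_ne h]; exact hrows k)
  have hXn : X ^ n = X ^ (n - 1) * X := by rw [← pow_succ, Nat.sub_add_cancel hn]
  have t0 : |m (0, 1) * (slc n L).det - m (0, 1) * (slc n L').det| ≤ c * n * (X ^ n * Y) := by
    rw [← mul_sub, abs_mul]
    calc _ ≤ X * (c * n * X ^ (n - 1) * Y) := by gcongr; exact hd0.2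
      _ = _ := by rw [hXn]; ring
  have tj : ∀ j, |L (0, 1) j * ((slc n L).updateRow j (fun i => m (ebase i, 0))).det
      - L' (0, 1) j * ((slc n L').updateRow j (fun i => m (ebase i, 0))).det| ≤ (c + c * n) * (X ^ n * Y) := by
    intro j
    obtain ⟨h1, h2⟩ := hdj j
    set d := ((slc n L).updateRow j (fun i => m (ebase i, 0))).det
    set d' := ((slc n L').updateRow j (fun i => m (ebase i, 0))).det
    have e : L (0, 1) j * d - L' (0, 1) j * d' = (L - L') (0, 1) j * d + L' (0, 1) j * (d - d') := by
      simp; ring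
    rw [e]
    refine (abs_add_le _ _).trans ?_
    rw [abs_mul, abs_mul]
    calc _ ≤ Y * (c * X ^ n) + X * (c * n * X ^ (n - 1) * Y) := by
          gcongr
          · exact norm_dt_le _ hLL j
          · exact norm_dt_le _ hL' j
      _ = _ := by rw [hXn]; ring
  have tot : |Dform n L m - Dform n L' m| ≤ (c * n + n * (c + c * n)) * (X ^ n * Y) := by
    have e : Dform n L m - Dform n L' m = (m (0, 1) * (slc n L).det - m (0, 1) * (slc n L').det)
        - ∑ j, (L (0, 1) j * ((slc n L).updateRow j (fun i => m (ebase i, 0))).det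
      - L' (0, 1) j * ((slc n L').updateRow j (fun i => m (ebase i, 0))).det) := by
      simp only [Dform, Finset.sum_sub_distrib]; ring
    rw [e]
    refine (abs_sub _ _).trans ?_
    have := (Finset.abs_sum_le_sum_abs _ _).trans (Finset.sum_le_sum fun j (_ : j ∈ Finset.univ) => tj j)
    simp only [Finset.sum_const, Finset.card_univ, Fintype.card_fin, nsmul_eq_mul] at this
    calc _ ≤ c * n * (X ^ n * Y) + n * ((c + c * n) * (X ^ n * Y)) := add_le_add t0 this
      _ = _ := by ring
  calc _ ≤ ‖l‖ / X * ((c * n + n * (c + c * n)) * (X ^ n * Y)) := by gcongr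
    _ = _ := by rw [hXn]; field_simp

/-- the basic identity -/
lemma ext_identity {n : ℕ} {V : Euc n × ℝ → Euc n} (hV : ContDiff ℝ 2 V)
    {Φ : Euc n × ℝ → ℝ} (hΦ : ContDiff ℝ 1 Φ) {K : Set (Euc n)} (hK : IsCompact K) {t0 : ℝ} (ht0 : 0 < t0)
    (hΦK : ∀ x, x ∉ K → ∀ t ∈ Set.Icc 0 t0, Φ (x, t) = 0) (hΦ0 : ∀ x, Φ (x, t0) = 0) :
    ∫ x in K, Φ (x, 0) * (jacMat n (fun x => V (x, 0)) x).det
      = - ∫ q in K ×ˢ Set.Ioc 0 t0, Dform n (fderiv ℝ V q) (fderiv ℝ Φ q) := by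
  have hV' : ContDiff ℝ 1 (fderiv ℝ V) := hV.fderiv_right (by norm_num)
  have hVc : Continuous (fderiv ℝ V) := hV'.continuous
  have hVcc : Continuous (fderiv ℝ (fderiv ℝ V)) := hV'.continuous_fderiv (by norm_num)
  have hΦc : Continuous (fderiv ℝ Φ) := hΦ.continuous_fderiv (by norm_num)
  have hinl : ∀ (x : Euc n) (t : ℝ), HasFDerivAt (fun x : Euc n => (x, t)) (ContinuousLinearMap.inl ℝ (Euc n) ℝ) x :=
    fun x t => hasFDerivAt_prodMk_left x t
  have hinr : ∀ (x : Euc n) (t : ℝ), HasDerivAt (fun t : ℝ => (x, t)) ((0, 1) : Euc n × ℝ) t :=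
    fun x t => (hasDerivAt_const t x).prodMk (hasDerivAt_id t)
  have hjac : ∀ x t, jacMat n (fun x => V (x, t)) x = slc n (fderiv ℝ V (x, t)) := by
    intro x t
    have h1 : HasFDerivAt (fun x => V (x, t)) ((fderiv ℝ V (x, t)).comp (ContinuousLinearMap.inl ℝ (Euc n) ℝ)) x :=
      (hV.differentiable (by norm_num) (x, t)).hasFDerivAt.comp x (hinl x t)
    ext k i
    simp [jacMat, slc, h1.fderiv]
  -- mixed second derivatives
  set r : Fin n → Euc n × ℝ → Fin n → ℝ := fun j q i => fderiv ℝ (fderiv ℝ V) q (0, 1) (ebase i, 0) j with hr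
  have hrc : ∀ j, Continuous (r j) := fun j => continuous_pi fun i =>
    (EuclideanSpace.proj j : Euc n →L[ℝ] ℝ).continuous.comp
      ((hVcc.clm_apply continuous_const).clm_apply continuous_const)
  have hsl : Continuous fun q => slc n (fderiv ℝ V q) := (continuous_slc n).comp hVc
  set g' : Euc n × ℝ → ℝ := fun q => fderiv ℝ Φ q (0, 1) * (slc n (fderiv ℝ V q)).det
    + Φ q * ∑ j, ((slc n (fderiv ℝ V q)).updateRow j (r j q)).det with hg'
  have hg'c : Continuous g' := by
    refine ((hΦc.clm_apply continuous_const).mul hsl.matrix_det).add (hΦ.continuous.mul ?_)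
    exact continuous_finsetSum _ fun j _ => (hsl.matrix_updateRow j (hrc j)).matrix_det
  have hder : ∀ x t, HasDerivAt (fun t => Φ (x, t) * (slc n (fderiv ℝ V (x, t))).det) (g' (x, t)) t := by
    intro x t
    have h1 : HasDerivAt (fun t => Φ (x, t)) (fderiv ℝ Φ (x, t) (0, 1)) t :=
      (hΦ.differentiable (by norm_num) (x, t)).hasFDerivAt.comp_hasDerivAt t (hinr x t)
    have h2 : HasDerivAt (fun t => (slc n (fderiv ℝ V (x, t))).det)
        (∑ j, ((slc n (fderiv ℝ V (x, t))).updateRow j (r j (x, t))).det) t := by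
      refine hasDerivAt_det fun j => ?_
      rw [hasDerivAt_pi]
      intro i
      have h3 : HasDerivAt (fun t => fderiv ℝ V (x, t)) (fderiv ℝ (fderiv ℝ V) (x, t) (0, 1)) t :=
        (hV'.differentiable (by norm_num) (x, t)).hasFDerivAt.comp_hasDerivAt t (hinr x t)
      have h4 := ((EuclideanSpace.proj j : Euc n →L[ℝ] ℝ).comp
        (ContinuousLinearMap.apply ℝ (Euc n) ((ebase i, 0) : Euc n × ℝ))).hasFDerivAt.comp_hasDerivAt t h3
      exact h4
    exact h1.mul h2
  -- the functions h_j
  set hj : Fin n → ℝ → Euc n → ℝ := fun j t x => fderiv ℝ V (x, t) (0, 1) j * Φ (x, t) with hhj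
  have hpair : ∀ t : ℝ, ContDiff ℝ 2 (fun x : Euc n => (x, t)) := fun t => contDiff_id.prodMk contDiff_const
  have hdjC : ∀ j t, ContDiff ℝ 1 (fun x => fderiv ℝ V (x, t) (0, 1) j) := fun j t =>
    (EuclideanSpace.proj j : Euc n →L[ℝ] ℝ).contDiff.comp
      ((hV'.comp ((hpair t).of_le (by norm_num))).clm_apply contDiff_const)
  have hhjC : ∀ j t, ContDiff ℝ 1 (hj j t) := fun j t =>
    (hdjC j t).mul (hΦ.comp ((hpair t).of_le (by norm_num)))
  have hgrad : ∀ j t x, gradRow n (hj j t) x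
      = Φ (x, t) • r j (x, t) + (fderiv ℝ V (x, t) (0, 1) j) • (fun i => fderiv ℝ Φ (x, t) (ebase i, 0)) := by
    intro j t x
    have h1 : HasFDerivAt (fun x => Φ (x, t)) ((fderiv ℝ Φ (x, t)).comp (ContinuousLinearMap.inl ℝ (Euc n) ℝ)) x :=
      (hΦ.differentiable (by norm_num) (x, t)).hasFDerivAt.comp x (hinl x t)
    have h2 : HasFDerivAt (fun x => fderiv ℝ V (x, t)) ((fderiv ℝ (fderiv ℝ V) (x, t)).comp (ContinuousLinearMap.inl ℝ (Euc n) ℝ)) x :=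
      (hV'.differentiable (by norm_num) (x, t)).hasFDerivAt.comp x (hinl x t)
    have h3 := ((EuclideanSpace.proj j : Euc n →L[ℝ] ℝ).comp
        (ContinuousLinearMap.apply ℝ (Euc n) ((0, 1) : Euc n × ℝ))).hasFDerivAt.comp x h2
    have h4 : HasFDerivAt (hj j t) _ x := h3.mul h1
    ext i
    rw [gradRow, h4.fderiv]
    have hs : IsSymmSndFDerivAt ℝ V (x, t) := hV.contDiffAt.isSymmSndFDerivAt (by simp)
    have hs2 := hs.eq (ebase i, 0) (0, 1)
    simp [hr, ← hs2]
    ring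
  -- vanishing
  have hz : ∀ j, ∀ t ∈ Set.Icc 0 t0, ∀ x, x ∉ K → gradRow n (hj j t) x = 0 := by
    intro j t ht x hx
    have : hj j t =ᶠ[𝓝 x] fun _ => 0 := by
      filter_upwards [hK.isClosed.isOpen_compl.mem_nhds hx] with y hy
      simp [hhj, hΦK y hy t ht]
    ext i
    simp [gradRow, this.fderiv_eq]
  have hcs : ∀ j, ∀ t ∈ Set.Icc 0 t0, HasCompactSupport (hj j t) := fun j t ht =>
    HasCompactSupport.intro hK fun x hx => by simp [hhj, hΦK x hx t ht]
  have hI0 : ∀ j, ∀ t ∈ Set.Icc 0 t0, ∫ x in K, ((slc n (fderiv ℝ V (x, t))).updateRow j (gradRow n (hj j t) x)).det = 0 := by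
    intro j t ht
    have h := integral_det_row_eq_zero (V := fun x => V (x, t)) (hV.comp (hpair t)) (hhjC j t) (hcs j t ht) j
    simp_rw [hjac] at h
    rw [← h]
    apply setIntegral_eq_integral_of_forall_compl_eq_zero
    intro x hx
    rw [hz j t ht x hx]
    exact Matrix.det_eq_zero_of_row_eq_zero j (fun i => by simp)
  have hDg : ∀ x t, Dform n (fderiv ℝ V (x, t)) (fderiv ℝ Φ (x, t))
      = g' (x, t) - ∑ j, ((slc n (fderiv ℝ V (x, t))).updateRow j (gradRow n (hj j t) x)).det := by
    intro x t
    simp only [hgrad, Matrix.det_updateRow_add, Matrix.det_updateRow_smul, Finset.sum_add_distrib, hg', Dform,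
      Finset.mul_sum]
    ring
  have hgradc : ∀ j, Continuous (fun q : Euc n × ℝ => gradRow n (hj j q.2) q.1) := by
    intro j
    simp only [hgrad]
    have c1 : Continuous (fun q : Euc n × ℝ => fderiv ℝ V (q.1, q.2) (0, 1) j) :=
      (EuclideanSpace.proj j : Euc n →L[ℝ] ℝ).continuous.comp (hVc.clm_apply continuous_const)
    have c2 : Continuous (fun (q : Euc n × ℝ) (i : Fin n) => fderiv ℝ Φ (q.1, q.2) (ebase i, 0)) :=
      continuous_pi fun i => hΦc.clm_apply continuous_const
    exact (hΦ.continuous.smul (hrc j)).add (c1.smul c2)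
  have hintg : ∀ G : Euc n × ℝ → ℝ, Continuous G → IntegrableOn G (K ×ˢ Set.Ioc 0 t0) (volume.prod volume) := by
    intro G hG
    exact (hG.continuousOn.integrableOn_compact (hK.prod isCompact_Icc)).mono_set
      (Set.prod_mono le_rfl Set.Ioc_subset_Icc_self)
  have hintK : ∀ G : Euc n → ℝ, Continuous G → IntegrableOn G K := fun G hG =>
    hG.continuousOn.integrableOn_compact hK
  have hDc : Continuous (fun q => Dform n (fderiv ℝ V q) (fderiv ℝ Φ q)) :=
    (continuous_Dform n).comp (hVc.prodMk hΦc)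
  -- assemble
  have e1 : ∫ q in K ×ˢ Set.Ioc 0 t0, Dform n (fderiv ℝ V q) (fderiv ℝ Φ q)
      = ∫ q in K ×ˢ Set.Ioc 0 t0, g' q := by
    have hD := hintg _ hDc
    have hg := hintg _ hg'c
    change ∫ q in K ×ˢ Set.Ioc 0 t0, _ ∂(volume.prod volume) = ∫ q in K ×ˢ Set.Ioc 0 t0, _ ∂(volume.prod volume)
    rw [IntegrableOn, ← Measure.prod_restrict] at hD hg
    rw [← Measure.prod_restrict, integral_prod_symm _ hD, integral_prod_symm _ hg]
    refine setIntegral_congr_fun measurableSet_Ioc fun t ht => ?_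
    have ht' := Set.Ioc_subset_Icc_self ht
    have hct : Continuous fun x : Euc n => (x, t) := (hpair t).continuous
    have hc2 : ∀ j, Continuous fun x => ((slc n (fderiv ℝ V (x, t))).updateRow j (gradRow n (hj j t) x)).det := fun j =>
      ((hsl.comp hct).matrix_updateRow j ((hgradc j).comp hct)).matrix_det
    simp only [hDg]
    rw [integral_sub (f := fun x => g' (x, t)) (hintK _ (hg'c.comp hct)) (hintK _ (continuous_finsetSum _ fun j _ => hc2 j)),
      integral_finsetSum _ (fun j _ => hintK _ (hc2 j)), Finset.sum_eq_zero (fun j _ => hI0 j t ht'), sub_zero]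
  rw [e1]
  change _ = - ∫ q in K ×ˢ Set.Ioc 0 t0, g' q ∂(volume.prod volume)
  rw [setIntegral_prod _ (hintg _ hg'c), ← integral_neg]
  refine setIntegral_congr_fun hK.measurableSet fun x _ => ?_
  have hcx : Continuous fun t : ℝ => (x, t) := by fun_prop
  have := intervalIntegral.integral_eq_sub_of_hasDerivAt (a := 0) (b := t0) (fun t _ => hder x t)
    ((hg'c.comp hcx).intervalIntegrable _ _)
  rw [intervalIntegral.integral_of_le ht0.le] at this
  simp only [hjac, this, hΦ0]
  ring

end

section

/-! ### Energies and the trace estimate -/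

def energy {F : Type*} [NormedAddCommGroup F] (n p : ℕ) (S : Set (Euc n)) (v : Euc n → F) : ENNReal :=
  ∫⁻ q, ‖v q.1 - v q.2‖ₑ ^ p / edist q.1 q.2 ^ (n + p - 1)
    ∂((volume.restrict S).prod (volume.restrict S))

lemma lintegral_pow_le {α : Type*} [MeasurableSpace α] (μ : Measure α) {f : α → ENNReal}
    (hf : AEMeasurable f μ) {p : ℕ} (hp : 1 ≤ p) :
    (∫⁻ x, f x ∂μ) ^ p ≤ μ Set.univ ^ (p - 1) * ∫⁻ x, f x ^ p ∂μ := by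
  rcases hp.eq_or_lt with h1 | h1
  · subst h1; simp
  have hp1 : (1 : ℝ) < p := by exact_mod_cast h1
  have hp0 : (p : ℝ) ≠ 0 := by positivity
  have hpq := Real.HolderConjugate.conjExponent hp1
  have h := ENNReal.lintegral_mul_le_Lp_mul_Lq μ hpq hf (g := fun _ => 1) aemeasurable_const
  simp only [Pi.mul_apply, mul_one, ENNReal.one_rpow, lintegral_const, one_mul, ENNReal.rpow_natCast] at h
  calc (∫⁻ x, f x ∂μ) ^ p ≤ ((∫⁻ a, f a ^ p ∂μ) ^ (1 / (p : ℝ)) * μ Set.univ ^ (1 / (p : ℝ).conjExponent)) ^ p := by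
        gcongr
    _ = _ := by
        rw [mul_pow, ← ENNReal.rpow_natCast, ← ENNReal.rpow_mul, one_div, inv_mul_cancel₀ hp0, ENNReal.rpow_one,
          ← ENNReal.rpow_natCast, ← ENNReal.rpow_mul, mul_comm]
        congr 1
        rw [← ENNReal.rpow_natCast]
        congr 1
        rw [Real.conjExponent, Nat.cast_sub hp]
        have : (p : ℝ) - 1 ≠ 0 := by linarith
        field_simp
        simp

lemma lintegral_comp_add_smul {n : ℕ} (x : Euc n) {t : ℝ} (ht : 0 < t) {f : Euc n → ENNReal}
    (hf : Measurable f) : ∫⁻ z, f (x + t • z) = ENNReal.ofReal t⁻¹ ^ n * ∫⁻ y, f y := by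
  have h1 : ∫⁻ z, f (x + t • z) = ∫⁻ y, f (x + y) ∂(Measure.map (fun z : Euc n => t • z) volume) := by
    rw [lintegral_map (by fun_prop) (by fun_prop)]
  rw [h1, Measure.map_addHaar_smul _ ht.ne', lintegral_smul_measure, lintegral_add_left_eq_self f x]
  congr 1
  rw [← inv_pow, abs_of_nonneg (by positivity), ENNReal.ofReal_pow (by positivity)]
  simp

lemma lintegral_inv_pow_le {m : ℕ} (hm : 1 ≤ m) {r : ℝ} (hr : 0 < r) :
    ∫⁻ t in Set.Ici r, ENNReal.ofReal t⁻¹ ^ (m + 1) ≤ (ENNReal.ofReal r ^ m)⁻¹ := by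
  rw [← restrict_Ioi_eq_restrict_Ici]
  have hm' : (1 : ℝ) ≤ m := by exact_mod_cast hm
  have ha : (-((m : ℝ) + 1)) < -1 := by linarith
  have h1 : ∫⁻ t in Set.Ioi r, ENNReal.ofReal t⁻¹ ^ (m + 1)
      = ∫⁻ t in Set.Ioi r, ENNReal.ofReal (t ^ (-((m : ℝ) + 1))) := by
    refine setLIntegral_congr_fun measurableSet_Ioi fun t ht => ?_
    have ht0 : 0 < t := hr.trans ht
    rw [← ENNReal.ofReal_pow (by positivity), Real.rpow_neg ht0.le, inv_pow]
    congr 2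
    exact_mod_cast (Real.rpow_natCast t (m + 1)).symm
  rw [h1, ← ofReal_integral_eq_lintegral_ofReal (integrableOn_Ioi_rpow_of_lt ha hr), integral_Ioi_rpow_of_lt ha hr,
    ← ENNReal.ofReal_pow hr.le, ← ENNReal.ofReal_inv_of_pos (by positivity)]
  · refine ENNReal.ofReal_le_ofReal ?_
    have e : -((m : ℝ) + 1) + 1 = -m := by ring
    rw [e, neg_div_neg_eq, Real.rpow_neg hr.le, Real.rpow_natCast]
    exact div_le_self (by positivity) hm'
  · filter_upwards [ae_restrict_mem measurableSet_Ioi] with t ht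
    have ht0 : 0 < t := hr.trans ht
    positivity

lemma energy_ext_bound (n p : ℕ) (hn : 1 ≤ n) (hp : 1 ≤ p) : ∃ C : ENNReal, C ≠ ⊤ ∧
    ∀ {F : Type} [NormedAddCommGroup F] [NormedSpace ℝ F] [CompleteSpace F] [SecondCountableTopology F]
      (v : Euc n → F)
      (_ : ContDiff ℝ 1 v) (K : Set (Euc n)) (_ : IsCompact K) (t0 : ℝ) (_ : 0 < t0),
      ∫⁻ q in K ×ˢ Set.Ioc 0 t0, ‖fderiv ℝ (extv n v) q‖ₑ ^ p ≤ C * energy n p (cthickening t0 K) v := by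
  obtain ⟨C, hC0, hC⟩ := exists_fderiv_extv_bound n
  set b : ENNReal := volume (closedBall (0 : Euc n) 1) with hb
  have hbt : b ≠ ⊤ := (isCompact_closedBall _ _).measure_lt_top.ne
  refine ⟨ENNReal.ofReal C ^ p * b ^ (p - 1), ENNReal.mul_ne_top (ENNReal.pow_ne_top ENNReal.ofReal_ne_top)
    (ENNReal.pow_ne_top hbt), ?_⟩
  intro F _ _ _ _ v hv K hK t0 ht0
  set C' := ENNReal.ofReal C ^ p * b ^ (p - 1) with hC'
  borelize F
  have hvc := hv.continuous
  -- the integrand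
  set G : Euc n → Euc n → ENNReal := fun x y => ‖v x - v y‖ₑ ^ p with hG
  have hGm : Measurable (Function.uncurry G) := by
    have : Continuous (fun q : Euc n × Euc n => ‖v q.1 - v q.2‖ₑ) := by fun_prop
    exact this.measurable.pow_const p
  have hGx : ∀ x, Measurable (G x) := fun x => hGm.comp measurable_prodMk_left
  -- pointwise bound
  have hA : ∀ x, ∀ t ∈ Set.Ioc 0 t0, ‖fderiv ℝ (extv n v) (x, t)‖ₑ ^ p ≤
      C' * ∫⁻ y, (closedBall x t).indicator (fun y => ENNReal.ofReal t⁻¹ ^ (n + p) * G x y) y := by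
    intro x t ht
    have ht' : 0 < t := ht.1
    have h1 := hC v hv x t ht'
    have hc : Continuous fun z => v (x + t • z) - v x := by fun_prop
    have hi : Integrable (fun z => v (x + t • z) - v x) (volume.restrict (closedBall (0 : Euc n) 1)) :=
      hc.continuousOn.integrableOn_compact (isCompact_closedBall _ _)
    have h2 : ‖fderiv ℝ (extv n v) (x, t)‖ₑ ≤ ENNReal.ofReal C * ENNReal.ofReal t⁻¹ *
        ∫⁻ z in closedBall (0 : Euc n) 1, ‖v (x + t • z) - v x‖ₑ := by
      rw [← ofReal_norm, ← ofReal_integral_norm_eq_lintegral_enorm hi,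
        ← ENNReal.ofReal_mul hC0, ← ENNReal.ofReal_mul (by positivity)]
      exact ENNReal.ofReal_le_ofReal h1
    have h3 := lintegral_pow_le (volume.restrict (closedBall (0 : Euc n) 1)) hc.enorm.measurable.aemeasurable hp
    rw [Measure.restrict_apply_univ] at h3
    have h4 : ∫⁻ z in closedBall (0 : Euc n) 1, ‖v (x + t • z) - v x‖ₑ ^ p
        = ENNReal.ofReal t⁻¹ ^ n * ∫⁻ y, (closedBall x t).indicator (G x) y := by
      rw [← lintegral_comp_add_smul x ht' ((hGx x).indicator measurableSet_closedBall),
        ← lintegral_indicator measurableSet_closedBall]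
      refine lintegral_congr fun z => ?_
      by_cases hz : z ∈ closedBall (0 : Euc n) 1
      · rw [Set.indicator_of_mem hz, Set.indicator_of_mem]
        · simp only [hG]; rw [← enorm_neg, neg_sub]
        · rw [mem_closedBall, dist_eq_norm] at hz ⊢
          simp only [sub_zero, add_sub_cancel_left, norm_smul, Real.norm_of_nonneg ht'.le] at hz ⊢
          nlinarith
      · rw [Set.indicator_of_notMem hz, Set.indicator_of_notMem]
        rw [mem_closedBall, dist_eq_norm] at hz ⊢
        simp only [sub_zero, add_sub_cancel_left, norm_smul, Real.norm_of_nonneg ht'.le] at hz ⊢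
        intro h; apply hz; nlinarith
    have h5 : ∀ y, (closedBall x t).indicator (fun y => ENNReal.ofReal t⁻¹ ^ (n + p) * G x y) y
        = ENNReal.ofReal t⁻¹ ^ (n + p) * (closedBall x t).indicator (G x) y := by
      intro y
      by_cases hy : y ∈ closedBall x t
      · simp [hy]
      · simp [hy]
    simp_rw [h5]
    rw [lintegral_const_mul _ ((hGx x).indicator measurableSet_closedBall)]
    calc ‖fderiv ℝ (extv n v) (x, t)‖ₑ ^ p ≤ (ENNReal.ofReal C * ENNReal.ofReal t⁻¹ *
        ∫⁻ z in closedBall (0 : Euc n) 1, ‖v (x + t • z) - v x‖ₑ) ^ p := by gcongr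
      _ ≤ ENNReal.ofReal C ^ p * ENNReal.ofReal t⁻¹ ^ p * (b ^ (p - 1) *
          ∫⁻ z in closedBall (0 : Euc n) 1, ‖v (x + t • z) - v x‖ₑ ^ p) := by
          rw [mul_pow, mul_pow]; gcongr
      _ = _ := by rw [h4, pow_add, hC']; ring
  set T : Euc n → ℝ → Euc n → ENNReal := fun x t y =>
    (closedBall x t).indicator (fun y => ENNReal.ofReal t⁻¹ ^ (n + p) * G x y) y with hT
  have hTm : ∀ x, Measurable (Function.uncurry (T x)) := by
    intro x
    have e : Function.uncurry (T x) = {q : ℝ × Euc n | dist q.2 x ≤ q.1}.indicator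
        (fun q => ENNReal.ofReal q.1⁻¹ ^ (n + p) * G x q.2) := by
      ext q
      by_cases h : dist q.2 x ≤ q.1
      · rw [Set.indicator_of_mem (by exact h)]
        simp only [hT, Function.uncurry]
        rw [Set.indicator_of_mem (by exact h)]
      · rw [Set.indicator_of_notMem (by exact h)]
        simp only [hT, Function.uncurry]
        rw [Set.indicator_of_notMem (by exact h)]
    rw [e]
    refine Measurable.indicator ?_ (measurableSet_le (by fun_prop) (by fun_prop))
    exact ((by fun_prop : Measurable fun q : ℝ × Euc n => ENNReal.ofReal q.1⁻¹).pow_const _).mul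
      ((hGx x).comp measurable_snd)
  have hcV : Continuous (fderiv ℝ (extv n v)) :=
    (contDiff_extv (k := 1) hv).continuous_fderiv (by norm_num)
  have hmV : Measurable (fun q => ‖fderiv ℝ (extv n v) q‖ₑ ^ p) := hcV.enorm.measurable.pow_const p
  set K2 := cthickening t0 K with hK2
  have hK2m : MeasurableSet K2 := isClosed_cthickening.measurableSet
  have hKK2 : K ⊆ K2 := self_subset_cthickening K
  have hin : ∀ x ∈ K, ∫⁻ t in Set.Ioc 0 t0, ‖fderiv ℝ (extv n v) (x, t)‖ₑ ^ p
      ≤ C' * ∫⁻ y in K2, G x y / edist x y ^ (n + p - 1) := by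
    intro x hx
    calc _ ≤ ∫⁻ t in Set.Ioc 0 t0, C' * ∫⁻ y, T x t y :=
          setLIntegral_mono' measurableSet_Ioc fun t ht => hA x t ht
      _ = C' * ∫⁻ t in Set.Ioc 0 t0, ∫⁻ y, T x t y := by
          rw [lintegral_const_mul]; exact (hTm x).lintegral_prod_right'
      _ = C' * ∫⁻ y, ∫⁻ t in Set.Ioc 0 t0, T x t y := by
          rw [lintegral_lintegral_swap (hTm x).aemeasurable]
      _ ≤ C' * ∫⁻ y in K2, G x y / edist x y ^ (n + p - 1) := by
          refine mul_le_mul_right ?_ _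
          rw [← lintegral_indicator hK2m]
          refine lintegral_mono fun y => ?_
          by_cases hy : y ∈ K2
          · rw [Set.indicator_of_mem hy]
            by_cases hxy : x = y
            · subst hxy
              have : ∀ t, T x t x = 0 := by
                intro t
                have hp0 : p ≠ 0 := by omega
                simp only [hT, hG, Set.indicator_apply]
                simp [hp0]
              simp [this]
            · have hr : 0 < dist y x := dist_pos.2 (Ne.symm hxy)
              calc ∫⁻ t in Set.Ioc 0 t0, T x t y ≤ ∫⁻ t, (Set.Ici (dist y x)).indicator
                    (fun t => G x y * ENNReal.ofReal t⁻¹ ^ (n + p - 1 + 1)) t := by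
                    refine (setLIntegral_le_lintegral _ _).trans (lintegral_mono fun t => ?_)
                    by_cases h : dist y x ≤ t
                    · rw [Set.indicator_of_mem (by exact h)]
                      simp only [hT]
                      rw [Set.indicator_of_mem (by exact h), mul_comm, Nat.sub_add_cancel (by omega)]
                    · simp only [hT]
                      rw [Set.indicator_of_notMem (by exact h)]
                      exact zero_le
                _ ≤ G x y / edist x y ^ (n + p - 1) := by
                    rw [lintegral_indicator measurableSet_Ici, lintegral_const_mul _ (by fun_prop), div_eq_mul_inv]
                    gcongr
                    rw [edist_comm, edist_dist]
                    exact lintegral_inv_pow_le (by omega) hr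
          · have : ∫⁻ t in Set.Ioc 0 t0, T x t y = ∫⁻ t in Set.Ioc 0 t0, 0 := by
              refine setLIntegral_congr_fun measurableSet_Ioc fun t ht => ?_
              simp only [hT]
              rw [Set.indicator_of_notMem]
              intro h
              exact hy (closedBall_subset_cthickening hx t0 (closedBall_subset_closedBall ht.2 h))
            rw [this]; simp
  change ∫⁻ q in K ×ˢ Set.Ioc 0 t0, _ ∂(volume.prod volume) ≤ _
  have hQm : Measurable (fun q : Euc n × Euc n => G q.1 q.2 / edist q.1 q.2 ^ (n + p - 1)) :=
    hGm.div (measurable_edist.pow_const _)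
  rw [setLIntegral_prod _ hmV.aemeasurable, energy, lintegral_prod _ hQm.aemeasurable,
    ← lintegral_const_mul _ hQm.lintegral_prod_right']
  calc _ ≤ ∫⁻ x in K, C' * ∫⁻ y in K2, G x y / edist x y ^ (n + p - 1) :=
        setLIntegral_mono' hK.measurableSet hin
    _ ≤ _ := lintegral_mono_set hKK2

end

section

/-! ### The two basic estimates for regular maps -/

lemma young_enn {a b l : ENNReal} (hl0 : l ≠ 0) (hlt : l ≠ ⊤) (m : ℕ) :
    a ^ m * b ≤ l * a ^ (m + 1) + l⁻¹ ^ m * b ^ (m + 1) := by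
  rcases le_total b (l * a) with h | h
  · calc a ^ m * b ≤ a ^ m * (l * a) := by gcongr
      _ = l * a ^ (m + 1) := by ring
      _ ≤ _ := le_self_add
  · have ha : a ≤ l⁻¹ * b := by
      rw [← ENNReal.mul_le_iff_le_inv hl0 hlt]; exact h
    calc a ^ m * b ≤ (l⁻¹ * b) ^ m * b := by gcongr
      _ = l⁻¹ ^ m * b ^ (m + 1) := by ring
      _ ≤ _ := le_add_self

lemma add_pow_enn (a b : ENNReal) (m : ℕ) : (a + b) ^ m ≤ 2 ^ m * (a ^ m + b ^ m) := by
  wlog h : a ≤ b generalizing a b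
  · rw [add_comm a b, add_comm (a ^ m)]; exact this b a (le_of_not_ge h)
  calc (a + b) ^ m ≤ (b + b) ^ m := by gcongr
    _ = 2 ^ m * b ^ m := by rw [← two_mul, mul_pow]
    _ ≤ _ := by gcongr; exact le_add_self

/-- the extended test function -/
def testExt (n : ℕ) (φ : Euc n → ℝ) (t0 : ℝ) (q : Euc n × ℝ) : ℝ := (1 - q.2 / t0) * extv n φ q

lemma abs_extv_le {n : ℕ} {φ : Euc n → ℝ} {M : ℝ} (hM : ∀ x, |φ x| ≤ M) (q : Euc n × ℝ) :
    |extv n φ q| ≤ M := by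
  have h : ‖∫ z, eta n z • φ (q.1 + q.2 • z)‖ ≤ ∫ z, eta n z * M := by
    refine norm_integral_le_of_norm_le ?_ (Eventually.of_forall fun z => ?_)
    · have hη : Continuous (eta n) := (eta_contDiff n (k := 0)).continuous
      exact ((hη.integrable_of_hasCompactSupport (eta_compact n)).mul_const M)
    · rw [norm_smul, Real.norm_of_nonneg (eta_nonneg n z)]
      exact mul_le_mul_of_nonneg_left (hM _) (eta_nonneg n z)
  rw [integral_mul_const, eta_integral, one_mul] at h
  exact h

lemma norm_fderiv_extv_le {n : ℕ} {φ : Euc n → ℝ} (hφ : ContDiff ℝ 1 φ) {Λ : ℝ}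
    (hL : ∀ x, ‖fderiv ℝ φ x‖ ≤ Λ) (q : Euc n × ℝ) : ‖fderiv ℝ (extv n φ) q‖ ≤ 2 * Λ := by
  have hΛ : 0 ≤ Λ := (norm_nonneg _).trans (hL 0)
  refine ContinuousLinearMap.opNorm_le_bound _ (by positivity) fun w => ?_
  rw [fderiv_extv_apply hφ]
  have h : ‖∫ z, eta n z • fderiv ℝ φ (q.1 + q.2 • z) (w.1 + w.2 • z)‖ ≤ ∫ z, eta n z * (2 * Λ * ‖w‖) := by
    refine norm_integral_le_of_norm_le ?_ (Eventually.of_forall fun z => ?_)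
    · have hη : Continuous (eta n) := (eta_contDiff n (k := 0)).continuous
      exact ((hη.integrable_of_hasCompactSupport (eta_compact n)).mul_const _)
    · rw [norm_smul, Real.norm_of_nonneg (eta_nonneg n z)]
      by_cases hz : z ∈ closedBall (0 : Euc n) 1
      · refine mul_le_mul_of_nonneg_left ?_ (eta_nonneg n z)
        have hz' : ‖z‖ ≤ 1 := by simpa using hz
        refine (ContinuousLinearMap.le_opNorm _ _).trans ?_
        have : ‖w.1 + w.2 • z‖ ≤ 2 * ‖w‖ := by
          refine (norm_add_le _ _).trans ?_
          rw [norm_smul]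
          nlinarith [norm_fst_le w, norm_snd_le w, norm_nonneg z, norm_nonneg w.2]
        calc _ ≤ Λ * (2 * ‖w‖) := by gcongr; exact hL _
          _ = _ := by ring
      · rw [eta_zero hz]; simp
  rw [integral_mul_const, eta_integral, one_mul] at h
  exact h

/-- base estimate -/
lemma base_estimate (n : ℕ) (hn : 1 ≤ n) : ∃ C : ENNReal, C ≠ ⊤ ∧
    ∀ (v w : Euc n → Euc n) (_ : ContDiff ℝ 2 v) (_ : ContDiff ℝ 2 w) (φ : Euc n → ℝ) (_ : ContDiff ℝ 1 φ)
      (K : Set (Euc n)) (_ : IsCompact K) (_ : ∀ x, x ∉ K → φ x = 0) (M : ℝ) (_ : ∀ x, |φ x| ≤ M)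
      (t0 : ℝ) (_ : 0 < t0),
      ENNReal.ofReal |∫ x in cthickening t0 K, φ x * ((jacMat n v x).det - (jacMat n w x).det)| ≤
        C * ∫⁻ q in (cthickening t0 K) ×ˢ Set.Ioc 0 t0,
          (‖fderiv ℝ (extv n v) q‖ₑ + ‖fderiv ℝ (extv n w) q‖ₑ) ^ (n - 1)
            * ‖fderiv ℝ (extv n (v - w)) q‖ₑ * (‖fderiv ℝ (extv n φ) q‖ₑ + ENNReal.ofReal (M / t0)) := by
  obtain ⟨C, hC0, hC⟩ := Dform_sub_le n hn
  refine ⟨ENNReal.ofReal C, ENNReal.ofReal_ne_top, ?_⟩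
  intro v w hv hw φ hφ K hK hφK M hM t0 ht0
  set K1 := cthickening t0 K with hK1
  have hK1c : IsCompact K1 := hK.cthickening
  have hV : ContDiff ℝ 2 (extv n v) := contDiff_extv (k := 2) hv
  have hW : ContDiff ℝ 2 (extv n w) := contDiff_extv (k := 2) hw
  have hΦ0 : ContDiff ℝ 1 (extv n φ) := contDiff_extv (k := 1) hφ
  set Φ := testExt n φ t0 with hΦdef
  have hΦ : ContDiff ℝ 1 Φ := by
    refine ContDiff.mul ?_ hΦ0
    fun_prop
  have hsupp : ∀ x, x ∉ K1 → ∀ t ∈ Set.Icc 0 t0, Φ (x, t) = 0 := by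
    intro x hx t ht
    have : extv n φ (x, t) = 0 := by
      simp only [extv]
      rw [← integral_zero (Euc n) ℝ (μ := volume)]
      congr 1; ext z
      by_cases hz : z ∈ closedBall (0 : Euc n) 1
      · rw [hφK, smul_zero]
        intro hxz
        apply hx
        refine closedBall_subset_cthickening hxz t0 ?_
        have hz' : ‖z‖ ≤ 1 := by simpa using hz
        rw [mem_closedBall, dist_eq_norm]
        simp only [sub_add_cancel_left, norm_neg, norm_smul, Real.norm_of_nonneg ht.1]
        nlinarith [ht.2, ht.1, norm_nonneg z]
      · rw [eta_zero hz, zero_smul]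
    simp [hΦdef, testExt, this]
  have hend : ∀ x, Φ (x, t0) = 0 := fun x => by simp [hΦdef, testExt, ht0.ne']
  have h0 : ∀ x, Φ (x, 0) = φ x := fun x => by simp [hΦdef, testExt, extv_zero]
  have iv := ext_identity hV hΦ hK1c ht0 hsupp hend
  have iw := ext_identity hW hΦ hK1c ht0 hsupp hend
  simp only [h0, extv_zero] at iv iw
  have hjc : ∀ v : Euc n → Euc n, ContDiff ℝ 2 v → Continuous (fun x => (jacMat n v x).det) := by
    intro v hv
    refine Continuous.matrix_det (continuous_matrix fun k i => ?_)
    exact (EuclideanSpace.proj k : Euc n →L[ℝ] ℝ).continuous.comp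
      ((hv.continuous_fderiv (by norm_num)).clm_apply continuous_const)
  have hintg : ∀ v : Euc n → Euc n, ContDiff ℝ 2 v → IntegrableOn (fun x => φ x * (jacMat n v x).det) K1 :=
    fun v hv => (hφ.continuous.mul (hjc v hv)).continuousOn.integrableOn_compact hK1c
  have hDint : ∀ V : Euc n × ℝ → Euc n, ContDiff ℝ 2 V → IntegrableOn
      (fun q => Dform n (fderiv ℝ V q) (fderiv ℝ Φ q)) (K1 ×ˢ Set.Ioc 0 t0) := by
    intro V hV
    refine IntegrableOn.mono_set (ContinuousOn.integrableOn_compact (hK1c.prod (isCompact_Icc (a := 0) (b := t0)))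
      (Continuous.continuousOn ?_)) (Set.prod_mono le_rfl Set.Ioc_subset_Icc_self)
    exact (continuous_Dform n).comp ((hV.continuous_fderiv (by norm_num)).prodMk (hΦ.continuous_fderiv (by norm_num)))
  have e1 : ∫ x in K1, φ x * ((jacMat n v x).det - (jacMat n w x).det)
      = - ∫ q in K1 ×ˢ Set.Ioc 0 t0, (Dform n (fderiv ℝ (extv n v) q) (fderiv ℝ Φ q)
        - Dform n (fderiv ℝ (extv n w) q) (fderiv ℝ Φ q)) := by
    simp only [mul_sub]
    rw [integral_sub (hintg v hv) (hintg w hw), iv, iw, integral_sub (hDint _ hV) (hDint _ hW)]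
    ring
  rw [e1, abs_neg]
  rw [← Real.norm_eq_abs, ofReal_norm]
  refine (enorm_integral_le_lintegral_enorm _).trans ?_
  rw [← lintegral_const_mul]
  swap
  · have c1 := (hV.continuous_fderiv (by norm_num)).enorm.measurable
    have c2 := (hW.continuous_fderiv (by norm_num)).enorm.measurable
    have c3 := (hΦ0.continuous_fderiv (by norm_num)).enorm.measurable
    have c4 : Measurable fun q => ‖fderiv ℝ (extv n (v - w)) q‖ₑ :=
      ((contDiff_extv (k := 2) (hv.sub hw)).continuous_fderiv (by norm_num)).enorm.measurable
    exact (((c1.add c2).pow_const _).mul c4).mul (c3.add measurable_const)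
  refine setLIntegral_mono' (hK1c.measurableSet.prod measurableSet_Ioc) fun q hq => ?_
  set L := fderiv ℝ (extv n v) q
  set L' := fderiv ℝ (extv n w) q
  have hsub : fderiv ℝ (extv n (v - w)) q = L - L' := by
    rw [extv_sub hv.continuous hw.continuous, fderiv_sub (hV.differentiable (by norm_num) q)
      (hW.differentiable (by norm_num) q)]
  have hΦd : ‖fderiv ℝ Φ q‖ ≤ ‖fderiv ℝ (extv n φ) q‖ + M / t0 := by
    have h1 : HasFDerivAt (fun q : Euc n × ℝ => 1 - q.2 / t0)
        (- ((t0⁻¹ : ℝ) • ContinuousLinearMap.snd ℝ (Euc n) ℝ)) q := by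
      have h2 : HasFDerivAt (fun q : Euc n × ℝ => t0⁻¹ • q.2) ((t0⁻¹ : ℝ) • ContinuousLinearMap.snd ℝ (Euc n) ℝ) q :=
        (ContinuousLinearMap.snd ℝ (Euc n) ℝ).hasFDerivAt.const_smul t0⁻¹
      have e : (fun q : Euc n × ℝ => 1 - q.2 / t0) = fun q => 1 - t0⁻¹ • q.2 := by
        funext q; rw [smul_eq_mul, div_eq_inv_mul]
      rw [e]; exact h2.const_sub 1
    have h2 : HasFDerivAt Φ _ q := h1.mul (hΦ0.differentiable (by norm_num) q).hasFDerivAt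
    rw [h2.fderiv]
    refine (norm_add_le _ _).trans (add_le_add ?_ ?_)
    · rw [norm_smul]
      have : ‖1 - q.2 / t0‖ ≤ 1 := by
        have h5 : 0 ≤ q.2 / t0 := div_nonneg hq.2.1.le ht0.le
        have h6 : q.2 / t0 ≤ 1 := (div_le_one ht0).2 hq.2.2
        rw [Real.norm_eq_abs, abs_le]; constructor <;> linarith
      nlinarith [norm_nonneg (fderiv ℝ (extv n φ) q)]
    · rw [norm_smul, norm_neg, norm_smul, norm_inv, Real.norm_of_nonneg ht0.le, Real.norm_eq_abs]
      have := abs_extv_le hM q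
      have hs := ContinuousLinearMap.norm_snd_le (𝕜 := ℝ) (E := Euc n) (F := ℝ)
      calc _ ≤ M * (t0⁻¹ * 1) := by gcongr; exact (abs_nonneg _).trans this
        _ = _ := by rw [mul_one, div_eq_mul_inv]
  have key := hC L L' (fderiv ℝ Φ q) (‖L‖ + ‖L'‖) ‖L - L'‖ (le_add_of_nonneg_right (norm_nonneg _))
    (le_add_of_nonneg_left (norm_nonneg _)) le_rfl
  have hM0 : 0 ≤ M := (abs_nonneg _).trans (hM 0)
  rw [hsub, ← ofReal_norm, ← ofReal_norm (L), ← ofReal_norm L', ← ofReal_norm (L - L'), ← ofReal_norm (fderiv ℝ (extv n φ) q),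
    ← ENNReal.ofReal_add (norm_nonneg _) (norm_nonneg _), ← ENNReal.ofReal_add (norm_nonneg _) (by positivity),
    ← ENNReal.ofReal_pow (by positivity), ← ENNReal.ofReal_mul (by positivity), ← ENNReal.ofReal_mul (by positivity),
    ← ENNReal.ofReal_mul hC0]
  refine ENNReal.ofReal_le_ofReal (key.trans ?_)
  calc _ ≤ C * (‖L‖ + ‖L'‖) ^ (n - 1) * ‖L - L'‖ * (‖fderiv ℝ (extv n φ) q‖ + M / t0) := by gcongr
    _ = _ := by ring

lemma lint_combo {α : Type*} [MeasurableSpace α] (μ : Measure α) {A B D : α → ENNReal} (hA : Measurable A)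
    (hB : Measurable B) (hD : Measurable D) {c l k : ENNReal} :
    ∫⁻ q, c * (l * (A q + B q) + k * D q) ∂μ = c * (l * (∫⁻ q, A q ∂μ + ∫⁻ q, B q ∂μ) + k * ∫⁻ q, D q ∂μ) := by
  rw [lintegral_const_mul _ (by fun_prop), lintegral_add_left (by fun_prop), lintegral_const_mul _ (by fun_prop),
    lintegral_const_mul _ hD, lintegral_add_left hA]

lemma estimate_B (n : ℕ) (hn : 1 ≤ n) : ∃ C : ENNReal, C ≠ ⊤ ∧
    ∀ (v w : Euc n → Euc n) (_ : ContDiff ℝ 2 v) (_ : ContDiff ℝ 2 w) (φ : Euc n → ℝ) (_ : ContDiff ℝ 1 φ)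
      (K : Set (Euc n)) (_ : IsCompact K) (_ : ∀ x, x ∉ K → φ x = 0) (M : ℝ) (_ : ∀ x, |φ x| ≤ M)
      (Λ : ℝ) (_ : ∀ x, ‖fderiv ℝ φ x‖ ≤ Λ)
      (t0 : ℝ) (_ : 0 < t0) (l : ENNReal) (_ : l ≠ 0) (_ : l ≠ ⊤),
      ENNReal.ofReal |∫ x in cthickening t0 K, φ x * ((jacMat n v x).det - (jacMat n w x).det)| ≤
        C * ENNReal.ofReal (2 * Λ + M / t0) *
         (l * (energy n n (cthickening t0 (cthickening t0 K)) v + energy n n (cthickening t0 (cthickening t0 K)) w)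
          + l⁻¹ ^ (n - 1) * energy n n (cthickening t0 (cthickening t0 K)) (v - w)) := by
  obtain ⟨C, hC0, hC⟩ := base_estimate n hn
  obtain ⟨C2, hC20, hC2⟩ := energy_ext_bound n n hn hn
  refine ⟨C * (2 ^ n * C2), by finiteness, ?_⟩
  intro v w hv hw φ hφ K hK hφK M hM Λ hΛ t0 ht0 l hl0 hlt
  refine (hC v w hv hw φ hφ K hK hφK M hM t0 ht0).trans ?_
  set K1 := cthickening t0 K with hK1
  have hK1c : IsCompact K1 := hK.cthickening
  set P := ENNReal.ofReal (2 * Λ + M / t0)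
  have hM0 : 0 ≤ M := (abs_nonneg _).trans (hM 0)
  have hΛ0 : 0 ≤ Λ := (norm_nonneg _).trans (hΛ 0)
  have c : ∀ v : Euc n → Euc n, ContDiff ℝ 2 v → Measurable fun q => ‖fderiv ℝ (extv n v) q‖ₑ := fun v hv =>
    ((contDiff_extv (k := 2) hv).continuous_fderiv (by norm_num)).enorm.measurable
  have e1 := hC2 v (hv.of_le (by norm_num)) K1 hK1c t0 ht0
  have e2 := hC2 w (hw.of_le (by norm_num)) K1 hK1c t0 ht0
  have e3 := hC2 (v - w) ((hv.sub hw).of_le (by norm_num)) K1 hK1c t0 ht0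
  have hpt : ∀ q, (‖fderiv ℝ (extv n v) q‖ₑ + ‖fderiv ℝ (extv n w) q‖ₑ) ^ (n - 1)
            * ‖fderiv ℝ (extv n (v - w)) q‖ₑ * (‖fderiv ℝ (extv n φ) q‖ₑ + ENNReal.ofReal (M / t0))
      ≤ 2 ^ n * P * (l * (‖fderiv ℝ (extv n v) q‖ₑ ^ n + ‖fderiv ℝ (extv n w) q‖ₑ ^ n)
        + l⁻¹ ^ (n - 1) * ‖fderiv ℝ (extv n (v - w)) q‖ₑ ^ n) := by
    intro q
    set a := ‖fderiv ℝ (extv n v) q‖ₑ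
    set b := ‖fderiv ℝ (extv n w) q‖ₑ
    set d := ‖fderiv ℝ (extv n (v - w)) q‖ₑ
    have hP : ‖fderiv ℝ (extv n φ) q‖ₑ + ENNReal.ofReal (M / t0) ≤ P := by
      rw [← ofReal_norm, ← ENNReal.ofReal_add (norm_nonneg _) (by positivity)]
      refine ENNReal.ofReal_le_ofReal ?_
      linarith [norm_fderiv_extv_le hφ hΛ q]
    have hy := young_enn (a := a + b) (b := d) hl0 hlt (n - 1)
    rw [Nat.sub_add_cancel hn] at hy
    have h2 : (1 : ENNReal) ≤ 2 ^ n := one_le_pow₀ (by norm_num)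
    calc _ ≤ (l * (a + b) ^ n + l⁻¹ ^ (n - 1) * d ^ n) * P := by gcongr
      _ ≤ (l * (2 ^ n * (a ^ n + b ^ n)) + l⁻¹ ^ (n - 1) * (2 ^ n * d ^ n)) * P := by
          gcongr
          · exact add_pow_enn a b n
          · exact le_mul_of_one_le_left zero_le h2
      _ = _ := by ring
  calc _ ≤ C * ∫⁻ q in K1 ×ˢ Set.Ioc 0 t0, 2 ^ n * P * (l * (‖fderiv ℝ (extv n v) q‖ₑ ^ n + ‖fderiv ℝ (extv n w) q‖ₑ ^ n)
        + l⁻¹ ^ (n - 1) * ‖fderiv ℝ (extv n (v - w)) q‖ₑ ^ n) := by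
        exact mul_le_mul' le_rfl (lintegral_mono fun q => hpt q)
    _ = C * (2 ^ n * P * (l * ((∫⁻ q in K1 ×ˢ Set.Ioc 0 t0, ‖fderiv ℝ (extv n v) q‖ₑ ^ n)
          + ∫⁻ q in K1 ×ˢ Set.Ioc 0 t0, ‖fderiv ℝ (extv n w) q‖ₑ ^ n)
        + l⁻¹ ^ (n - 1) * ∫⁻ q in K1 ×ˢ Set.Ioc 0 t0, ‖fderiv ℝ (extv n (v - w)) q‖ₑ ^ n)) := by
        have m1 := (c v hv).pow_const n
        have m2 := (c w hw).pow_const n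
        have m3 := (c (v - w) (hv.sub hw)).pow_const n
        rw [lint_combo _ m1 m2 m3]
    _ ≤ C * (2 ^ n * P * (l * (C2 * energy n n (cthickening t0 K1) v + C2 * energy n n (cthickening t0 K1) w)
        + l⁻¹ ^ (n - 1) * (C2 * energy n n (cthickening t0 K1) (v - w)))) := by gcongr
    _ = _ := by ring

lemma estimate_B' (n : ℕ) (hn : 1 ≤ n) : ∃ C : ENNReal, C ≠ ⊤ ∧
    ∀ (v w : Euc n → Euc n) (_ : ContDiff ℝ 2 v) (_ : ContDiff ℝ 2 w) (φ : Euc n → ℝ) (_ : ContDiff ℝ 1 φ)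
      (K : Set (Euc n)) (_ : IsCompact K) (_ : ∀ x, x ∉ K → φ x = 0) (M : ℝ) (_ : ∀ x, |φ x| ≤ M)
      (t0 : ℝ) (_ : 0 < t0) (l : ENNReal) (_ : l ≠ 0) (_ : l ≠ ⊤),
      ENNReal.ofReal |∫ x in cthickening t0 K, φ x * ((jacMat n v x).det - (jacMat n w x).det)| ≤
        C * (l * (energy n (n + 1) (cthickening t0 (cthickening t0 K)) v
            + energy n (n + 1) (cthickening t0 (cthickening t0 K)) w
            + (energy n (n + 1) (cthickening t0 (cthickening t0 K)) φ
              + ENNReal.ofReal (M / t0) ^ (n + 1) * volume ((cthickening t0 K) ×ˢ Set.Ioc 0 t0)))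
          + l⁻¹ ^ n * energy n (n + 1) (cthickening t0 (cthickening t0 K)) (v - w)) := by
  obtain ⟨C, hC0, hC⟩ := base_estimate n hn
  obtain ⟨C2, hC20, hC2⟩ := energy_ext_bound n (n + 1) hn (by omega)
  refine ⟨C * (2 ^ (n + 1) * 2 ^ (n + 1) * (C2 + 1)), by finiteness, ?_⟩
  intro v w hv hw φ hφ K hK hφK M hM t0 ht0 l hl0 hlt
  refine (hC v w hv hw φ hφ K hK hφK M hM t0 ht0).trans ?_
  set K1 := cthickening t0 K with hK1
  have hK1c : IsCompact K1 := hK.cthickening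
  set P := ENNReal.ofReal (M / t0)
  have c : ∀ v : Euc n → Euc n, ContDiff ℝ 2 v → Measurable fun q => ‖fderiv ℝ (extv n v) q‖ₑ := fun v hv =>
    ((contDiff_extv (k := 2) hv).continuous_fderiv (by norm_num)).enorm.measurable
  have c' : Measurable fun q => ‖fderiv ℝ (extv n φ) q‖ₑ :=
    ((contDiff_extv (k := 1) hφ).continuous_fderiv (by norm_num)).enorm.measurable
  have e1 := hC2 v (hv.of_le (by norm_num)) K1 hK1c t0 ht0
  have e2 := hC2 w (hw.of_le (by norm_num)) K1 hK1c t0 ht0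
  have e3 := hC2 (v - w) ((hv.sub hw).of_le (by norm_num)) K1 hK1c t0 ht0
  have e4 := hC2 φ hφ K1 hK1c t0 ht0
  set c0 : ENNReal := 2 ^ (n + 1) * 2 ^ (n + 1)
  have hpt : ∀ q, (‖fderiv ℝ (extv n v) q‖ₑ + ‖fderiv ℝ (extv n w) q‖ₑ) ^ (n - 1)
            * ‖fderiv ℝ (extv n (v - w)) q‖ₑ * (‖fderiv ℝ (extv n φ) q‖ₑ + P)
      ≤ c0 * (l * ((‖fderiv ℝ (extv n v) q‖ₑ ^ (n + 1) + ‖fderiv ℝ (extv n w) q‖ₑ ^ (n + 1)) +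
          (‖fderiv ℝ (extv n φ) q‖ₑ ^ (n + 1) + P ^ (n + 1)))
        + l⁻¹ ^ n * ‖fderiv ℝ (extv n (v - w)) q‖ₑ ^ (n + 1)) := by
    intro q
    set a := ‖fderiv ℝ (extv n v) q‖ₑ
    set b := ‖fderiv ℝ (extv n w) q‖ₑ
    set d := ‖fderiv ℝ (extv n (v - w)) q‖ₑ
    set e := ‖fderiv ℝ (extv n φ) q‖ₑ
    have hy := young_enn (a := (a + b) + (e + P)) (b := d) hl0 hlt n
    have h2 : (1 : ENNReal) ≤ 2 ^ (n + 1) := one_le_pow₀ (by norm_num)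
    have h3 : (1 : ENNReal) ≤ c0 := by
      calc (1 : ENNReal) = 1 * 1 := by ring
        _ ≤ c0 := by simp only [c0]; gcongr
    have h4 : ((a + b) + (e + P)) ^ (n + 1) ≤ c0 * ((a ^ (n + 1) + b ^ (n + 1)) + (e ^ (n + 1) + P ^ (n + 1))) := by
      calc _ ≤ 2 ^ (n + 1) * ((a + b) ^ (n + 1) + (e + P) ^ (n + 1)) := add_pow_enn _ _ _
        _ ≤ 2 ^ (n + 1) * (2 ^ (n + 1) * (a ^ (n + 1) + b ^ (n + 1)) + 2 ^ (n + 1) * (e ^ (n + 1) + P ^ (n + 1))) := by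
          gcongr <;> exact add_pow_enn _ _ _
        _ = _ := by simp only [c0]; ring
    calc _ ≤ ((a + b) + (e + P)) ^ (n - 1) * d * ((a + b) + (e + P)) := by
          refine mul_le_mul' (mul_le_mul' (pow_le_pow_left' le_self_add _) le_rfl) le_add_self
      _ = ((a + b) + (e + P)) ^ (n - 1 + 1) * d := by ring
      _ = ((a + b) + (e + P)) ^ n * d := by rw [Nat.sub_add_cancel hn]
      _ ≤ _ := hy
      _ ≤ l * (c0 * ((a ^ (n + 1) + b ^ (n + 1)) + (e ^ (n + 1) + P ^ (n + 1)))) + l⁻¹ ^ n * (c0 * d ^ (n + 1)) := by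
          gcongr
          exact le_mul_of_one_le_left zero_le h3
      _ = _ := by ring
  calc _ ≤ C * ∫⁻ q in K1 ×ˢ Set.Ioc 0 t0, c0 * (l * ((‖fderiv ℝ (extv n v) q‖ₑ ^ (n + 1) + ‖fderiv ℝ (extv n w) q‖ₑ ^ (n + 1)) +
          (‖fderiv ℝ (extv n φ) q‖ₑ ^ (n + 1) + P ^ (n + 1)))
        + l⁻¹ ^ n * ‖fderiv ℝ (extv n (v - w)) q‖ₑ ^ (n + 1)) := by
        exact mul_le_mul' le_rfl (lintegral_mono fun q => hpt q)
    _ = C * (c0 * (l * (((∫⁻ q in K1 ×ˢ Set.Ioc 0 t0, ‖fderiv ℝ (extv n v) q‖ₑ ^ (n + 1))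
          + ∫⁻ q in K1 ×ˢ Set.Ioc 0 t0, ‖fderiv ℝ (extv n w) q‖ₑ ^ (n + 1))
          + ((∫⁻ q in K1 ×ˢ Set.Ioc 0 t0, ‖fderiv ℝ (extv n φ) q‖ₑ ^ (n + 1))
            + P ^ (n + 1) * volume (K1 ×ˢ Set.Ioc 0 t0)))
        + l⁻¹ ^ n * ∫⁻ q in K1 ×ˢ Set.Ioc 0 t0, ‖fderiv ℝ (extv n (v - w)) q‖ₑ ^ (n + 1))) := by
        have m1 := (c v hv).pow_const (n + 1)
        have m2 := (c w hw).pow_const (n + 1)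
        have m3 := (c (v - w) (hv.sub hw)).pow_const (n + 1)
        have m4 := c'.pow_const (n + 1)
        have m5 : Measurable (fun _ : Euc n × ℝ => P ^ (n + 1)) := measurable_const
        rw [lint_combo _ (A := fun q => ‖fderiv ℝ (extv n v) q‖ₑ ^ (n + 1) + ‖fderiv ℝ (extv n w) q‖ₑ ^ (n + 1))
          (B := fun q => ‖fderiv ℝ (extv n φ) q‖ₑ ^ (n + 1) + P ^ (n + 1)) (m1.add m2) (m4.add m5) m3,
          lintegral_add_left m1, lintegral_add_left m4]
        simp
    _ ≤ C * (c0 * (l * ((C2 * energy n (n + 1) (cthickening t0 K1) v + C2 * energy n (n + 1) (cthickening t0 K1) w)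
          + (C2 * energy n (n + 1) (cthickening t0 K1) φ + P ^ (n + 1) * volume (K1 ×ˢ Set.Ioc 0 t0)))
        + l⁻¹ ^ n * (C2 * energy n (n + 1) (cthickening t0 K1) (v - w)))) := by gcongr
    _ ≤ C * (c0 * (l * (((C2 + 1) * energy n (n + 1) (cthickening t0 K1) v + (C2 + 1) * energy n (n + 1) (cthickening t0 K1) w)
          + ((C2 + 1) * energy n (n + 1) (cthickening t0 K1) φ + (C2 + 1) * (P ^ (n + 1) * volume (K1 ×ˢ Set.Ioc 0 t0))))
        + l⁻¹ ^ n * ((C2 + 1) * energy n (n + 1) (cthickening t0 K1) (v - w)))) := by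
        have h5 : C2 ≤ C2 + 1 := le_self_add
        have h6 : P ^ (n + 1) * volume (K1 ×ˢ Set.Ioc 0 t0) ≤ (C2 + 1) * (P ^ (n + 1) * volume (K1 ×ˢ Set.Ioc 0 t0)) :=
          le_mul_of_one_le_left zero_le le_add_self
        generalize P ^ (n + 1) * volume (K1 ×ˢ Set.Ioc 0 t0) = Y at *
        gcongr
    _ = _ := by ring

end

section

/-! ### Jensen's inequality for mollifications -/

def etaM (n : ℕ) : Measure (Euc n) := volume.withDensity fun z => ENNReal.ofReal (eta n z)

lemma eta_continuous (n : ℕ) : Continuous (eta n) := (eta_contDiff n (k := 0)).continuous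

instance etaM_prob (n : ℕ) : IsProbabilityMeasure (etaM n) := by
  constructor
  rw [etaM, withDensity_apply _ MeasurableSet.univ, Measure.restrict_univ,
    ← ofReal_integral_eq_lintegral_ofReal
      ((eta_continuous n).integrable_of_hasCompactSupport (eta_compact n)) (ae_of_all _ (eta_nonneg n)),
    eta_integral, ENNReal.ofReal_one]

lemma integral_etaM {n : ℕ} {F : Type*} [NormedAddCommGroup F] [NormedSpace ℝ F] (g : Euc n → F) :
    ∫ z, g z ∂(etaM n) = ∫ z, eta n z • g z := by
  rw [etaM, integral_withDensity_eq_integral_toReal_smul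
    (f := fun z => ENNReal.ofReal (eta n z)) (ENNReal.measurable_ofReal.comp (eta_continuous n).measurable) (ae_of_all _ fun _ => ENNReal.ofReal_lt_top)]
  simp only [ENNReal.toReal_ofReal (eta_nonneg n _)]

lemma etaM_ae (n : ℕ) : ∀ᵐ z ∂(etaM n), z ∈ closedBall (0 : Euc n) 1 := by
  rw [etaM, ae_withDensity_iff (f := fun z => ENNReal.ofReal (eta n z)) (ENNReal.measurable_ofReal.comp (eta_continuous n).measurable)]
  refine ae_of_all _ fun z hz => ?_
  by_contra h
  exact hz (by simp [eta_zero h])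

lemma jensen_enorm {α F : Type*} [MeasurableSpace α] {ν : Measure α} [IsProbabilityMeasure ν]
    [NormedAddCommGroup F] [NormedSpace ℝ F] {g h : α → F} (hg : Integrable g ν) (hh : Integrable h ν)
    {p : ℕ} (hp : 1 ≤ p) :
    ‖∫ z, g z ∂ν - ∫ z, h z ∂ν‖ₑ ^ p ≤ ∫⁻ z, ‖g z - h z‖ₑ ^ p ∂ν := by
  rw [← integral_sub hg hh]
  calc _ ≤ (∫⁻ z, ‖g z - h z‖ₑ ∂ν) ^ p := by gcongr; exact enorm_integral_le_lintegral_enorm _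
    _ ≤ _ := by simpa using lintegral_pow_le ν (hg.sub hh).aestronglyMeasurable.enorm hp

variable {F : Type*} [NormedAddCommGroup F] [NormedSpace ℝ F] [MeasurableSpace F] [BorelSpace F]
  [SecondCountableTopology F]

lemma energy_jensen {n p : ℕ} (hp : 1 ≤ p) {S : Set (Euc n)} (hS : MeasurableSet S) {v : Euc n → F}
    (hv : Measurable v) {T : Euc n → Euc n → Euc n} (hT : Measurable fun q : Euc n × Euc n => T q.1 q.2)
    (hintg : ∀ x ∈ S, Integrable (fun z => v (T x z)) (etaM n)) :
    energy n p S (fun x => ∫ z, v (T x z) ∂(etaM n)) ≤ ∫⁻ z, energy n p S (fun x => v (T x z)) ∂(etaM n) := by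
  unfold energy
  have hm : Measurable fun r : (Euc n × Euc n) × Euc n =>
      ‖v (T r.1.1 r.2) - v (T r.1.2 r.2)‖ₑ ^ p / edist r.1.1 r.1.2 ^ (n + p - 1) := by
    have h1 : Measurable fun r : (Euc n × Euc n) × Euc n => v (T r.1.1 r.2) :=
      hv.comp (hT.comp (measurable_fst.fst.prodMk measurable_snd))
    have h2 : Measurable fun r : (Euc n × Euc n) × Euc n => v (T r.1.2 r.2) :=
      hv.comp (hT.comp (measurable_fst.snd.prodMk measurable_snd))
    fun_prop
  rw [lintegral_lintegral_swap (μ := etaM n)]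
  swap
  · exact (hm.comp measurable_swap).aemeasurable
  refine lintegral_mono_ae ?_
  rw [Measure.prod_restrict]
  filter_upwards [ae_restrict_mem (hS.prod hS)] with q hq
  simp only [div_eq_mul_inv]
  rw [lintegral_mul_const]
  · gcongr
    exact jensen_enorm (hintg _ hq.1) (hintg _ hq.2) hp
  · have h1 : Measurable fun z => v (T q.1 z) := hv.comp (hT.comp measurable_prodMk_left)
    have h2 : Measurable fun z => v (T q.2 z) := hv.comp (hT.comp measurable_prodMk_left)
    fun_prop

lemma lp_jensen {n p : ℕ} (hp : 1 ≤ p) {S : Set (Euc n)} (hS : MeasurableSet S) {v : Euc n → F}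
    (hv : Measurable v) {T : Euc n → Euc n → Euc n} (hT : Measurable fun q : Euc n × Euc n => T q.1 q.2)
    (hintg : ∀ x ∈ S, Integrable (fun z => v (T x z)) (etaM n)) :
    ∫⁻ x in S, ‖∫ z, v (T x z) ∂(etaM n)‖ₑ ^ p ≤ ∫⁻ z, (∫⁻ x in S, ‖v (T x z)‖ₑ ^ p) ∂(etaM n) := by
  have hm : Measurable fun r : Euc n × Euc n => ‖v (T r.1 r.2)‖ₑ ^ p := by
    have h1 : Measurable fun r : Euc n × Euc n => v (T r.1 r.2) := hv.comp hT
    fun_prop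
  rw [lintegral_lintegral_swap (μ := etaM n)]
  swap
  · exact (hm.comp measurable_swap).aemeasurable
  refine lintegral_mono_ae ?_
  filter_upwards [ae_restrict_mem hS] with x hx
  have := jensen_enorm (hintg _ hx) (integrable_zero _ F (etaM n)) hp
  simpa using this

/-- change of variables in the energy -/
lemma energy_comp_le {n p : ℕ} {S S' : Set (Euc n)} (hS : MeasurableSet S) {v : Euc n → F} (hv : Measurable v)
    {Φ : Euc n → Euc n} {Φ' : Euc n → Euc n →L[ℝ] Euc n}
    (hΦ : ∀ x ∈ S, HasFDerivWithinAt Φ (Φ' x) S x) (hinj : Set.InjOn Φ S) (hmap : Set.MapsTo Φ S S')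
    (hΦm : Measurable Φ) {a b : ENNReal} 
    (hdet : ∀ x ∈ S, 1 ≤ a * ENNReal.ofReal |(Φ' x).det|)
    (hlip : ∀ x ∈ S, ∀ y ∈ S, edist (Φ x) (Φ y) ≤ b * edist x y) (hat : a ≠ ⊤) (hb0 : b ≠ 0) (hbt : b ≠ ⊤) :
    energy n p S (fun x => v (Φ x)) ≤ b ^ (n + p - 1) * a ^ 2 * energy n p S' v := by
  set m := n + p - 1
  set k : Euc n → Euc n → ENNReal := fun x y => ‖v x - v y‖ₑ ^ p / edist x y ^ m with hk
  have hkm : Measurable fun q : Euc n × Euc n => k q.1 q.2 := by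
    have h1 : Measurable fun q : Euc n × Euc n => v q.1 := hv.comp measurable_fst
    have h2 : Measurable fun q : Euc n × Euc n => v q.2 := hv.comp measurable_snd
    fun_prop
  have cov : ∀ f : Euc n → ENNReal, ∫⁻ x in S, f (Φ x) ≤ a * ∫⁻ x in S', f x := by
    intro f
    calc _ ≤ ∫⁻ x in S, a * (ENNReal.ofReal |(Φ' x).det| * f (Φ x)) := by
          refine setLIntegral_mono' hS fun x hx => ?_
          rw [← mul_assoc]
          exact le_mul_of_one_le_left zero_le (hdet x hx)
      _ = a * ∫⁻ x in S, ENNReal.ofReal |(Φ' x).det| * f (Φ x) := lintegral_const_mul' _ _ hat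
      _ = a * ∫⁻ x in Φ '' S, f x := by
          rw [lintegral_image_eq_lintegral_abs_det_fderiv_mul volume hS hΦ hinj]
      _ ≤ _ := by gcongr; exact hmap.image_subset
  have e1 : energy n p S' v = ∫⁻ x in S', ∫⁻ y in S', k x y := by
    rw [energy, lintegral_prod _ hkm.aemeasurable]
  have hkm2 : Measurable fun q : Euc n × Euc n => k (Φ q.1) (Φ q.2) :=
    hkm.comp ((hΦm.comp measurable_fst).prodMk (hΦm.comp measurable_snd))
  have key : energy n p S (fun x => v (Φ x)) ≤ b ^ m * ∫⁻ x in S, ∫⁻ y in S, k (Φ x) (Φ y) := by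
    rw [energy, ← lintegral_prod (fun q : Euc n × Euc n => k (Φ q.1) (Φ q.2)) hkm2.aemeasurable, ← lintegral_const_mul _ hkm2,
      Measure.prod_restrict]
    refine setLIntegral_mono' (hS.prod hS) fun q hq => ?_
    simp only [hk, div_eq_mul_inv]
    rw [mul_left_comm]
    gcongr
    have hbm0 : b ^ m ≠ 0 := pow_ne_zero _ hb0
    have hbmt : b ^ m ≠ ⊤ := ENNReal.pow_ne_top hbt
    calc (edist q.1 q.2 ^ m)⁻¹ = b ^ m * ((b * edist q.1 q.2) ^ m)⁻¹ := by
          rw [mul_pow, ENNReal.mul_inv (Or.inl hbm0) (Or.inl hbmt), ← mul_assoc, ENNReal.mul_inv_cancel hbm0 hbmt, one_mul]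
      _ ≤ _ := by gcongr; exact hlip _ hq.1 _ hq.2
  refine key.trans ?_
  rw [mul_assoc, e1]
  gcongr
  calc ∫⁻ x in S, ∫⁻ y in S, k (Φ x) (Φ y) ≤ ∫⁻ x in S, a * ∫⁻ y in S', k (Φ x) y := by
        exact lintegral_mono fun x => cov _
    _ ≤ a * ∫⁻ x in S', a * ∫⁻ y in S', k x y := cov (fun x => a * ∫⁻ y in S', k x y)
    _ = _ := by
      rw [lintegral_const_mul _ hkm.lintegral_prod_right', pow_two, mul_assoc]

end

section

/-! ### From smooth maps to maps that are `C¹` in `Ω` -/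

lemma exists_C1_ext {n : ℕ} {F : Type*} [NormedAddCommGroup F] [NormedSpace ℝ F] {Ω K : Set (Euc n)} (hΩ : IsOpen Ω)
    (hK : IsClosed K) (hKΩ : K ⊆ Ω) {v : Euc n → F} (hv : ContDiffOn ℝ 1 v Ω) :
    ∃ v' : Euc n → F, ContDiff ℝ 1 v' ∧ ∀ᶠ x in 𝓝ˢ K, v' x = v x := by
  obtain ⟨f, hf0, hf1, -⟩ := exists_contMDiffMap_zero_one_nhds_of_isClosed (n := 1)
    (modelWithCornersSelf ℝ (Euc n)) hΩ.isClosed_compl hK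
    (Set.disjoint_left.2 fun x hx hx' => hx (hKΩ hx'))
  refine ⟨fun x => f x • v x, ?_, ?_⟩
  · rw [contDiff_iff_contDiffAt]
    intro x
    by_cases hx : x ∈ Ω
    · exact (f.contMDiff.contDiff.contDiffAt).smul (hv.contDiffAt (hΩ.mem_nhds hx))
    · have : (fun x => f x • v x) =ᶠ[𝓝 x] fun _ => 0 := by
        filter_upwards [(eventually_nhdsSet_iff_forall.1 hf0) x hx] with y hy
        rw [hy, zero_smul]
      exact contDiffAt_const.congr_of_eventuallyEq this
  · filter_upwards [hf1] with x hx
    rw [hx, one_smul]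

lemma extv_eq_etaM {n : ℕ} {F : Type*} [NormedAddCommGroup F] [NormedSpace ℝ F] (v : Euc n → F) (p : Euc n × ℝ) :
    extv n v p = ∫ z, v (p.1 + p.2 • z) ∂(etaM n) := by
  rw [integral_etaM]; rfl

lemma contDiff_moll {n : ℕ} {F : Type*} [NormedAddCommGroup F] [NormedSpace ℝ F] [CompleteSpace F] {v : Euc n → F}
    (hv : LocallyIntegrable v volume) {δ : ℝ} (hδ : 0 < δ) {k : ℕ∞} :
    ContDiff ℝ k (fun x => extv n v (x, δ)) := by
  set g : Euc n → ℝ := fun y => (δ ^ n)⁻¹ * eta n (-(δ⁻¹ • y)) with hg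
  have hgc : HasCompactSupport g := by
    refine HasCompactSupport.mul_left (f := fun _ => (δ ^ n)⁻¹) ?_
    have h1 : HasCompactSupport (fun y : Euc n => eta n (δ⁻¹ • (-y))) :=
      ((eta_compact n).comp_smul (inv_ne_zero hδ.ne')).comp_homeomorph (Homeomorph.neg (Euc n))
    simpa using h1
  have hgd : ContDiff ℝ k g := contDiff_const.mul ((eta_contDiff n).comp (by fun_prop))
  have h := hgc.contDiff_convolution_left (ContinuousLinearMap.lsmul ℝ ℝ : ℝ →L[ℝ] F →L[ℝ] F) hgd hv
  convert h using 1
  funext x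
  simp only [MeasureTheory.convolution, extv, hg, ContinuousLinearMap.lsmul_apply]
  have e := Measure.integral_comp_smul (μ := (volume : Measure (Euc n)))
    (fun t : Euc n => ((δ ^ n)⁻¹ * eta n (-(δ⁻¹ • t))) • v (x - t)) (-δ)
  have e2 : ∫ (t : Euc n), ((δ ^ n)⁻¹ * eta n (-(δ⁻¹ • t))) • v (x - t)
      = (δ ^ n) • ∫ z : Euc n, ((δ ^ n)⁻¹ * eta n (-(δ⁻¹ • ((-δ) • z)))) • v (x - (-δ) • z) := by
    rw [e, smul_smul]
    have : δ ^ n * |((-δ) ^ Module.finrank ℝ (Euc n))⁻¹| = 1 := by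
      rw [abs_inv, abs_pow, abs_neg, abs_of_pos hδ]; simp [hδ.ne']
    rw [this, one_smul]
  rw [e2, ← integral_smul]
  refine integral_congr_ae (ae_of_all _ fun z => ?_)
  simp only [smul_smul]
  rw [← mul_assoc, mul_inv_cancel₀ (by positivity), one_mul]
  simp [smul_smul, hδ.ne']

lemma energy_moll_le {n p : ℕ} (hp : 1 ≤ p) {F : Type*} [NormedAddCommGroup F] [NormedSpace ℝ F]
    [SecondCountableTopology F] {v : Euc n → F} (hv : Continuous v) {K : Set (Euc n)} (hK : IsClosed K)
    {δ : ℝ} (hδ : 0 ≤ δ) :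
    energy n p K (fun x => extv n v (x, δ)) ≤ energy n p (cthickening δ K) v := by
  borelize F
  simp only [extv_eq_etaM]
  refine (energy_jensen hp hK.measurableSet hv.measurable (T := fun x z => x + δ • z) (by fun_prop) ?_).trans ?_
  · intro x _
    have hc : Continuous fun z => v (x + δ • z) := by fun_prop
    obtain ⟨C, hC⟩ := (isCompact_closedBall (0 : Euc n) 1).exists_bound_of_continuousOn hc.continuousOn
    refine Integrable.of_bound hc.aestronglyMeasurable C ?_
    filter_upwards [etaM_ae n] with z hz using hC z hz
  · calc _ ≤ ∫⁻ z, energy n p (cthickening δ K) v ∂(etaM n) := by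
          refine lintegral_mono_ae ?_
          filter_upwards [etaM_ae n] with z hz
          have := energy_comp_le (p := p) (S' := cthickening δ K) hK.measurableSet hv.measurable (Φ := fun x => x + δ • z)
            (Φ' := fun _ => ContinuousLinearMap.id ℝ (Euc n)) (a := 1) (b := 1)
            (fun x _ => ((hasFDerivAt_id x).add_const _).hasFDerivWithinAt)
            (fun x _ y _ h => by simpa using h) ?_ (by fun_prop) ?_ ?_ (by simp) (by simp) (by simp)
          · simpa using this
          · intro x hx
            refine closedBall_subset_cthickening hx δ ?_
            rw [mem_closedBall, dist_eq_norm]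
            simp only [add_sub_cancel_left, norm_smul, Real.norm_of_nonneg hδ]
            rw [mem_closedBall_zero_iff] at hz
            nlinarith
          · intro x _
            simp [ContinuousLinearMap.det]
          · intro x _ y _
            simp
      _ = _ := by simp

lemma energy_mono {n p : ℕ} {F : Type*} [NormedAddCommGroup F] {v : Euc n → F} {S T : Set (Euc n)} (h : S ⊆ T) :
    energy n p S v ≤ energy n p T v := by
  unfold energy
  refine lintegral_mono' ?_ le_rfl
  rw [Measure.prod_restrict, Measure.prod_restrict]
  exact Measure.restrict_mono (Set.prod_mono h h) le_rfl

lemma energy_congr {n p : ℕ} {F : Type*} [NormedAddCommGroup F] {v w : Euc n → F} {S : Set (Euc n)}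
    (hS : MeasurableSet S) (h : ∀ x ∈ S, v x = w x) : energy n p S v = energy n p S w := by
  unfold energy
  rw [Measure.prod_restrict]
  refine setLIntegral_congr_fun (hS.prod hS) fun q hq => ?_
  simp only [h _ hq.1, h _ hq.2]

lemma jacMat_moll {n : ℕ} {v : Euc n → Euc n} (hv : ContDiff ℝ 1 v) (x : Euc n) (δ : ℝ) :
    jacMat n (fun x => extv n v (x, δ)) x = slc n (fderiv ℝ (extv n v) (x, δ)) := by
  have h1 : HasFDerivAt (fun x => extv n v (x, δ)) ((fderiv ℝ (extv n v) (x, δ)).comp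
      (ContinuousLinearMap.inl ℝ (Euc n) ℝ)) x := by
    have := ((contDiff_extv (k := 1) hv).differentiable (by norm_num) (x, δ)).hasFDerivAt
    exact HasFDerivAt.comp (g := extv n v) (f := fun e => (e, δ)) x this (hasFDerivAt_prodMk_left x δ)
  ext i j
  simp [jacMat, h1.fderiv, slc]

lemma transfer_est {n p : ℕ} (hp : 1 ≤ p) {Ω : Set (Euc n)} (hΩ : IsOpen Ω) {K : Set (Euc n)} (hK : IsCompact K)
    {t0 : ℝ} (ht0 : 0 < t0) (hKΩ : cthickening t0 (cthickening t0 (cthickening t0 K)) ⊆ Ω)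
    {φ : Euc n → ℝ} (hφ : ContDiff ℝ 1 φ) (hφK : ∀ x, x ∉ K → φ x = 0) {α β γ : ENNReal}
    (H : ∀ v w : Euc n → Euc n, ContDiff ℝ 2 v → ContDiff ℝ 2 w →
      ENNReal.ofReal |∫ x in cthickening t0 K, φ x * ((jacMat n v x).det - (jacMat n w x).det)| ≤
        α + β * (energy n p (cthickening t0 (cthickening t0 K)) v + energy n p (cthickening t0 (cthickening t0 K)) w)
          + γ * energy n p (cthickening t0 (cthickening t0 K)) (v - w))
    {v w : Euc n → Euc n} (hv : ContDiffOn ℝ 1 v Ω) (hw : ContDiffOn ℝ 1 w Ω) :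
    ENNReal.ofReal |∫ x in Ω, φ x * ((jacMat n v x).det - (jacMat n w x).det)| ≤
        α + β * (energy n p Ω v + energy n p Ω w) + γ * energy n p Ω (v - w) := by
  set K1 := cthickening t0 K
  set K2 := cthickening t0 K1
  set K3 := cthickening t0 K2
  have hK1c : IsCompact K1 := hK.cthickening
  have h12 : K1 ⊆ K2 := self_subset_cthickening _
  have h23 : K2 ⊆ K3 := self_subset_cthickening _
  have h01 : K ⊆ K1 := self_subset_cthickening _
  have hK3 : IsClosed K3 := isClosed_cthickening
  obtain ⟨v', hv', hvv⟩ := exists_C1_ext hΩ hK3 hKΩ hv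
  obtain ⟨w', hw', hww⟩ := exists_C1_ext hΩ hK3 hKΩ hw
  rw [eventually_nhdsSet_iff_forall] at hvv hww
  have e1 : ∫ x in Ω, φ x * ((jacMat n v x).det - (jacMat n w x).det)
      = ∫ x in K1, φ x * ((jacMat n v' x).det - (jacMat n w' x).det) := by
    have : ∫ x in K1, φ x * ((jacMat n v' x).det - (jacMat n w' x).det)
        = ∫ x in K1, φ x * ((jacMat n v x).det - (jacMat n w x).det) := by
      refine setIntegral_congr_fun hK1c.measurableSet fun x hx => ?_
      have a1 : jacMat n v' x = jacMat n v x := by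
        have a0 : v' =ᶠ[𝓝 x] v := hvv x (h23 (h12 hx))
        simp only [jacMat, a0.fderiv_eq]
      have a2 : jacMat n w' x = jacMat n w x := by
        have a0 : w' =ᶠ[𝓝 x] w := hww x (h23 (h12 hx))
        simp only [jacMat, a0.fderiv_eq]
      simp only [a1, a2]
    rw [this]
    exact (setIntegral_eq_of_subset_of_forall_diff_eq_zero hΩ.measurableSet
      (h12.trans (h23.trans hKΩ)) fun x hx => by rw [hφK x fun h => hx.2 (h01 h), zero_mul])
  have hvm := contDiff_extv (k := 1) hv'
  have hwm := contDiff_extv (k := 1) hw'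
  have hcont : Continuous fun δ : ℝ => ∫ x in K1, φ x * ((slc n (fderiv ℝ (extv n v') (x, δ))).det
      - (slc n (fderiv ℝ (extv n w') (x, δ))).det) := by
    refine continuous_parametric_integral_of_continuous ?_ hK1c
    have c1 : Continuous fun q : ℝ × Euc n => slc n (fderiv ℝ (extv n v') (q.2, q.1)) :=
      (continuous_slc n).comp ((hvm.continuous_fderiv (by norm_num)).comp (by fun_prop))
    have c2 : Continuous fun q : ℝ × Euc n => slc n (fderiv ℝ (extv n w') (q.2, q.1)) :=
      (continuous_slc n).comp ((hwm.continuous_fderiv (by norm_num)).comp (by fun_prop))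
    have c3 := hφ.continuous
    exact (c3.comp continuous_snd).mul (c1.matrix_det.sub c2.matrix_det)
  have e2 : ∫ x in K1, φ x * ((jacMat n v' x).det - (jacMat n w' x).det)
      = ∫ x in K1, φ x * ((slc n (fderiv ℝ (extv n v') (x, 0))).det
      - (slc n (fderiv ℝ (extv n w') (x, 0))).det) := by
    simp only [← jacMat_moll hv', ← jacMat_moll hw', extv_zero]
  rw [e1, e2]
  have hlim : Tendsto (fun δ : ℝ => ENNReal.ofReal |∫ x in K1, φ x * ((slc n (fderiv ℝ (extv n v') (x, δ))).det
      - (slc n (fderiv ℝ (extv n w') (x, δ))).det)|) (𝓝[>] 0) (𝓝 (ENNReal.ofReal |∫ x in K1, φ x *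
        ((slc n (fderiv ℝ (extv n v') (x, 0))).det - (slc n (fderiv ℝ (extv n w') (x, 0))).det)|)) :=
    ((ENNReal.continuous_ofReal.comp hcont.abs).tendsto 0).mono_left nhdsWithin_le_nhds
  refine le_of_tendsto hlim ?_
  filter_upwards [Ioc_mem_nhdsGT ht0] with δ hδ
  simp only [← jacMat_moll hv', ← jacMat_moll hw']
  refine (H _ _ (contDiff_moll hv'.continuous.locallyIntegrable hδ.1)
    (contDiff_moll hw'.continuous.locallyIntegrable hδ.1)).trans ?_
  have hen : ∀ f f' : Euc n → Euc n, ContDiff ℝ 1 f' → (∀ x ∈ K3, f' x = f x) →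
      energy n p K2 (fun x => extv n f' (x, δ)) ≤ energy n p Ω f := by
    intro f f' hf' hff
    refine (energy_moll_le hp hf'.continuous isClosed_cthickening hδ.1.le).trans ?_
    refine (energy_mono (cthickening_mono hδ.2 _)).trans ?_
    rw [energy_congr hK3.measurableSet hff]
    exact energy_mono hKΩ
  have hvv' : ∀ x ∈ K3, v' x = v x := fun x hx => (hvv x hx).self_of_nhds
  have hww' : ∀ x ∈ K3, w' x = w x := fun x hx => (hww x hx).self_of_nhds
  have hs : ((fun x => extv n v' (x, δ)) - fun x => extv n w' (x, δ)) = fun x => extv n (v' - w') (x, δ) := by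
    rw [extv_sub hv'.continuous hw'.continuous]; rfl
  rw [hs]
  gcongr
  · exact hen v v' hv' hvv'
  · exact hen w w' hw' hww'
  · exact hen (v - w) (v' - w') (hv'.sub hw') fun x hx => by simp [hvv' x hx, hww' x hx]

lemma exists_thick {n : ℕ} {Ω : Set (Euc n)} (hΩ : IsOpen Ω) {K : Set (Euc n)} (hK : IsCompact K) (hKΩ : K ⊆ Ω) :
    ∃ t0 : ℝ, 0 < t0 ∧ cthickening t0 (cthickening t0 (cthickening t0 K)) ⊆ Ω := by
  obtain ⟨d, hd, h⟩ := hK.exists_cthickening_subset_open hΩ hKΩ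
  refine ⟨d / 3, by positivity, ?_⟩
  refine (cthickening_cthickening_subset (by positivity) (by positivity) _).trans ?_
  refine (cthickening_cthickening_subset (by positivity) (by positivity) _).trans ?_
  exact (cthickening_mono (by linarith) _).trans h

lemma estB_dom {n : ℕ} (hn : 1 ≤ n) {Ω : Set (Euc n)} (hΩ : IsOpen Ω) {K : Set (Euc n)} (hK : IsCompact K)
    (hKΩ : K ⊆ Ω) : ∃ C : ENNReal, C ≠ ⊤ ∧ ∀ (v w : Euc n → Euc n), ContDiffOn ℝ 1 v Ω → ContDiffOn ℝ 1 w Ω →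
      ∀ (φ : Euc n → ℝ), ContDiff ℝ 1 φ → (∀ x, x ∉ K → φ x = 0) → ∀ M : ℝ, (∀ x, |φ x| ≤ M) →
      ∀ Λ : ℝ, (∀ x, ‖fderiv ℝ φ x‖ ≤ Λ) → ∀ l : ENNReal, l ≠ 0 → l ≠ ⊤ →
      ENNReal.ofReal |∫ x in Ω, φ x * ((jacMat n v x).det - (jacMat n w x).det)| ≤
        C * ENNReal.ofReal (Λ + M) * (l * (energy n n Ω v + energy n n Ω w) + l⁻¹ ^ (n - 1) * energy n n Ω (v - w)) := by
  obtain ⟨t0, ht0, hsub⟩ := exists_thick hΩ hK hKΩ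
  obtain ⟨C, hC, h⟩ := estimate_B n hn
  refine ⟨C * ENNReal.ofReal (2 + 1 / t0), by finiteness, ?_⟩
  intro v w hv hw φ hφ hφK M hM Λ hΛ l hl0 hlt
  have hM0 : 0 ≤ M := (abs_nonneg _).trans (hM 0)
  have hΛ0 : 0 ≤ Λ := (norm_nonneg _).trans (hΛ 0)
  set P := C * ENNReal.ofReal (2 * Λ + M / t0)
  have hP : P ≤ C * ENNReal.ofReal (2 + 1 / t0) * ENNReal.ofReal (Λ + M) := by
    rw [mul_assoc, ← ENNReal.ofReal_mul (by positivity)]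
    refine mul_le_mul' le_rfl (ENNReal.ofReal_le_ofReal ?_)
    have : 0 ≤ Λ * (1 / t0) := by positivity
    have e : M / t0 = M * (1 / t0) := by ring
    rw [e]; nlinarith
  have := transfer_est hn hΩ hK ht0 hsub hφ hφK (α := 0) (β := P * l) (γ := P * l⁻¹ ^ (n - 1)) (fun v w hv hw => by
    refine (h v w hv hw φ hφ K hK hφK M hM Λ hΛ t0 ht0 l hl0 hlt).trans (le_of_eq ?_)
    ring) hv hw
  refine this.trans ?_
  calc _ = P * (l * (energy n n Ω v + energy n n Ω w) + l⁻¹ ^ (n - 1) * energy n n Ω (v - w)) := by ring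
    _ ≤ _ := by gcongr

lemma estB'_dom {n : ℕ} (hn : 1 ≤ n) {Ω : Set (Euc n)} (hΩ : IsOpen Ω) {K : Set (Euc n)} (hK : IsCompact K)
    (hKΩ : K ⊆ Ω) : ∃ C : ENNReal, C ≠ ⊤ ∧ ∀ (v w : Euc n → Euc n), ContDiffOn ℝ 1 v Ω → ContDiffOn ℝ 1 w Ω →
      ∀ (φ : Euc n → ℝ), ContDiff ℝ 1 φ → (∀ x, x ∉ K → φ x = 0) → ∀ M : ℝ, (∀ x, |φ x| ≤ M) →
      ∀ l : ENNReal, l ≠ 0 → l ≠ ⊤ →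
      ENNReal.ofReal |∫ x in Ω, φ x * ((jacMat n v x).det - (jacMat n w x).det)| ≤
        C * (l * (energy n (n + 1) Ω v + energy n (n + 1) Ω w + (energy n (n + 1) Ω φ + ENNReal.ofReal M ^ (n + 1)))
          + l⁻¹ ^ n * energy n (n + 1) Ω (v - w)) := by
  obtain ⟨t0, ht0, hsub⟩ := exists_thick hΩ hK hKΩ
  obtain ⟨C, hC, h⟩ := estimate_B' n hn
  set Y := volume ((cthickening t0 K) ×ˢ Set.Ioc 0 t0) with hY
  have hYt : Y ≠ ⊤ := by
    rw [hY, Measure.volume_eq_prod, Measure.prod_prod]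
    exact ENNReal.mul_ne_top (hK.cthickening (r := t0)).measure_lt_top.ne (by simp)
  set Z := 1 + ENNReal.ofReal (1 / t0) ^ (n + 1) * Y
  have hZ : Z ≠ ⊤ := by finiteness
  refine ⟨C * Z, by finiteness, ?_⟩
  intro v w hv hw φ hφ hφK M hM l hl0 hlt
  have hM0 : 0 ≤ M := (abs_nonneg _).trans (hM 0)
  have := transfer_est (p := n + 1) (by omega) hΩ hK ht0 hsub hφ hφK
    (α := C * (l * (energy n (n + 1) Ω φ + ENNReal.ofReal (M / t0) ^ (n + 1) * Y))) (β := C * l) (γ := C * l⁻¹ ^ n)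
    (fun v w hv hw => by
      refine (h v w hv hw φ hφ K hK hφK M hM t0 ht0 l hl0 hlt).trans ?_
      have : energy n (n + 1) (cthickening t0 (cthickening t0 K)) φ ≤ energy n (n + 1) Ω φ :=
        energy_mono ((self_subset_cthickening _).trans hsub)
      generalize energy n (n + 1) (cthickening t0 (cthickening t0 K)) φ = a at *
      calc _ ≤ C * (l * (energy n (n + 1) (cthickening t0 (cthickening t0 K)) v
            + energy n (n + 1) (cthickening t0 (cthickening t0 K)) w
            + (energy n (n + 1) Ω φ + ENNReal.ofReal (M / t0) ^ (n + 1) * Y))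
          + l⁻¹ ^ n * energy n (n + 1) (cthickening t0 (cthickening t0 K)) (v - w)) := by gcongr
        _ = _ := by ring) hv hw
  refine this.trans ?_
  have hZ1 : 1 ≤ Z := le_self_add
  have h2 : ENNReal.ofReal (M / t0) ^ (n + 1) * Y ≤ Z * ENNReal.ofReal M ^ (n + 1) := by
    rw [show M / t0 = M * (1 / t0) by ring, ENNReal.ofReal_mul hM0, mul_pow, mul_assoc, mul_comm]
    gcongr
    exact le_add_self
  have mz : ∀ a : ENNReal, a ≤ Z * a := fun a => le_mul_of_one_le_left zero_le hZ1
  calc _ = C * (l * (energy n (n + 1) Ω v + energy n (n + 1) Ω w + (energy n (n + 1) Ω φ + ENNReal.ofReal (M / t0) ^ (n + 1) * Y))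
          + l⁻¹ ^ n * energy n (n + 1) Ω (v - w)) := by ring
    _ ≤ C * (l * (Z * energy n (n + 1) Ω v + Z * energy n (n + 1) Ω w + (Z * energy n (n + 1) Ω φ + Z * ENNReal.ofReal M ^ (n + 1)))
          + l⁻¹ ^ n * (Z * energy n (n + 1) Ω (v - w))) := by
        refine mul_le_mul' le_rfl (add_le_add (mul_le_mul' le_rfl (add_le_add (add_le_add (mz _) (mz _))
          (add_le_add (mz _) h2))) (mul_le_mul' le_rfl (mz _)))
    _ = _ := by ring

end

section

/-! ### Maps pushing `Ω` into itself -/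

lemma grad_exists {n : ℕ} {f : Euc n → ℝ} (hf : ContDiff ℝ (⊤ : ℕ∞) f) :
    ∃ g : Euc n → Euc n, ContDiff ℝ (⊤ : ℕ∞) g ∧ ∀ x y, fderiv ℝ f x y = inner ℝ (g x) y := by
  refine ⟨fun x => (InnerProductSpace.toDual ℝ (Euc n)).symm (fderiv ℝ f x), ?_, fun x y => ?_⟩
  · exact (InnerProductSpace.toDual ℝ (Euc n)).symm.contDiff.comp (hf.fderiv_right (by simp))
  · simp

lemma bdry_facts {n : ℕ} {Ω : Set (Euc n)} {f : Euc n → ℝ} (hfc : Continuous f) (hΩ : Ω = f ⁻¹' Set.Iio 0)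
    {x : Euc n} (hx : x ∈ closure Ω) : f x < 0 ∨ (f x = 0 ∧ x ∈ frontier Ω) := by
  have h1 : f x ≤ 0 := by
    have : closure Ω ⊆ {y | f y ≤ 0} := closure_minimal (fun y hy => by
      rw [hΩ] at hy; exact le_of_lt (show f y < 0 from hy)) (isClosed_le hfc continuous_const)
    exact this hx
  rcases h1.lt_or_eq with h | h
  · exact Or.inl h
  · refine Or.inr ⟨h, ?_⟩
    have ho : IsOpen Ω := by rw [hΩ]; exact isOpen_Iio.preimage hfc
    rw [ho.frontier_eq]
    refine ⟨hx, fun hh => ?_⟩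
    rw [hΩ] at hh
    have : f x < 0 := hh
    linarith

lemma push_in {n : ℕ} {Ω : Set (Euc n)} {f : Euc n → ℝ} (hf : ContDiff ℝ (⊤ : ℕ∞) f) (hΩ : Ω = f ⁻¹' Set.Iio 0)
    (hΩf : ∀ x ∈ frontier Ω, fderiv ℝ f x ≠ 0) {g : Euc n → Euc n} (hg : Continuous g)
    (hfg : ∀ x y, fderiv ℝ f x y = inner ℝ (g x) y) (hb : Bornology.IsBounded Ω) :
    ∀ᶠ t in 𝓝[>] (0 : ℝ), ∀ x ∈ closure Ω, x - t • g x ∈ Ω := by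
  have hK : IsCompact (closure Ω) := hb.isCompact_closure
  have key : ∀ᶠ t in 𝓝 (0 : ℝ), ∀ x ∈ closure Ω, 0 < t → x ∈ closure Ω → x - t • g x ∈ Ω := by
    refine hK.eventually_forall_of_forall_eventually ?_
    intro x0 hx0
    have hcont : Continuous fun q : ℝ × Euc n => q.2 - q.1 • g q.2 := by fun_prop
    rcases bdry_facts hf.continuous hΩ hx0 with h | ⟨h, hfr⟩
    · have : ∀ᶠ q : ℝ × Euc n in 𝓝 (0, x0), f (q.2 - q.1 • g q.2) < 0 :=
        (hf.continuous.comp hcont).continuousAt.eventually_lt continuousAt_const (by simpa using h)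
      filter_upwards [this] with q hq _ _
      rw [hΩ]; exact hq
    · have hgne : g x0 ≠ 0 := fun h0 => hΩf x0 hfr (by ext y; rw [hfg, h0]; simp)
      have hin : ∀ᶠ q : Euc n × Euc n in 𝓝 (x0, x0), 0 < (inner ℝ (g q.1) (g q.2) : ℝ) := by
        have hc : Continuous fun q : Euc n × Euc n => (inner ℝ (g q.1) (g q.2) : ℝ) := by fun_prop
        exact continuousAt_const.eventually_lt hc.continuousAt (by
          simpa using real_inner_self_pos.2 hgne)
      obtain ⟨r, hr, hball⟩ := Metric.eventually_nhds_iff_ball.1 hin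
      rw [← ball_prod_same] at hball
      have h1 : ∀ᶠ q : ℝ × Euc n in 𝓝 (0, x0), q.2 - q.1 • g q.2 ∈ ball x0 r :=
        hcont.continuousAt.eventually_mem (isOpen_ball.mem_nhds (by simpa using hr))
      have h2 : ∀ᶠ q : ℝ × Euc n in 𝓝 (0, x0), q.2 ∈ ball x0 r :=
        continuous_snd.continuousAt.eventually_mem (isOpen_ball.mem_nhds (by simpa using hr))
      filter_upwards [h1, h2] with q hq1 hq2 hq hqK
      have hfx : f q.2 ≤ 0 := by
        rcases bdry_facts hf.continuous hΩ hqK with h | h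
        · exact h.le
        · exact h.1.le
      obtain ⟨z, hz, hzz⟩ := domain_mvt (f := f) (f' := fderiv ℝ f) (s := ball x0 r)
        (fun x _ => (hf.differentiable (by simp) x).hasFDerivAt.hasFDerivWithinAt) (convex_ball x0 r) hq2 hq1
      have hzb : z ∈ ball x0 r := (convex_ball x0 r).segment_subset hq2 hq1 hz
      have hpos := hball (z, q.2) ⟨hzb, hq2⟩
      rw [hfg] at hzz
      have e : (inner ℝ (g z) (q.2 - q.1 • g q.2 - q.2) : ℝ) = - (q.1 * inner ℝ (g z) (g q.2)) := by
        rw [sub_sub_cancel_left, inner_neg_right, inner_smul_right]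
      rw [hΩ]
      show f _ < 0
      have := mul_pos hq hpos
      simp only at this
      rw [e] at hzz
      linarith
  filter_upwards [nhdsWithin_le_nhds key, self_mem_nhdsWithin] with t ht h0 x hx using ht x hx h0 hx

lemma exists_approx_maps {n : ℕ} {Ω : Set (Euc n)} (hb : Bornology.IsBounded Ω) (hs : SmoothBoundary n Ω) :
    ∀ ε : ℝ, 0 < ε → ε < 1 → ∃ Φ : Euc n → Euc n, ContDiff ℝ (⊤ : ℕ∞) Φ ∧ (∀ x ∈ closure Ω, Φ x ∈ Ω) ∧
      (∀ x ∈ closure Ω, ‖Φ x - x‖ ≤ ε) ∧ Set.InjOn Φ Ω ∧ (∀ x ∈ closure Ω, 1 - ε ≤ |(fderiv ℝ Φ x).det|) ∧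
      (∀ x ∈ Ω, ∀ y ∈ Ω, dist (Φ x) (Φ y) ≤ (1 + ε) * dist x y) := by
  intro ε hε hε1
  obtain ⟨f, hf, hΩ, hΩf⟩ := hs
  obtain ⟨g, hg, hfg⟩ := grad_exists hf
  have hgc : Continuous g := hg.continuous
  have hK : IsCompact (closure Ω) := hb.isCompact_closure
  have p1 := push_in hf hΩ hΩf hgc hfg hb
  have hD : ∀ (t : ℝ) (x : Euc n), HasFDerivAt (fun x => x - t • g x)
      (ContinuousLinearMap.id ℝ (Euc n) - t • fderiv ℝ g x) x := fun t x =>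
    (hasFDerivAt_id x).sub ((hg.differentiable (by simp) x).hasFDerivAt.fun_const_smul t)
  have hgf : Continuous (fderiv ℝ g) := hg.continuous_fderiv (by simp)
  have p2 : ∀ᶠ t in 𝓝 (0 : ℝ), ∀ x ∈ closure Ω,
      1 - ε < |(ContinuousLinearMap.id ℝ (Euc n) - t • fderiv ℝ g x).det| := by
    refine hK.eventually_forall_of_forall_eventually fun x0 _ => ?_
    have hc : Continuous fun q : ℝ × Euc n => |(ContinuousLinearMap.id ℝ (Euc n) - q.1 • fderiv ℝ g q.2).det| := by
      refine (ContinuousLinearMap.continuous_det.comp ?_).abs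
      fun_prop
    refine continuousAt_const.eventually_lt hc.continuousAt ?_
    have : (ContinuousLinearMap.id ℝ (Euc n)).det = 1 := by simp [ContinuousLinearMap.det]
    have e0 : ContinuousLinearMap.id ℝ (Euc n) - (0 : ℝ) • fderiv ℝ g x0 = ContinuousLinearMap.id ℝ (Euc n) := by
      refine ContinuousLinearMap.ext fun y => ?_
      show y - (0 : ℝ) • fderiv ℝ g x0 y = y
      rw [zero_smul, sub_zero]
    simp only [e0, this, abs_one]; linarith
  obtain ⟨B, hB⟩ := hK.exists_bound_of_continuousOn hgc.continuousOn
  obtain ⟨R, hR⟩ := hb.subset_closedBall 0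
  obtain ⟨C, hC⟩ := (isCompact_closedBall (0 : Euc n) R).exists_bound_of_continuousOn hgf.continuousOn
  have hlip : ∀ x ∈ Ω, ∀ y ∈ Ω, ‖g x - g y‖ ≤ C * ‖x - y‖ := fun x hx y hy =>
    (convex_closedBall (0 : Euc n) R).norm_image_sub_le_of_norm_fderiv_le
      (fun z _ => hg.differentiable (by simp) z) hC (hR hy) (hR hx)
  have lin : ∀ c : ℝ, ∀ᶠ t in 𝓝 (0 : ℝ), t * c < ε := fun c => by
    have : Continuous fun t : ℝ => t * c := by fun_prop
    exact this.continuousAt.eventually_lt continuousAt_const (by simpa using hε)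
  obtain ⟨t, ⟨ht1, ht2, ht3, ht4⟩, ht0⟩ := ((p1.and (nhdsWithin_le_nhds (p2.and ((lin B).and (lin C))))).and
    (self_mem_nhdsWithin : ∀ᶠ t in 𝓝[>] (0 : ℝ), 0 < t)).exists
  have hdiff : ∀ x ∈ Ω, ∀ y ∈ Ω, ‖t • (g x - g y)‖ ≤ ε * ‖x - y‖ := fun x hx y hy => by
    rw [norm_smul, Real.norm_of_nonneg ht0.le]
    calc t * ‖g x - g y‖ ≤ t * (C * ‖x - y‖) := by gcongr; exact hlip x hx y hy
      _ = (t * C) * ‖x - y‖ := by ring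
      _ ≤ _ := by gcongr
  refine ⟨fun x => x - t • g x, contDiff_id.sub (hg.const_smul t), ht1, fun x hx => ?_, ?_, fun x hx => ?_, ?_⟩
  · simp only [sub_sub_cancel_left, norm_neg, norm_smul, Real.norm_of_nonneg ht0.le]
    exact (mul_le_mul_of_nonneg_left (hB x hx) ht0.le).trans ht3.le
  · intro x hx y hy hxy
    simp only at hxy
    have : x - y = t • (g x - g y) := by
      rw [smul_sub, sub_eq_sub_iff_sub_eq_sub]
      exact hxy
    have h := hdiff x hx y hy
    rw [← this] at h
    have : ‖x - y‖ ≤ 0 := by nlinarith [norm_nonneg (x - y)]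
    exact sub_eq_zero.1 (norm_le_zero_iff.1 this)
  · rw [(hD t x).fderiv]
    exact (ht2 x hx).le
  · intro x hx y hy
    rw [dist_eq_norm, dist_eq_norm]
    have : x - t • g x - (y - t • g y) = (x - y) - t • (g x - g y) := by rw [smul_sub]; abel
    rw [this]
    have := norm_sub_le (x - y) (t • (g x - g y))
    have := hdiff x hx y hy
    linarith

end

section

/-! ### Approximation operators -/

structure ApproxSys (n : ℕ) (Ω : Set (Euc n)) where
  Φ : ℕ → Euc n → Euc n
  ε : ℕ → ℝ
  δ : ℕ → ℝ
  smooth : ∀ k, ContDiff ℝ (⊤ : ℕ∞) (Φ k)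
  εpos : ∀ k, 0 < ε k
  εlt : ∀ k, ε k < 1
  δpos : ∀ k, 0 < δ k
  δle : ∀ k, δ k ≤ ε k
  lim : Tendsto ε atTop (𝓝 0)
  into : ∀ k, ∀ x ∈ closure Ω, ∀ y, dist y (Φ k x) ≤ δ k → y ∈ Ω
  near : ∀ k, ∀ x ∈ closure Ω, ‖Φ k x - x‖ ≤ ε k
  inj : ∀ k, Set.InjOn (Φ k) Ω
  det : ∀ k, ∀ x ∈ closure Ω, 1 - ε k ≤ |(fderiv ℝ (Φ k) x).det|
  lip : ∀ k, ∀ x ∈ Ω, ∀ y ∈ Ω, dist (Φ k x) (Φ k y) ≤ (1 + ε k) * dist x y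

lemma approxSys_exists {n : ℕ} {Ω : Set (Euc n)} (ho : IsOpen Ω) (hb : Bornology.IsBounded Ω)
    (hs : SmoothBoundary n Ω) : Nonempty (ApproxSys n Ω) := by
  have hε : ∀ k : ℕ, (0 : ℝ) < 1 / ((k : ℝ) + 2) ∧ 1 / ((k : ℝ) + 2) < 1 := fun k => by
    refine ⟨by positivity, ?_⟩
    rw [div_lt_one (by positivity)]
    have : (0 : ℝ) ≤ k := k.cast_nonneg
    linarith
  choose Φ h1 h2 h3 h4 h5 h6 using fun k : ℕ => exists_approx_maps hb hs (1 / ((k : ℝ) + 2)) (hε k).1 (hε k).2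
  have hd : ∀ k, ∃ d : ℝ, 0 < d ∧ cthickening d (Φ k '' closure Ω) ⊆ Ω := fun k =>
    (hb.isCompact_closure.image (h1 k).continuous).exists_cthickening_subset_open ho
      (Set.image_subset_iff.2 fun x hx => h2 k x hx)
  choose d hd0 hd using hd
  refine ⟨⟨Φ, fun k => 1 / ((k : ℝ) + 2), fun k => min (d k) (1 / ((k : ℝ) + 2)), h1, fun k => (hε k).1,
    fun k => (hε k).2, fun k => lt_min (hd0 k) (hε k).1, fun k => min_le_right _ _, ?_, ?_, h3, h4, h5, h6⟩⟩
  · have := (tendsto_one_div_add_atTop_nhds_zero_nat (𝕜 := ℝ)).comp (tendsto_add_atTop_nat 1)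
    refine this.congr fun k => ?_
    simp only [Function.comp]; push_cast; ring
  · intro k x hx y hy
    exact hd k (closedBall_subset_cthickening (Set.mem_image_of_mem _ hx) _ (hy.trans (min_le_left _ _)))

variable {F : Type*} [NormedAddCommGroup F] [NormedSpace ℝ F]

/-- The approximation operator. -/
def app {n : ℕ} {Ω : Set (Euc n)} (S : ApproxSys n Ω) (v : Euc n → F) (k : ℕ) : Euc n → F :=
  fun x => ∫ z, Ω.indicator v (S.Φ k x + S.δ k • z) ∂(etaM n)

lemma integrable_etaM {n : ℕ} {w : Euc n → F} (hw : Integrable w) (x : Euc n) {δ : ℝ} (hδ : 0 < δ) :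
    Integrable (fun z => w (x + δ • z)) (etaM n) := by
  have h1 : Integrable (fun z => w (x + δ • z)) volume := (hw.comp_add_left x).comp_smul hδ.ne'
  obtain ⟨C, hC⟩ := (eta_continuous n).bounded_above_of_compact_support (eta_compact n)
  refine (h1.smul_measure (c := ENNReal.ofReal C) ENNReal.ofReal_ne_top).mono_measure ?_
  rw [etaM, ← withDensity_const]
  exact withDensity_mono (ae_of_all _ fun z => ENNReal.ofReal_le_ofReal ((le_abs_self _).trans (hC z)))

lemma app_integrable {n : ℕ} {Ω : Set (Euc n)} (hΩ : MeasurableSet Ω) (S : ApproxSys n Ω) {v : Euc n → F}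
    (hv : IntegrableOn v Ω) (k : ℕ) (x : Euc n) :
    Integrable (fun z => Ω.indicator v (S.Φ k x + S.δ k • z)) (etaM n) :=
  integrable_etaM ((integrable_indicator_iff hΩ).2 hv) _ (S.δpos k)

lemma app_contDiff {n : ℕ} [CompleteSpace F] {Ω : Set (Euc n)} (hΩ : MeasurableSet Ω) (S : ApproxSys n Ω) {v : Euc n → F}
    (hv : IntegrableOn v Ω) (k : ℕ) : ContDiff ℝ 1 (app S v k) := by
  have h := contDiff_moll (k := 1) ((integrable_indicator_iff hΩ).2 hv).locallyIntegrable (S.δpos k)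
  have e : app S v k = fun x => extv n (Ω.indicator v) (S.Φ k x, S.δ k) := by
    funext x; rw [extv_eq_etaM]; rfl
  rw [e]
  exact h.comp ((S.smooth k).of_le (by norm_cast))

lemma app_mem {n : ℕ} {Ω : Set (Euc n)} (S : ApproxSys n Ω) (k : ℕ) {x : Euc n} (hx : x ∈ closure Ω)
    {z : Euc n} (hz : z ∈ closedBall (0 : Euc n) 1) : S.Φ k x + S.δ k • z ∈ Ω := by
  refine S.into k x hx _ ?_
  rw [dist_eq_norm, add_sub_cancel_left, norm_smul, Real.norm_of_nonneg (S.δpos k).le]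
  rw [mem_closedBall_zero_iff] at hz
  nlinarith [S.δpos k]

lemma app_near {n : ℕ} [CompleteSpace F] {Ω : Set (Euc n)} (hΩ : MeasurableSet Ω) (S : ApproxSys n Ω) {v : Euc n → F}
    (hv : IntegrableOn v Ω) (k : ℕ) {x : Euc n} (hx : x ∈ closure Ω) {e : ℝ} {c : F}
    (h : ∀ y ∈ Ω, dist y x ≤ 2 * S.ε k → ‖v y - c‖ ≤ e) : ‖app S v k x - c‖ ≤ e := by
  have h1 : app S v k x - c = ∫ z, (Ω.indicator v (S.Φ k x + S.δ k • z) - c) ∂(etaM n) := by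
    rw [integral_sub (app_integrable hΩ S hv k x) (integrable_const _)]
    simp [app]
  rw [h1]
  have := norm_integral_le_of_norm_le_const (μ := etaM n) (C := e)
    (f := fun z => Ω.indicator v (S.Φ k x + S.δ k • z) - c) (by
      filter_upwards [etaM_ae n] with z hz
      have hm := app_mem S k hx hz
      rw [Set.indicator_of_mem hm]
      refine h _ hm ?_
      rw [dist_eq_norm]
      have e1 : S.Φ k x + S.δ k • z - x = (S.Φ k x - x) + S.δ k • z := by abel
      have e2 : ‖S.δ k • z‖ ≤ S.ε k := by
        rw [norm_smul, Real.norm_of_nonneg (S.δpos k).le]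
        rw [mem_closedBall_zero_iff] at hz
        nlinarith [S.δpos k, S.δle k]
      rw [e1]
      linarith [norm_add_le (S.Φ k x - x) (S.δ k • z), S.near k x hx])
  simpa using this

lemma app_tendsto {n : ℕ} [CompleteSpace F] {Ω : Set (Euc n)} (hΩ : MeasurableSet Ω) (S : ApproxSys n Ω) {v : Euc n → F}
    (hv : IntegrableOn v Ω) {x : Euc n} (hx : x ∈ Ω) (hc : ContinuousAt v x) :
    Tendsto (fun k => app S v k x) atTop (𝓝 (v x)) := by
  rw [Metric.tendsto_atTop']
  intro e he
  obtain ⟨r, hr, h⟩ := Metric.continuousAt_iff.1 hc (e / 2) (by positivity)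
  have := (S.lim.eventually_lt_const (show (0 : ℝ) < r / 2 by positivity))
  obtain ⟨N, hN⟩ := eventually_atTop.1 this
  refine ⟨N, fun k hk => ?_⟩
  rw [dist_eq_norm]
  refine (app_near hΩ S hv k (subset_closure hx) (e := e / 2) fun y _ hy => ?_).trans_lt (by linarith)
  rw [← dist_eq_norm]
  exact (h (by linarith [hN k hk.le])).le

lemma app_unif {n : ℕ} [CompleteSpace F] {Ω : Set (Euc n)} (hΩ : IsOpen Ω) (S : ApproxSys n Ω) {v : Euc n → F}
    (hv : IntegrableOn v Ω) (hc : ContinuousOn v Ω) {K : Set (Euc n)} (hK : IsCompact K) (hKΩ : K ⊆ Ω) {e : ℝ} (he : 0 < e) :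
    ∀ᶠ k in atTop, ∀ x ∈ K, ‖app S v k x - v x‖ ≤ e := by
  obtain ⟨d, hd, hdK⟩ := hK.exists_cthickening_subset_open hΩ hKΩ
  have huc := (hK.cthickening (r := d)).uniformContinuousOn_of_continuous (hc.mono hdK)
  obtain ⟨r, hr, h⟩ := Metric.uniformContinuousOn_iff.1 huc e he
  filter_upwards [S.lim.eventually_lt_const (show (0 : ℝ) < min r d / 2 by positivity)] with k hk x hx
  refine app_near hΩ.measurableSet S hv k (subset_closure (hKΩ hx)) fun y _ hy => ?_
  rw [← dist_eq_norm]
  have hy2 : dist y x < min r d := by linarith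
  exact (h y (closedBall_subset_cthickening hx d (hy2.le.trans (min_le_right _ _))) x
    (self_subset_cthickening _ hx) (hy2.trans_le (min_le_left _ _))).le

lemma app_sub {n : ℕ} {Ω : Set (Euc n)} (hΩ : MeasurableSet Ω) (S : ApproxSys n Ω) {v w : Euc n → F}
    (hv : IntegrableOn v Ω) (hw : IntegrableOn w Ω) (k : ℕ) :
    app S (v - w) k = app S v k - app S w k := by
  funext x
  simp only [app, Pi.sub_apply]
  rw [← integral_sub (app_integrable hΩ S hv k x) (app_integrable hΩ S hw k x)]
  congr 1; funext z
  rw [Set.indicator_sub']; rfl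

/-- The constant in the energy bound. -/
def appC {n : ℕ} {Ω : Set (Euc n)} (S : ApproxSys n Ω) (m k : ℕ) : ENNReal :=
  ENNReal.ofReal (1 + S.ε k) ^ m * ENNReal.ofReal ((1 - S.ε k)⁻¹) ^ 2

lemma appC_tendsto {n : ℕ} {Ω : Set (Euc n)} (S : ApproxSys n Ω) (m : ℕ) : Tendsto (appC S m) atTop (𝓝 1) := by
  have h : Tendsto (fun k => ENNReal.ofReal ((1 + S.ε k) ^ m * (1 - S.ε k)⁻¹ ^ 2)) atTop (𝓝 1) := by
    have h1 : Tendsto (fun k => (1 + S.ε k) ^ m * (1 - S.ε k)⁻¹ ^ 2) atTop (𝓝 ((1 + 0) ^ m * (1 - 0)⁻¹ ^ 2)) :=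
      ((S.lim.const_add 1).pow m).mul ((S.lim.const_sub 1).inv₀ (by norm_num) |>.pow 2)
    have h2 := (ENNReal.continuous_ofReal.tendsto _).comp h1
    rw [show ENNReal.ofReal ((1 + 0) ^ m * (1 - 0)⁻¹ ^ 2) = 1 by simp] at h2
    exact h2
  refine h.congr fun k => ?_
  have := S.εpos k
  have h2 := S.εlt k
  have h3 : 0 ≤ (1 - S.ε k)⁻¹ := inv_nonneg.2 (by linarith)
  rw [ENNReal.ofReal_mul (by positivity), ENNReal.ofReal_pow (by positivity), ENNReal.ofReal_pow h3]; rfl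

variable [MeasurableSpace F] [BorelSpace F] [SecondCountableTopology F]

lemma app_det {n : ℕ} {Ω : Set (Euc n)} (S : ApproxSys n Ω) (k : ℕ) {x : Euc n} (hx : x ∈ Ω) :
    1 ≤ ENNReal.ofReal ((1 - S.ε k)⁻¹) * ENNReal.ofReal |(fderiv ℝ (S.Φ k) x).det| := by
  have h2 : 0 < 1 - S.ε k := by linarith [S.εlt k]
  rw [← ENNReal.ofReal_mul (by positivity), ENNReal.one_le_ofReal]
  calc (1 : ℝ) = (1 - S.ε k)⁻¹ * (1 - S.ε k) := by field_simp
    _ ≤ _ := by gcongr; exact S.det k x (subset_closure hx)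

lemma app_energy_le {n p : ℕ} (hp : 1 ≤ p) {Ω : Set (Euc n)} (hΩ : MeasurableSet Ω) (S : ApproxSys n Ω) {v : Euc n → F}
    (hvm : Measurable v) (hv : IntegrableOn v Ω) (k : ℕ) :
    energy n p Ω (app S v k) ≤ appC S (n + p - 1) k * energy n p Ω v := by
  have hΦ := (S.smooth k).continuous
  refine (energy_jensen hp hΩ (hvm.indicator hΩ) (T := fun x z => S.Φ k x + S.δ k • z) (by fun_prop)
    fun x _ => app_integrable hΩ S hv k x).trans ?_
  calc _ ≤ ∫⁻ z, appC S (n + p - 1) k * energy n p Ω v ∂(etaM n) := by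
        refine lintegral_mono_ae ?_
        filter_upwards [etaM_ae n] with z hz
        have := energy_comp_le (p := p) (S' := Ω) hΩ (hvm.indicator hΩ) (Φ := fun x => S.Φ k x + S.δ k • z)
          (Φ' := fderiv ℝ (S.Φ k)) (a := ENNReal.ofReal ((1 - S.ε k)⁻¹)) (b := ENNReal.ofReal (1 + S.ε k))
          (fun x _ => (((S.smooth k).differentiable (by simp) x).hasFDerivAt.add_const _).hasFDerivWithinAt)
          (fun x hx y hy h => S.inj k hx hy (by simpa using h)) (fun x hx => app_mem S k (subset_closure hx) hz)
          (by fun_prop) (fun x hx => app_det S k hx) (fun x hx y hy => ?_) (by simp) ?_ (by simp)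
        · refine this.trans (le_of_eq ?_)
          rw [energy_congr hΩ fun x hx => Set.indicator_of_mem hx v]; rfl
        · simp only [edist_add_right]
          rw [edist_dist, edist_dist, ← ENNReal.ofReal_mul (by linarith [S.εpos k])]
          exact ENNReal.ofReal_le_ofReal (S.lip k x hx y hy)
        · simp; linarith [S.εpos k]
    _ = _ := by simp

lemma app_lp_le {n p : ℕ} (hp : 1 ≤ p) {Ω : Set (Euc n)} (hΩ : MeasurableSet Ω) (S : ApproxSys n Ω) {v : Euc n → F}
    (hvm : Measurable v) (hv : IntegrableOn v Ω) (k : ℕ) :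
    ∫⁻ x in Ω, ‖app S v k x‖ₑ ^ p ≤ appC S 0 k * ∫⁻ x in Ω, ‖v x‖ₑ ^ p := by
  have hΦ := (S.smooth k).continuous
  refine (lp_jensen hp hΩ (hvm.indicator hΩ) (T := fun x z => S.Φ k x + S.δ k • z) (by fun_prop)
    fun x _ => app_integrable hΩ S hv k x).trans ?_
  have ha1 : 1 ≤ ENNReal.ofReal ((1 - S.ε k)⁻¹) := by
    rw [ENNReal.one_le_ofReal]
    exact (one_le_inv₀ (by linarith [S.εlt k])).2 (by linarith [S.εpos k])
  set a := ENNReal.ofReal ((1 - S.ε k)⁻¹) with ha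
  calc _ ≤ ∫⁻ _, (appC S 0 k * ∫⁻ x in Ω, ‖v x‖ₑ ^ p) ∂(etaM n) := by
        refine lintegral_mono_ae ?_
        filter_upwards [etaM_ae n] with z hz
        have hinj : Set.InjOn (fun x => S.Φ k x + S.δ k • z) Ω := fun x hx y hy h => S.inj k hx hy (by simpa using h)
        have hD : ∀ x ∈ Ω, HasFDerivWithinAt (fun x => S.Φ k x + S.δ k • z) (fderiv ℝ (S.Φ k) x) Ω x := fun x _ =>
          (((S.smooth k).differentiable (by simp) x).hasFDerivAt.add_const _).hasFDerivWithinAt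
        have hsub : (fun x => S.Φ k x + S.δ k • z) '' Ω ⊆ Ω := Set.image_subset_iff.2 fun x hx =>
          app_mem S k (subset_closure hx) hz
        calc _ ≤ ∫⁻ x in Ω, a * (ENNReal.ofReal |(fderiv ℝ (S.Φ k) x).det| * ‖v (S.Φ k x + S.δ k • z)‖ₑ ^ p) := by
              refine setLIntegral_mono' hΩ fun x hx => ?_
              rw [← mul_assoc, Set.indicator_of_mem (app_mem S k (subset_closure hx) hz)]
              exact le_mul_of_one_le_left zero_le (app_det S k hx)
          _ = a * ∫⁻ x in (fun x => S.Φ k x + S.δ k • z) '' Ω, ‖v x‖ₑ ^ p := by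
              rw [lintegral_const_mul' _ _ (by simp [ha]),
                lintegral_image_eq_lintegral_abs_det_fderiv_mul volume hΩ hD hinj]
          _ ≤ a * ∫⁻ x in Ω, ‖v x‖ₑ ^ p := by gcongr
          _ ≤ _ := by
              gcongr
              simp only [appC, pow_zero, one_mul]
              exact le_self_pow₀ ha1 (by norm_num)
    _ = _ := by simp

end

section

/-! ### A generalized dominated convergence theorem and convergence of approximations -/

lemma genDCT {α : Type*} [MeasurableSpace α] {μ : Measure α} {D G : ℕ → α → ENNReal} {g : α → ENNReal}
    (hD : ∀ k, AEMeasurable (D k) μ) (hG : ∀ k, AEMeasurable (G k) μ) (hg : AEMeasurable g μ) {C : ENNReal}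
    (hC : C ≠ ⊤) (hle : ∀ k, ∀ᵐ x ∂μ, D k x ≤ C * (G k x + g x))
    (hGl : ∀ᵐ x ∂μ, Tendsto (fun k => G k x) atTop (𝓝 (g x)))
    (hDl : ∀ᵐ x ∂μ, Tendsto (fun k => D k x) atTop (𝓝 0)) (hfin : ∫⁻ x, g x ∂μ ≠ ⊤) {c : ℕ → ENNReal}
    (hc : Tendsto c atTop (𝓝 1)) (hintg : ∀ k, ∫⁻ x, G k x ∂μ ≤ c k * ∫⁻ x, g x ∂μ) :
    Tendsto (fun k => ∫⁻ x, D k x ∂μ) atTop (𝓝 0) := by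
  set I := ∫⁻ x, g x ∂μ with hI
  have h1 : Tendsto (fun k => ∫⁻ x, min (G k x) (g x) ∂μ) atTop (𝓝 I) := by
    refine tendsto_lintegral_of_dominated_convergence' g (fun k => (hG k).min hg)
      (fun k => ae_of_all _ fun x => min_le_right _ _) hfin ?_
    filter_upwards [hGl] with x hx
    simpa using hx.min (tendsto_const_nhds (x := g x))
  have h2 : ∀ k, ∫⁻ x, (G k x - g x) ∂μ ≤ c k * I - ∫⁻ x, min (G k x) (g x) ∂μ := by
    intro k
    have hm : ∫⁻ x, min (G k x) (g x) ∂μ ≠ ⊤ :=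
      ne_top_of_le_ne_top hfin (lintegral_mono fun x => min_le_right _ _)
    refine ENNReal.le_sub_of_add_le_right hm ?_
    rw [← lintegral_add_right' _ ((hG k).min hg)]
    refine le_trans (lintegral_mono fun x => ?_) (hintg k)
    rcases le_total (G k x) (g x) with h | h
    · simp [h, tsub_eq_zero_of_le h]
    · simp [h, tsub_add_cancel_of_le h]
  have h3 : Tendsto (fun k => ∫⁻ x, (G k x - g x) ∂μ) atTop (𝓝 0) := by
    refine tendsto_of_tendsto_of_tendsto_of_le_of_le tendsto_const_nhds ?_ (fun _ => zero_le) h2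
    have := ENNReal.Tendsto.sub (ENNReal.Tendsto.mul_const hc (Or.inr hfin)) h1 (Or.inr hfin)
    simpa using this
  have h4 : Tendsto (fun k => ∫⁻ x, min (D k x) (2 * C * g x) ∂μ) atTop (𝓝 0) := by
    have := tendsto_lintegral_of_dominated_convergence' (μ := μ) (F := fun k x => min (D k x) (2 * C * g x))
      (f := fun _ => 0) (fun x => 2 * C * g x)
      (fun k => (hD k).min (hg.const_mul _)) (fun k => ae_of_all _ fun x => min_le_right _ _) ?_ ?_
    · simpa using this
    · rw [lintegral_const_mul'' _ hg]; finiteness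
    · filter_upwards [hDl] with x hx
      refine tendsto_of_tendsto_of_tendsto_of_le_of_le tendsto_const_nhds hx (fun _ => zero_le) fun k => min_le_left _ _
  have h5 : ∀ k, ∫⁻ x, D k x ∂μ ≤ (∫⁻ x, min (D k x) (2 * C * g x) ∂μ) + C * ∫⁻ x, (G k x - g x) ∂μ := by
    intro k
    rw [← lintegral_const_mul' _ _ hC, ← lintegral_add_left' ((hD k).min (hg.const_mul _))]
    refine lintegral_mono_ae ?_
    filter_upwards [hle k] with x hx
    have : D k x ≤ 2 * C * g x + C * (G k x - g x) := by
      refine hx.trans ?_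
      calc C * (G k x + g x) ≤ C * ((G k x - g x + g x) + g x) := by gcongr; exact le_tsub_add
        _ = _ := by ring
    rcases le_total (D k x) (2 * C * g x) with h | h
    · simp [h]
    · simpa [h] using this
  refine tendsto_of_tendsto_of_tendsto_of_le_of_le tendsto_const_nhds ?_ (fun _ => zero_le) h5
  simpa using h4.add (ENNReal.Tendsto.const_mul h3 (Or.inr hC))

variable {F : Type*} [NormedAddCommGroup F] [NormedSpace ℝ F] [CompleteSpace F]
  [MeasurableSpace F] [BorelSpace F] [SecondCountableTopology F]

lemma ae_prod_restrict {α : Type*} [MeasurableSpace α] {μ : Measure α} [SFinite μ] {P : α → Prop} (h : ∀ᵐ x ∂μ, P x) :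
    ∀ᵐ q ∂(μ.prod μ), P q.1 ∧ P q.2 :=
  (Measure.quasiMeasurePreserving_fst.ae h).and (Measure.quasiMeasurePreserving_snd.ae h)

/-- energy density -/
def eden {F : Type*} [NormedAddCommGroup F] (n p : ℕ) (v : Euc n → F) (q : Euc n × Euc n) : ENNReal :=
  ‖v q.1 - v q.2‖ₑ ^ p / edist q.1 q.2 ^ (n + p - 1)

lemma measurable_eden {n p : ℕ} {v : Euc n → F} (hv : Measurable v) : Measurable (eden n p v) := by
  unfold eden
  have h1 : Measurable fun q : Euc n × Euc n => v q.1 := hv.comp measurable_fst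
  have h2 : Measurable fun q : Euc n × Euc n => v q.2 := hv.comp measurable_snd
  fun_prop

lemma energy_eq {F : Type*} [NormedAddCommGroup F] (n p : ℕ) (S : Set (Euc n)) (v : Euc n → F) :
    energy n p S v = ∫⁻ q, eden n p v q ∂((volume.restrict S).prod (volume.restrict S)) := rfl

lemma eden_tendsto {n p : ℕ} (hp : p ≠ 0) {w : ℕ → Euc n → F} {v : Euc n → F} {q : Euc n × Euc n}
    (h1 : Tendsto (fun k => w k q.1) atTop (𝓝 (v q.1))) (h2 : Tendsto (fun k => w k q.2) atTop (𝓝 (v q.2))) :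
    Tendsto (fun k => eden n p (w k) q) atTop (𝓝 (eden n p v q)) := by
  by_cases hq : q.1 = q.2
  · have : ∀ f : Euc n → F, eden n p f q = 0 := fun f => by simp [eden, hq, hp]
    simp [this]
  · unfold eden
    refine ENNReal.Tendsto.div_const ?_ (Or.inr (by simpa using fun h => absurd h hq))
    exact ((ENNReal.continuous_pow p).tendsto _).comp ((continuous_enorm.tendsto _).comp (h1.sub h2))

lemma eden_add_le {n p : ℕ} (v w : Euc n → F) (q : Euc n × Euc n) :
    eden n p (v + w) q ≤ 2 ^ p * (eden n p v q + eden n p w q) := by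
  simp only [eden, Pi.add_apply]
  rw [← ENNReal.add_div, ← mul_div_assoc]
  gcongr
  refine le_trans ?_ (add_pow_enn _ _ p)
  gcongr
  rw [add_sub_add_comm]
  exact enorm_add_le _ _

lemma eden_neg {n p : ℕ} (v : Euc n → F) (q : Euc n × Euc n) : eden n p (-v) q = eden n p v q := by
  simp only [eden, Pi.neg_apply]
  rw [← neg_sub', enorm_neg]

lemma energy_add_le {n p : ℕ} {S : Set (Euc n)} {v w : Euc n → F} (hv : Measurable v) :
    energy n p S (v + w) ≤ 2 ^ p * (energy n p S v + energy n p S w) := by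
  simp only [energy_eq]
  rw [← lintegral_add_left (measurable_eden hv), ← lintegral_const_mul' _ _ (by finiteness)]
  exact lintegral_mono fun q => eden_add_le v w q

lemma energy_neg {n p : ℕ} {S : Set (Euc n)} (v : Euc n → F) : energy n p S (-v) = energy n p S v := by
  simp only [energy_eq, eden_neg]

lemma energy_sub_le {n p : ℕ} {S : Set (Euc n)} {v w : Euc n → F} (hv : Measurable v) :
    energy n p S (v - w) ≤ 2 ^ p * (energy n p S v + energy n p S w) := by
  rw [sub_eq_add_neg, ← energy_neg w]; exact energy_add_le hv

lemma eden_lip {n p : ℕ} {Q : F → F} {L : NNReal} (hQ : LipschitzWith L Q) (v : Euc n → F) (q : Euc n × Euc n) :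
    eden n p (Q ∘ v) q ≤ (L : ENNReal) ^ p * eden n p v q := by
  simp only [eden, Function.comp]
  rw [← mul_div_assoc, ← mul_pow]
  gcongr
  rw [← edist_eq_enorm_sub, ← edist_eq_enorm_sub]
  exact hQ _ _

lemma energy_lip {n p : ℕ} {S : Set (Euc n)} {Q : F → F} {L : NNReal} (hQ : LipschitzWith L Q) (v : Euc n → F) :
    energy n p S (Q ∘ v) ≤ (L : ENNReal) ^ p * energy n p S v := by
  simp only [energy_eq]
  rw [← lintegral_const_mul' _ _ (by finiteness)]
  exact lintegral_mono fun q => eden_lip hQ v q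

lemma app_measurable {n : ℕ} {Ω : Set (Euc n)} (hΩ : MeasurableSet Ω) (S : ApproxSys n Ω) {v : Euc n → F}
    (hv : IntegrableOn v Ω) (k : ℕ) : Measurable (app S v k) :=
  (app_contDiff hΩ S hv k).continuous.measurable

lemma app_energy_tendsto {n p : ℕ} (hp : 1 ≤ p) {Ω : Set (Euc n)} (hΩ : MeasurableSet Ω) (S : ApproxSys n Ω)
    {v : Euc n → F} (hvm : Measurable v) (hv : IntegrableOn v Ω) (hc : ∀ᵐ x ∂(volume.restrict Ω), ContinuousAt v x)
    (hE : energy n p Ω v ≠ ⊤) {Q : F → F} {L : NNReal} (hQ : LipschitzWith L Q) :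
    Tendsto (fun k => energy n p Ω (Q ∘ app S v k - Q ∘ v)) atTop (𝓝 0) := by
  have hae : ∀ᵐ x ∂(volume.restrict Ω), Tendsto (fun k => app S v k x) atTop (𝓝 (v x)) := by
    filter_upwards [hc, ae_restrict_mem hΩ] with x hx hxΩ using app_tendsto hΩ S hv hxΩ hx
  have hm := fun k => app_measurable hΩ S hv k
  have hQm := hQ.continuous.measurable
  simp only [energy_eq] at hE ⊢
  refine genDCT (G := fun k => eden n p (app S v k)) (g := eden n p v) (C := 2 ^ p * (L : ENNReal) ^ p)
    (c := appC S (n + p - 1)) (fun k => (measurable_eden ((hQm.comp (hm k)).sub (hQm.comp hvm))).aemeasurable)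
    (fun k => (measurable_eden (hm k)).aemeasurable) (measurable_eden hvm).aemeasurable (by finiteness) ?_ ?_ ?_ hE
    (appC_tendsto S _) (fun k => app_energy_le hp hΩ S hvm hv k)
  · refine fun k => ae_of_all _ fun q => ?_
    rw [sub_eq_add_neg]
    refine (eden_add_le _ _ q).trans ?_
    rw [eden_neg, mul_assoc, mul_add ((L : ENNReal) ^ p)]
    exact mul_le_mul' le_rfl (add_le_add (eden_lip hQ _ q) (eden_lip hQ _ q))
  · filter_upwards [ae_prod_restrict hae] with q hq using eden_tendsto (by omega) hq.1 hq.2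
  · filter_upwards [ae_prod_restrict hae] with q hq
    have h0 : ∀ x, Tendsto (fun k => app S v k x) atTop (𝓝 (v x)) →
        Tendsto (fun k => (Q ∘ app S v k - Q ∘ v) x) atTop (𝓝 ((0 : Euc n → F) x)) := fun x hx => by
      have := ((hQ.continuous.tendsto _).comp hx).sub_const (Q (v x))
      simpa using this
    have := eden_tendsto (n := n) (p := p) (by omega) (h0 _ hq.1) (h0 _ hq.2)
    have e : eden n p (0 : Euc n → F) q = 0 := by simp [eden, show p ≠ 0 by omega]
    rwa [e] at this

lemma app_lp_tendsto {n p : ℕ} (hp : 1 ≤ p) {Ω : Set (Euc n)} (hΩ : MeasurableSet Ω) (S : ApproxSys n Ω)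
    {v : Euc n → F} (hvm : Measurable v) (hv : IntegrableOn v Ω) (hc : ∀ᵐ x ∂(volume.restrict Ω), ContinuousAt v x)
    (hE : ∫⁻ x in Ω, ‖v x‖ₑ ^ p ≠ ⊤) {Q : F → F} {L : NNReal} (hQ : LipschitzWith L Q) :
    Tendsto (fun k => ∫⁻ x in Ω, ‖Q (app S v k x) - Q (v x)‖ₑ ^ p) atTop (𝓝 0) := by
  have hae : ∀ᵐ x ∂(volume.restrict Ω), Tendsto (fun k => app S v k x) atTop (𝓝 (v x)) := by
    filter_upwards [hc, ae_restrict_mem hΩ] with x hx hxΩ using app_tendsto hΩ S hv hxΩ hx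
  have hm := fun k => app_measurable hΩ S hv k
  have hQm := hQ.continuous.measurable
  refine genDCT (G := fun k x => ‖app S v k x‖ₑ ^ p) (g := fun x => ‖v x‖ₑ ^ p) (C := (L : ENNReal) ^ p * 2 ^ p)
    (c := appC S 0) (fun k => (((hQm.comp (hm k)).sub (hQm.comp hvm)).enorm.pow_const p).aemeasurable)
    (fun k => ((hm k).enorm.pow_const p).aemeasurable) (hvm.enorm.pow_const p).aemeasurable (by finiteness) ?_ ?_ ?_ hE
    (appC_tendsto S _) (fun k => app_lp_le hp hΩ S hvm hv k)
  · refine fun k => ae_of_all _ fun x => ?_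
    rw [mul_assoc]
    refine le_trans ?_ (mul_le_mul' le_rfl (add_pow_enn _ _ p))
    rw [← mul_pow]
    gcongr
    rw [← edist_eq_enorm_sub]
    refine (hQ _ _).trans ?_
    rw [edist_eq_enorm_sub]
    gcongr
    exact enorm_sub_le
  · filter_upwards [hae] with x hx using
    ((ENNReal.continuous_pow p).tendsto _).comp ((continuous_enorm.tendsto _).comp hx)
  · filter_upwards [hae] with x hx
    have := ((hQ.continuous.tendsto _).comp hx).sub_const (Q (v x))
    have h2 := ((ENNReal.continuous_pow p).tendsto _).comp ((continuous_enorm.tendsto _).comp this)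
    simpa [show p ≠ 0 by omega, Function.comp_def] using h2

end

section

/-! ### Kernels and Lipschitz maps -/

lemma ball_kernel {n : ℕ} (hn : 1 ≤ n) {e : ℝ} (he : e < n) :
    IntegrableOn (fun z : Euc n => ‖z‖ ^ (-e)) (ball 0 1) := by
  haveI : Nontrivial (Euc n) := by
    haveI : Nonempty (Fin n) := ⟨⟨0, hn⟩⟩
    infer_instance
  have h := (integrable_fun_norm_addHaar (volume : Measure (Euc n)) (f := (Set.Iio (1 : ℝ)).indicator fun y => y ^ (-e))).2 ?_
  · rw [← integrable_indicator_iff measurableSet_ball]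
    refine h.congr (ae_of_all _ fun z => ?_)
    simp [Set.indicator]
  · have h1 : IntegrableOn (fun y : ℝ => y ^ ((n : ℝ) - 1 - e)) (Set.Ioo 0 1) := by
      rw [intervalIntegral.integrableOn_Ioo_rpow_iff one_pos]
      linarith
    have h2 : IntegrableOn ((Set.Iio (1 : ℝ)).indicator fun y : ℝ => y ^ ((n : ℝ) - 1 - e)) (Set.Ioi 0) := by
      rw [integrableOn_indicator_iff measurableSet_Iio]
      have e0 : Set.Iio (1 : ℝ) ∩ Set.Ioi 0 = Set.Ioo 0 1 := by ext y; simp [and_comm]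
      rw [e0]; exact h1
    refine h2.congr_fun (fun y hy => ?_) measurableSet_Ioi
    by_cases hy1 : y < 1
    · simp only [Set.indicator, Set.mem_Iio, hy1, if_true, smul_eq_mul, finrank_euclideanSpace, Fintype.card_fin]
      rw [← Real.rpow_natCast y (n - 1), ← Real.rpow_add hy, Nat.cast_sub hn]
      simp; ring_nf
    · simp [Set.indicator, hy1]

lemma kernA {n : ℕ} (hn : 1 ≤ n) {e : ℝ} (he0 : 0 ≤ e) (he : e < n) :
    ∃ A : ENNReal, A ≠ ⊤ ∧ ∀ (S : Set (Euc n)) (b : Euc n),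
      ∫⁻ a in S, ENNReal.ofReal (‖b - a‖ ^ (-e)) ≤ volume S + A := by
  set k : Euc n → ENNReal := (ball (0 : Euc n) 1).indicator fun z => ENNReal.ofReal (‖z‖ ^ (-e)) with hk
  refine ⟨∫⁻ z, k z, ?_, fun S b => ?_⟩
  · rw [hk, lintegral_indicator measurableSet_ball]
    have := (ball_kernel hn he).2
    rw [hasFiniteIntegral_iff_ofReal (ae_of_all _ fun z => by positivity)] at this
    exact this.ne
  · have hkm : Measurable k := Measurable.indicator (by fun_prop) measurableSet_ball
    calc _ ≤ ∫⁻ a in S, (1 + k (b - a)) := by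
          refine lintegral_mono fun a => ?_
          by_cases h : b - a ∈ ball (0 : Euc n) 1
          · simp only [hk, Set.indicator_of_mem h]; exact le_add_self
          · refine le_trans ?_ le_self_add
            rw [ENNReal.ofReal_le_one]
            rw [mem_ball_zero_iff, not_lt] at h
            exact Real.rpow_le_one_of_one_le_of_nonpos h (by linarith)
      _ = volume S + ∫⁻ a in S, k (b - a) := by
          rw [lintegral_add_left measurable_const]; simp
      _ ≤ volume S + ∫⁻ a, k (b - a) := by gcongr; exact Measure.restrict_le_self
      _ = _ := by rw [lintegral_sub_left_eq_self]

lemma kernB {n : ℕ} (hn : 1 ≤ n) {e : ℝ} (he0 : 0 ≤ e) (he : e < n) {Ω : Set (Euc n)} (hb : Bornology.IsBounded Ω) :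
    ∫⁻ q : Euc n × Euc n, ENNReal.ofReal (dist q.1 q.2 ^ (-e)) ∂((volume.restrict Ω).prod (volume.restrict Ω)) ≠ ⊤ := by
  obtain ⟨A, hA, h⟩ := kernA hn he0 he
  have hv : volume Ω ≠ ⊤ := hb.measure_lt_top.ne
  rw [lintegral_prod _ (by fun_prop)]
  refine ne_top_of_le_ne_top ?_ (lintegral_mono fun x => ?_ : _ ≤ ∫⁻ _ in Ω, (volume Ω + A))
  · simp; finiteness
  · simpa [dist_eq_norm] using h Ω x

lemma eden_le_real {n p : ℕ} {F : Type*} [NormedAddCommGroup F] {v : Euc n → F} {q : Euc n × Euc n} (hq : q.1 ≠ q.2) :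
    eden n p v q = ENNReal.ofReal (‖v q.1 - v q.2‖ ^ p / dist q.1 q.2 ^ (n + p - 1)) := by
  have := dist_pos.2 hq
  rw [eden, ENNReal.ofReal_div_of_pos (by positivity), ENNReal.ofReal_pow (by positivity),
    ENNReal.ofReal_pow (by positivity), ofReal_norm, edist_dist]

lemma eden_diag {n p : ℕ} (hp : 1 ≤ p) {F : Type*} [NormedAddCommGroup F] {v : Euc n → F} {q : Euc n × Euc n} (hq : q.1 = q.2) :
    eden n p v q = 0 := by
  simp [eden, hq, show p ≠ 0 by omega]

lemma energy_lip_fin {n p : ℕ} (hn : 1 ≤ n) (hp : 1 ≤ p) {F : Type*} [NormedAddCommGroup F] {v : Euc n → F} {Ω : Set (Euc n)}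
    (hΩ : MeasurableSet Ω) (hb : Bornology.IsBounded Ω) {C : ℝ} (h : ∀ x ∈ Ω, ∀ y ∈ Ω, ‖v x - v y‖ ≤ C * dist x y) :
    energy n p Ω v ≠ ⊤ := by
  have hk := kernB hn (e := (n : ℝ) - 1) (by simpa using hn) (by linarith) hb
  refine ne_top_of_le_ne_top (ENNReal.mul_ne_top (ENNReal.ofReal_ne_top (r := |C| ^ p)) hk) ?_
  rw [energy_eq, ← lintegral_const_mul' _ _ ENNReal.ofReal_ne_top, Measure.prod_restrict]
  refine setLIntegral_mono' (hΩ.prod hΩ) fun q hq => ?_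
  by_cases hqq : q.1 = q.2
  · simp [eden_diag hp hqq]
  · have hd := dist_pos.2 hqq
    rw [eden_le_real hqq, ← ENNReal.ofReal_mul (by positivity)]
    refine ENNReal.ofReal_le_ofReal ?_
    rw [div_le_iff₀ (by positivity)]
    have e1 : dist q.1 q.2 ^ (-((n : ℝ) - 1)) * dist q.1 q.2 ^ (n + p - 1) = dist q.1 q.2 ^ p := by
      rw [← Real.rpow_natCast _ (n + p - 1), ← Real.rpow_natCast _ p, ← Real.rpow_add hd]
      congr 1
      rw [show n + p - 1 = (n - 1) + p by omega]; push_cast [Nat.cast_sub hn]; ring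
    rw [mul_assoc, e1, ← mul_pow]
    gcongr
    exact (h _ hq.1 _ hq.2).trans (by gcongr; exact le_abs_self _)

lemma energy_embed {n : ℕ} (hn : 1 ≤ n) {F : Type*} [NormedAddCommGroup F] {v : Euc n → F} {Ω : Set (Euc n)}
    (hb : Bornology.IsBounded Ω) (h : energy n (n + 1) Ω v ≠ ⊤) : energy n n Ω v ≠ ⊤ := by
  have hk := kernB hn (e := (n : ℝ) - 1) (by simpa using hn) (by linarith) hb
  refine ne_top_of_le_ne_top (ENNReal.add_ne_top.2 ⟨h, hk⟩) ?_
  rw [energy_eq, energy_eq, ← lintegral_add_right _ (by fun_prop)]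
  refine lintegral_mono fun q => ?_
  by_cases hqq : q.1 = q.2
  · simp [eden_diag hn hqq]
  · have hd := dist_pos.2 hqq
    rw [eden_le_real hqq, eden_le_real hqq, ← ENNReal.ofReal_add (by positivity) (by positivity)]
    refine ENNReal.ofReal_le_ofReal ?_
    set d := ‖v q.1 - v q.2‖
    set r := dist q.1 q.2
    have hdn : 0 ≤ d := norm_nonneg _
    rw [show n + n - 1 = n + (n - 1) by omega, show n + (n + 1) - 1 = n + (n - 1) + 1 by omega]
    rcases le_total r d with hrd | hrd
    · refine le_add_of_le_of_nonneg ?_ (by positivity)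
      rw [div_le_div_iff₀ (by positivity) (by positivity), pow_succ, pow_succ]
      calc d ^ n * (r ^ (n + (n - 1)) * r) ≤ d ^ n * (r ^ (n + (n - 1)) * d) := by gcongr
        _ = _ := by ring
    · refine le_add_of_nonneg_of_le (by positivity) ?_
      rw [div_le_iff₀ (by positivity), pow_add, Real.rpow_neg hd.le]
      have e1 : r ^ ((n : ℝ) - 1) = r ^ (n - 1) := by
        rw [← Real.rpow_natCast, Nat.cast_sub hn]; simp
      rw [e1]
      calc d ^ n ≤ r ^ n := by gcongr
        _ = _ := by field_simp

end

section

/-! ### Maps that are `C¹` up to the boundary are Lipschitz -/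

lemma locC1 {n : ℕ} {Ω : Set (Euc n)} (ho : IsOpen Ω) {v : Euc n → Euc n} (hv : ContDiffOn ℝ 1 v (closure Ω))
    {x0 : Euc n} (hx0 : x0 ∈ closure Ω) : ∃ ρ > 0, ∃ C : ℝ, ∃ f' : Euc n → Euc n →L[ℝ] Euc n,
      ∀ x ∈ Ω, dist x x0 < ρ → HasFDerivAt v (f' x) x ∧ ‖f' x‖ ≤ C := by
  have h := hv x0 hx0
  rw [show (1 : WithTop ℕ∞) = 0 + 1 by simp, contDiffWithinAt_succ_iff_hasFDerivWithinAt' (by simp),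
    Set.insert_eq_of_mem hx0] at h
  obtain ⟨u, hu, -, -, f', hf', hc⟩ := h
  have hb : ∀ᶠ x in 𝓝[closure Ω] x0, ‖f' x‖ < ‖f' x0‖ + 1 :=
    hc.continuousWithinAt.norm.eventually_lt_const (by linarith)
  have := hb.and hu
  obtain ⟨ρ, hρ, h⟩ := Metric.mem_nhdsWithin_iff.1 this
  refine ⟨ρ, hρ, ‖f' x0‖ + 1, f', fun x hx hd => ?_⟩
  have hm := h ⟨hd, subset_closure hx⟩
  exact ⟨(hf' x hm.2).hasFDerivAt (mem_of_superset (ho.mem_nhds hx) subset_closure), hm.1.le⟩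

lemma path_exists {n : ℕ} {Ω : Set (Euc n)} (ho : IsOpen Ω) (hs : SmoothBoundary n Ω) {x0 : Euc n}
    (hx0 : x0 ∈ closure Ω) {ρ : ℝ} (hρ : 0 < ρ) : ∃ ρ' > 0, ∃ Λ : ℝ, ∀ x ∈ Ω ∩ ball x0 ρ', ∀ y ∈ Ω ∩ ball x0 ρ',
      ∃ x' y', segment ℝ x x' ⊆ Ω ∩ ball x0 ρ ∧ segment ℝ x' y' ⊆ Ω ∩ ball x0 ρ ∧ segment ℝ y' y ⊆ Ω ∩ ball x0 ρ ∧
        ‖x - x'‖ + ‖x' - y'‖ + ‖y' - y‖ ≤ Λ * ‖x - y‖ := by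
  obtain ⟨f, hf, hΩ, hΩf⟩ := hs
  obtain ⟨g, hg, hfg⟩ := grad_exists hf
  have hgc : Continuous g := hg.continuous
  rcases bdry_facts hf.continuous hΩ hx0 with h | ⟨h, hfr⟩
  · have hxΩ : x0 ∈ Ω := by rw [hΩ]; exact h
    obtain ⟨ρ1, hρ1, h1⟩ := Metric.isOpen_iff.1 ho x0 hxΩ
    have hsub : ball x0 (min ρ ρ1) ⊆ Ω ∩ ball x0 ρ := fun z hz =>
      ⟨h1 (ball_subset_ball (min_le_right _ _) hz), ball_subset_ball (min_le_left _ _) hz⟩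
    refine ⟨min ρ ρ1, lt_min hρ hρ1, 1, fun x hx y hy => ⟨x, y, ?_, ?_, ?_, by simp⟩⟩
    · exact ((convex_ball x0 _).segment_subset hx.2 hx.2).trans hsub
    · exact ((convex_ball x0 _).segment_subset hx.2 hy.2).trans hsub
    · exact ((convex_ball x0 _).segment_subset hy.2 hy.2).trans hsub
  · have hgne : g x0 ≠ 0 := fun h0 => hΩf x0 hfr (by ext y; rw [hfg, h0]; simp)
    set ν := g x0 with hν
    have hpos : (0 : ℝ) < inner ℝ ν ν := real_inner_self_pos.2 hgne
    set c : ℝ := inner ℝ ν ν / 2 with hc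
    have hc0 : 0 < c := by positivity
    have e1 : ∀ᶠ z in 𝓝 x0, c < inner ℝ (g z) ν := by
      have hcc : Continuous fun z => (inner ℝ (g z) ν : ℝ) := by fun_prop
      exact continuousAt_const.eventually_lt hcc.continuousAt (by simp only [← hν]; linarith)
    set B := ‖ν‖ + 1 with hB
    have e2 : ∀ᶠ z in 𝓝 x0, ‖g z‖ < B :=
      hgc.norm.continuousAt.eventually_lt continuousAt_const (by simp only [← hν]; linarith)
    obtain ⟨ρ0, hρ0, hball⟩ := Metric.eventually_nhds_iff_ball.1 (e1.and e2)
    set ρ1 := min ρ ρ0 with hρ1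
    have hρ1p : 0 < ρ1 := lt_min hρ hρ0
    have key : ∀ x ∈ Ω ∩ ball x0 ρ1, ∀ p ∈ ball x0 ρ1, ∀ h : Euc n, ∀ s : ℝ, 0 ≤ s → p = x + h - s • ν →
        B * ‖h‖ ≤ s * c → p ∈ Ω ∩ ball x0 ρ := by
      intro x hx p hp h s hs hpe hle
      refine ⟨?_, ball_subset_ball (min_le_left _ _) hp⟩
      obtain ⟨z, hz, hzz⟩ := domain_mvt (f := f) (f' := fderiv ℝ f) (s := ball x0 ρ1)
        (fun x _ => (hf.differentiable (by simp) x).hasFDerivAt.hasFDerivWithinAt) (convex_ball x0 ρ1) hx.2 hp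
      have hzb := hball z (ball_subset_ball (min_le_right _ _) ((convex_ball x0 ρ1).segment_subset hx.2 hp hz))
      rw [hfg, hpe, show x + h - s • ν - x = h - s • ν by abel, inner_sub_right, inner_smul_right] at hzz
      have i1 : (inner ℝ (g z) h : ℝ) ≤ B * ‖h‖ := (real_inner_le_norm _ _).trans (by gcongr; exact hzb.2.le)
      have i2 : s * c ≤ s * inner ℝ (g z) ν := by gcongr; exact hzb.1.le
      have hfx : f x < 0 := by have := hx.1; rw [hΩ] at this; exact this
      rw [hΩ]
      show f p < 0
      rw [hpe]; linarith
    set Λ := B / c with hΛ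
    have hΛ0 : 0 ≤ Λ := by positivity
    set ρ' := ρ1 / (2 * (1 + 2 * Λ * ‖ν‖)) with hρ'
    have hden : 0 < 1 + 2 * Λ * ‖ν‖ := by positivity
    have hρ'0 : 0 < ρ' := by positivity
    have hρ'e : ρ' * (1 + 2 * Λ * ‖ν‖) = ρ1 / 2 := by rw [hρ']; field_simp
    refine ⟨ρ', hρ'0, 1 + 2 * Λ * ‖ν‖, fun x hx y hy => ⟨x - (Λ * ‖x - y‖) • ν, y - (Λ * ‖x - y‖) • ν, ?_⟩⟩
    set r := ‖x - y‖ with hr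
    have hr0 : 0 ≤ r := norm_nonneg _
    have hr2 : r ≤ 2 * ρ' := by
      have := dist_triangle_right x y x0
      rw [dist_eq_norm x y] at this
      have h1 := mem_ball.1 hx.2
      have h2 := mem_ball.1 hy.2
      linarith
    have hin : ∀ w ∈ ball x0 ρ', ∀ s : ℝ, 0 ≤ s → s ≤ Λ * r → w - s • ν ∈ ball x0 ρ1 := by
      intro w hw s hs0 hs
      rw [mem_ball, dist_eq_norm] at hw ⊢
      have e : w - s • ν - x0 = (w - x0) - s • ν := by abel
      have e' : ‖s • ν‖ ≤ Λ * (2 * ρ') * ‖ν‖ := by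
        rw [norm_smul, Real.norm_of_nonneg hs0]
        gcongr
        exact hs.trans (by gcongr)
      rw [e]
      have := norm_sub_le (w - x0) (s • ν)
      nlinarith
    have hρ'1 : ball x0 ρ' ⊆ ball x0 ρ1 := fun w hw => by
      have := hin w hw 0 le_rfl (by positivity)
      simpa using this
    have down : ∀ w ∈ Ω ∩ ball x0 ρ', segment ℝ w (w - (Λ * r) • ν) ⊆ Ω ∩ ball x0 ρ := by
      intro w hw p hp
      rw [segment_eq_image'] at hp
      obtain ⟨θ, hθ, rfl⟩ := hp
      have e : w + θ • (w - (Λ * r) • ν - w) = w - (θ * (Λ * r)) • ν := by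
        rw [sub_sub_cancel_left, smul_neg, smul_smul, sub_eq_add_neg]
      have h0 : 0 ≤ θ * (Λ * r) := mul_nonneg hθ.1 (by positivity)
      have h1 : θ * (Λ * r) ≤ Λ * r := mul_le_of_le_one_left (by positivity) hθ.2
      simp only [e]
      refine key w ⟨hw.1, hρ'1 hw.2⟩ _ (hin w hw.2 _ h0 h1) 0 _ h0 (by simp) ?_
      simp; positivity
    refine ⟨down x hx, ?_, ?_, ?_⟩
    · intro p hp
      rw [segment_eq_image'] at hp
      obtain ⟨θ, hθ, rfl⟩ := hp
      have hw : x + θ • (y - x) ∈ ball x0 ρ' := (convex_ball x0 ρ').segment_subset hx.2 hy.2 (by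
        rw [segment_eq_image']; exact ⟨θ, hθ, rfl⟩)
      have e : x - (Λ * r) • ν + θ • (y - (Λ * r) • ν - (x - (Λ * r) • ν)) = x + θ • (y - x) - (Λ * r) • ν := by
        rw [sub_sub_sub_cancel_right]; abel
      simp only [e]
      refine key x ⟨hx.1, hρ'1 hx.2⟩ _ (hin _ hw _ (by positivity) le_rfl) (θ • (y - x)) _ (by positivity) rfl ?_
      rw [norm_smul, norm_sub_rev y x, ← hr, Real.norm_of_nonneg hθ.1]
      have : Λ * r * c = B * r := by rw [hΛ]; field_simp
      rw [this]
      have hB0 : 0 ≤ B := by positivity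
      gcongr
      exact mul_le_of_le_one_left hr0 hθ.2
    · rw [segment_symm]; exact down y hy
    · have a1 : x - (x - (Λ * r) • ν) = (Λ * r) • ν := by abel
      have a2 : x - (Λ * r) • ν - (y - (Λ * r) • ν) = x - y := by abel
      have a3 : y - (Λ * r) • ν - y = -((Λ * r) • ν) := by abel
      rw [a1, a2, a3, norm_neg, norm_smul, Real.norm_of_nonneg (by positivity), ← hr]
      linarith

lemma lip_of_C1 {n : ℕ} {Ω : Set (Euc n)} (ho : IsOpen Ω) (hb : Bornology.IsBounded Ω) (hs : SmoothBoundary n Ω)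
    {v : Euc n → Euc n} (hv : ContDiffOn ℝ 1 v (closure Ω)) :
    ∃ C : ℝ, ∀ x ∈ Ω, ∀ y ∈ Ω, ‖v x - v y‖ ≤ C * dist x y := by
  have hK : IsCompact (closure Ω) := hb.isCompact_closure
  obtain ⟨M, hM⟩ := hK.exists_bound_of_continuousOn hv.continuousOn
  have main : ∃ C : ℝ, ∀ q ∈ closure Ω ×ˢ closure Ω, q.1 ∈ Ω → q.2 ∈ Ω → ‖v q.1 - v q.2‖ ≤ C * dist q.1 q.2 := by
    refine (hK.prod hK).induction_on (p := fun S => ∃ C : ℝ, ∀ q ∈ S, q.1 ∈ Ω → q.2 ∈ Ω →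
      ‖v q.1 - v q.2‖ ≤ C * dist q.1 q.2) ⟨0, by simp⟩ ?_ ?_ ?_
    · rintro s t hst ⟨C, hC⟩
      exact ⟨C, fun q hq => hC q (hst hq)⟩
    · rintro s t ⟨C, hC⟩ ⟨D, hD⟩
      refine ⟨max C D, fun q hq h1 h2 => ?_⟩
      rcases hq with hq | hq
      · exact (hC q hq h1 h2).trans (by gcongr; exact le_max_left _ _)
      · exact (hD q hq h1 h2).trans (by gcongr; exact le_max_right _ _)
    · rintro ⟨x0, y0⟩ ⟨hx0, hy0⟩
      simp only at hx0 hy0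
      by_cases hne : x0 = y0
      · subst hne
        obtain ⟨ρ, hρ, C, f', hf'⟩ := locC1 ho hv hx0
        obtain ⟨ρ', hρ', Λ, hpath⟩ := path_exists ho hs hx0 hρ
        have seg : ∀ a b, segment ℝ a b ⊆ Ω ∩ ball x0 ρ → ‖v a - v b‖ ≤ C * ‖a - b‖ := by
          intro a b hab
          refine (convex_segment a b).norm_image_sub_le_of_norm_hasFDerivWithin_le (f' := f') (fun z hz =>
            (hf' z (hab hz).1 (hab hz).2).1.hasFDerivWithinAt) (fun z hz => (hf' z (hab hz).1 (hab hz).2).2)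
            (right_mem_segment ℝ a b) (left_mem_segment ℝ a b)
        refine ⟨ball (x0, x0) ρ', mem_nhdsWithin_of_mem_nhds (ball_mem_nhds _ hρ'), C * Λ, fun q hq h1 h2 => ?_⟩
        rw [← ball_prod_same] at hq
        obtain ⟨x', y', s1, s2, s3, hl⟩ := hpath q.1 ⟨h1, hq.1⟩ q.2 ⟨h2, hq.2⟩
        have hC : 0 ≤ C := (norm_nonneg _).trans (hf' q.1 h1 (s1 (left_mem_segment ℝ _ _)).2).2
        calc ‖v q.1 - v q.2‖ = ‖(v q.1 - v x') + (v x' - v y') + (v y' - v q.2)‖ := by congr 1; abel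
          _ ≤ ‖v q.1 - v x'‖ + ‖v x' - v y'‖ + ‖v y' - v q.2‖ := norm_add₃_le
          _ ≤ C * ‖q.1 - x'‖ + C * ‖x' - y'‖ + C * ‖y' - q.2‖ := by
              gcongr
              exacts [seg _ _ s1, seg _ _ s2, seg _ _ s3]
          _ = C * (‖q.1 - x'‖ + ‖x' - y'‖ + ‖y' - q.2‖) := by ring
          _ ≤ C * (Λ * ‖q.1 - q.2‖) := by gcongr
          _ = _ := by rw [dist_eq_norm]; ring
      · have hd : 0 < dist x0 y0 := dist_pos.2 hne
        have hcd : Continuous fun q : Euc n × Euc n => dist q.1 q.2 := by fun_prop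
        have : ∀ᶠ q : Euc n × Euc n in 𝓝 (x0, y0), dist x0 y0 / 2 < dist q.1 q.2 :=
          continuousAt_const.eventually_lt hcd.continuousAt (by simp only; linarith)
        refine ⟨_, mem_nhdsWithin_of_mem_nhds this, 2 * M / (dist x0 y0 / 2), fun q hq h1 h2 => ?_⟩
        have hq' : dist x0 y0 / 2 < dist q.1 q.2 := hq
        have hM1 := hM _ (subset_closure h1)
        have hM2 := hM _ (subset_closure h2)
        have hM0 : 0 ≤ M := (norm_nonneg _).trans hM1
        calc ‖v q.1 - v q.2‖ ≤ 2 * M := by linarith [norm_sub_le (v q.1) (v q.2)]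
          _ = 2 * M / (dist x0 y0 / 2) * (dist x0 y0 / 2) := by field_simp
          _ ≤ _ := by gcongr
  obtain ⟨C, hC⟩ := main
  exact ⟨C, fun x hx y hy => hC (x, y) ⟨subset_closure hx, subset_closure hy⟩ hx hy⟩

end

section

/-! ### Conversion between Bochner and Lebesgue formulations -/

lemma eden_ne_top {n p : ℕ} (hp : 1 ≤ p) {F : Type*} [NormedAddCommGroup F] (v : Euc n → F) (q : Euc n × Euc n) :
    eden n p v q ≠ ⊤ := by
  by_cases hq : q.1 = q.2
  · rw [eden_diag hp hq]; exact ENNReal.zero_ne_top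
  · rw [eden_le_real hq]; exact ENNReal.ofReal_ne_top

lemma real_eden {n p : ℕ} (hp : 1 ≤ p) {s : ℝ} (hs : (n : ℝ) + s * p = ((n + p - 1 : ℕ) : ℝ)) {F : Type*}
    [NormedAddCommGroup F] (v : Euc n → F) (q : Euc n × Euc n) :
    ‖v q.1 - v q.2‖ ^ (p : ℝ) / dist q.1 q.2 ^ ((n : ℝ) + s * p) = (eden n p v q).toReal := by
  rw [hs, Real.rpow_natCast, Real.rpow_natCast]
  by_cases hq : q.1 = q.2
  · rw [eden_diag hp hq, hq]; simp; omega
  · rw [eden_le_real hq, ENNReal.toReal_ofReal (by positivity)]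

lemma memWsp_iff {n p : ℕ} (hp : 1 ≤ p) {s : ℝ} (hs : (n : ℝ) + s * p = ((n + p - 1 : ℕ) : ℝ)) {Ω : Set (Euc n)}
    {v : Euc n → Euc n} (hv : Measurable v) :
    MemWsp n s p Ω v ↔ (∫⁻ x in Ω, ‖v x‖ₑ ^ p) ≠ ⊤ ∧ energy n p Ω v ≠ ⊤ := by
  unfold MemWsp
  simp_rw [real_eden hp hs]
  have h1 : Integrable (fun x => ‖v x‖ ^ (p : ℝ)) (volume.restrict Ω) ↔ (∫⁻ x in Ω, ‖v x‖ₑ ^ p) ≠ ⊤ := by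
    have e : ∀ x, ENNReal.ofReal (‖v x‖ ^ (p : ℝ)) = ‖v x‖ₑ ^ p := fun x => by
      rw [Real.rpow_natCast, ENNReal.ofReal_pow (norm_nonneg _), ofReal_norm]
    unfold Integrable
    rw [hasFiniteIntegral_iff_ofReal (Eventually.of_forall fun x => by positivity)]
    simp_rw [e, lt_top_iff_ne_top]
    exact and_iff_right (hv.norm.pow_const _).aestronglyMeasurable
  have h2 : Integrable (fun q => (eden n p v q).toReal) ((volume.restrict Ω).prod (volume.restrict Ω)) ↔
      energy n p Ω v ≠ ⊤ := by
    unfold Integrable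
    rw [hasFiniteIntegral_iff_ofReal (Eventually.of_forall fun x => by positivity)]
    simp_rw [fun q => ENNReal.ofReal_toReal (eden_ne_top hp v q), lt_top_iff_ne_top]
    exact and_iff_right (measurable_eden hv).ennreal_toReal.aestronglyMeasurable
  rw [h1, h2]
  exact and_iff_right hv.aestronglyMeasurable

lemma sobNorm_congr {n : ℕ} {s p : ℝ} {Ω : Set (Euc n)} (hΩ : MeasurableSet Ω) {v w : Euc n → Euc n}
    (h : ∀ x ∈ Ω, v x = w x) : sobNorm n s p Ω v = sobNorm n s p Ω w := by
  unfold sobNorm sobSemi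
  congr 2
  · exact setIntegral_congr_fun hΩ fun x hx => by simp only [h x hx]
  · exact setIntegral_congr_fun hΩ fun x hx => setIntegral_congr_fun hΩ fun y hy => by simp only [h x hx, h y hy]

lemma memWsp_congr {n : ℕ} {s p : ℝ} {Ω : Set (Euc n)} (hΩ : MeasurableSet Ω) {v w : Euc n → Euc n}
    (h : ∀ x ∈ Ω, v x = w x) : MemWsp n s p Ω v ↔ MemWsp n s p Ω w := by
  have h0 : ∀ᵐ x ∂(volume.restrict Ω), v x = w x := (ae_restrict_iff' hΩ).2 (Eventually.of_forall h)
  unfold MemWsp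
  refine and_congr (aestronglyMeasurable_congr h0) (and_congr (integrable_congr ?_) (integrable_congr ?_))
  · filter_upwards [h0] with x hx; rw [hx]
  · filter_upwards [ae_prod_restrict h0] with q hq; rw [hq.1, hq.2]

lemma jp_congr {n : ℕ} {Ω : Set (Euc n)} (hΩ : MeasurableSet Ω) {v w : Euc n → Euc n}
    (h : ∀ x ∈ Ω, v x = w x) (ψ : Euc n → ℝ) (J : ℝ) : JPairing n Ω v ψ J ↔ JPairing n Ω w ψ J := by
  unfold JPairing
  have : ∀ vk : ℕ → Euc n → Euc n, (fun k => sobNorm n (((n : ℝ) - 1) / n) n Ω (vk k - v))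
      = (fun k => sobNorm n (((n : ℝ) - 1) / n) n Ω (vk k - w)) := fun vk => by
    funext k; exact sobNorm_congr hΩ fun x hx => by simp [h x hx]
  simp_rw [this]

lemma tvset_congr {n : ℕ} {Ω : Set (Euc n)} (hΩ : MeasurableSet Ω) {v w : Euc n → Euc n}
    (h : ∀ x ∈ Ω, v x = w x) : TVset n Ω v = TVset n Ω w := by
  unfold TVset; simp_rw [jp_congr hΩ h]

lemma sobNorm_eq {n p : ℕ} (hp : 1 ≤ p) {s : ℝ} (hs : (n : ℝ) + s * p = ((n + p - 1 : ℕ) : ℝ)) {Ω : Set (Euc n)}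
    {v : Euc n → Euc n} (hv : Measurable v) (hl : (∫⁻ x in Ω, ‖v x‖ₑ ^ p) ≠ ⊤) (he : energy n p Ω v ≠ ⊤) :
    sobNorm n s p Ω v = (∫⁻ x in Ω, ‖v x‖ₑ ^ p).toReal ^ (1 / (p : ℝ)) + (energy n p Ω v).toReal ^ (1 / (p : ℝ)) := by
  unfold sobNorm sobSemi
  congr 2
  · rw [integral_eq_lintegral_of_nonneg_ae (Eventually.of_forall fun x => by positivity) (hv.norm.pow_const _).aestronglyMeasurable]
    congr 1; refine lintegral_congr fun x => ?_
    rw [Real.rpow_natCast, ENNReal.ofReal_pow (norm_nonneg _), ofReal_norm]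
  · have : (∫ x in Ω, ∫ y in Ω, ‖v x - v y‖ ^ (p : ℝ) / dist x y ^ ((n : ℝ) + s * p))
        = ∫ x in Ω, ∫ y in Ω, (eden n p v (x, y)).toReal := by
      refine integral_congr_ae (Eventually.of_forall fun x => ?_)
      refine integral_congr_ae (Eventually.of_forall fun y => ?_)
      exact real_eden hp hs v (x, y)
    rw [this, ← integral_prod (fun q => (eden n p v q).toReal)
      (integrable_toReal_of_lintegral_ne_top (measurable_eden hv).aemeasurable he),
      integral_toReal (measurable_eden hv).aemeasurable
      (Eventually.of_forall fun q => (eden_ne_top hp v q).lt_top)]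
    rfl

lemma rpow_tendsto_zero_iff {p : ℕ} (hp : 1 ≤ p) {f : ℕ → ENNReal} (hf : ∀ k, f k ≠ ⊤) :
    Tendsto (fun k => (f k).toReal ^ (1 / (p : ℝ))) atTop (𝓝 0) ↔ Tendsto f atTop (𝓝 0) := by
  have hp' : (0 : ℝ) < p := by exact_mod_cast hp
  rw [← ENNReal.tendsto_toReal_iff hf ENNReal.zero_ne_top, ENNReal.toReal_zero]
  constructor
  · intro h
    have := h.pow p
    simp only [zero_pow (by omega : p ≠ 0)] at this
    refine this.congr fun k => ?_
    rw [← Real.rpow_natCast, ← Real.rpow_mul ENNReal.toReal_nonneg, one_div, inv_mul_cancel₀ hp'.ne', Real.rpow_one]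
  · intro h
    have := h.rpow_const (p := 1 / (p : ℝ)) (Or.inr (by positivity))
    rwa [Real.zero_rpow (by positivity)] at this

lemma sobNorm_tendsto_iff {n p : ℕ} (hp : 1 ≤ p) {s : ℝ} (hs : (n : ℝ) + s * p = ((n + p - 1 : ℕ) : ℝ)) {Ω : Set (Euc n)}
    {w : ℕ → Euc n → Euc n} (hv : ∀ k, Measurable (w k)) (hl : ∀ k, (∫⁻ x in Ω, ‖w k x‖ₑ ^ p) ≠ ⊤)
    (he : ∀ k, energy n p Ω (w k) ≠ ⊤) :
    Tendsto (fun k => sobNorm n s p Ω (w k)) atTop (𝓝 0) ↔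
      Tendsto (fun k => ∫⁻ x in Ω, ‖w k x‖ₑ ^ p) atTop (𝓝 0) ∧ Tendsto (fun k => energy n p Ω (w k)) atTop (𝓝 0) := by
  simp_rw [fun k => sobNorm_eq hp hs (hv k) (hl k) (he k)]
  rw [← rpow_tendsto_zero_iff hp hl, ← rpow_tendsto_zero_iff hp he]
  constructor
  · intro h
    exact ⟨squeeze_zero (fun k => by positivity) (fun k => le_add_of_nonneg_right (by positivity)) h,
      squeeze_zero (fun k => by positivity) (fun k => le_add_of_nonneg_left (by positivity)) h⟩
  · rintro ⟨h1, h2⟩; simpa using h1.add h2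

end

section

/-! ### The Jacobian pairing -/

/-- Standing assumptions on the domain. -/
structure Dom (n : ℕ) (Ω : Set (Euc n)) : Prop where
  hn : 2 ≤ n
  ho : IsOpen Ω
  hb : Bornology.IsBounded Ω
  hs : SmoothBoundary n Ω

/-- The class of maps we work with. -/
structure Good (n : ℕ) (Ω : Set (Euc n)) (v : Euc n → Euc n) : Prop where
  meas : Measurable v
  cont : ∀ᵐ x ∂(volume.restrict Ω), ContinuousAt v x
  int : IntegrableOn v Ω
  lp : ∫⁻ x in Ω, ‖v x‖ₑ ^ n ≠ ⊤
  en : energy n n Ω v ≠ ⊤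

lemma young_tendsto {ι : Type*} {F : Filter ι} {f e : ι → ENNReal} {B : ENNReal} {c : ENNReal → ENNReal} (hB : B ≠ ⊤)
    (hc : ∀ l, l ≠ 0 → l ≠ ⊤ → c l ≠ ⊤)
    (h : ∀ l, l ≠ 0 → l ≠ ⊤ → ∀ᶠ k in F, f k ≤ l * B + c l * e k) (he : Tendsto e F (𝓝 0)) : Tendsto f F (𝓝 0) := by
  rw [ENNReal.tendsto_nhds_zero]
  intro ε hε
  set δ := min ε 1 / 2 with hδ
  have hm0 : min ε 1 ≠ 0 := by simp [hε.ne']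
  have hmt : min ε 1 ≠ ⊤ := by simp
  have hδ0 : δ ≠ 0 := by simp [hδ, hm0]
  have hδt : δ ≠ ⊤ := by simp [hδ, ENNReal.div_eq_top, hmt]
  set l := δ / (B + 1) with hl
  have hl0 : l ≠ 0 := by simp [hl, hδ0, hB, ENNReal.div_eq_zero_iff]
  have hlt : l ≠ ⊤ := by simp [hl, ENNReal.div_eq_top, hδt]
  have hlB : l * B ≤ δ := by
    calc l * B ≤ l * (B + 1) := by gcongr; exact le_self_add
      _ = δ := ENNReal.div_mul_cancel (by simp) (by finiteness)
  have h2 : Tendsto (fun k => c l * e k) F (𝓝 0) := by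
    simpa using ENNReal.Tendsto.const_mul he (Or.inr (hc l hl0 hlt))
  filter_upwards [h l hl0 hlt, ENNReal.tendsto_nhds_zero.1 h2 δ (pos_iff_ne_zero.2 hδ0)] with k h3 h4
  calc f k ≤ l * B + c l * e k := h3
    _ ≤ δ + δ := add_le_add hlB h4
    _ = min ε 1 := ENNReal.add_halves _
    _ ≤ ε := min_le_left _ _

lemma cont_det {n : ℕ} {Ω : Set (Euc n)} (ho : IsOpen Ω) {v : Euc n → Euc n} (hv : ContDiffOn ℝ 1 v Ω) :
    ContinuousOn (fun x => (jacMat n v x).det) Ω := by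
  have h1 : ContinuousOn (fderiv ℝ v) Ω := hv.continuousOn_fderiv_of_isOpen ho (by simp)
  have h2 : ContinuousOn (jacMat n v) Ω := by
    refine continuousOn_pi.2 fun i => continuousOn_pi.2 fun j => ?_
    simp only [jacMat, Matrix.of_apply]
    have h3 : ContinuousOn (fun x => fderiv ℝ v x (EuclideanSpace.single j 1)) Ω := h1.clm_apply continuousOn_const
    exact (EuclideanSpace.proj (𝕜 := ℝ) i).continuous.comp_continuousOn h3
  exact (Continuous.matrix_det continuous_id).comp_continuousOn h2

lemma int_det {n : ℕ} {Ω : Set (Euc n)} (ho : IsOpen Ω) {v : Euc n → Euc n} (hv : ContDiffOn ℝ 1 v Ω) {φ : Euc n → ℝ}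
    (hφ : Continuous φ) {K : Set (Euc n)} (hK : IsCompact K) (hKΩ : K ⊆ Ω) (h0 : ∀ x, x ∉ K → φ x = 0) :
    IntegrableOn (fun x => φ x * (jacMat n v x).det) Ω := by
  have h1 : IntegrableOn (fun x => φ x * (jacMat n v x).det) K :=
    (hφ.continuousOn.mul ((cont_det ho hv).mono hKΩ)).integrableOn_compact hK
  have h2 : Integrable (K.indicator (fun x => φ x * (jacMat n v x).det)) :=
    (integrable_indicator_iff hK.measurableSet).2 h1
  have e : (K.indicator (fun x => φ x * (jacMat n v x).det)) = (fun x => φ x * (jacMat n v x).det) := by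
    funext x
    by_cases hx : x ∈ K
    · simp [hx]
    · simp [hx, h0 x hx]
  rw [e] at h2
  exact h2.integrableOn

lemma int_det' {n : ℕ} {Ω : Set (Euc n)} (ho : IsOpen Ω) {v : Euc n → Euc n} (hv : ContDiffOn ℝ 1 v Ω) {φ : Euc n → ℝ}
    (hφ : Continuous φ) {K : Set (Euc n)} (hK : IsCompact K) (hKΩ : K ⊆ Ω) (h0 : ∀ x, x ∉ K → φ x = 0) :
    Integrable (fun x => (jacMat n v x).det * φ x) (volume.restrict Ω) := by
  have h := int_det ho hv hφ hK hKΩ h0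
  simp only [mul_comm (φ _)] at h
  exact h

open Classical in
lemma ind_meas {n : ℕ} {Ω : Set (Euc n)} (ho : IsOpen Ω) {v : Euc n → Euc n} (hv : ContinuousOn v Ω) :
    Measurable (Ω.indicator v) := by
  rw [← Set.piecewise_eq_indicator]
  exact hv.measurable_piecewise continuousOn_const ho.measurableSet

lemma cc1_bd {n : ℕ} {Ω : Set (Euc n)} {ψ : Euc n → ℝ} (h : Cc1 n Ω ψ) :
    ∃ K : Set (Euc n), IsCompact K ∧ K ⊆ Ω ∧ (∀ x, x ∉ K → ψ x = 0) ∧ ∃ M, (∀ x, |ψ x| ≤ M) ∧ ∃ Λ, ∀ x, ‖fderiv ℝ ψ x‖ ≤ Λ := by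
  obtain ⟨M, hM⟩ := h.1.continuous.bounded_above_of_compact_support h.2.1
  obtain ⟨Λ, hΛ⟩ := (h.1.continuous_fderiv (by simp)).bounded_above_of_compact_support (h.2.1.fderiv (𝕜 := ℝ))
  exact ⟨tsupport ψ, h.2.1, h.2.2, fun x hx => image_eq_zero_of_notMem_tsupport hx, M, hM, Λ, hΛ⟩

lemma jdiff_tendsto {n : ℕ} {Ω : Set (Euc n)} (D : Dom n Ω) {v : Euc n → Euc n} (hv : Measurable v)
    (hE : energy n n Ω v ≠ ⊤) {ψ : Euc n → ℝ} (hψ : Cc1 n Ω ψ) {a b : ℕ → Euc n → Euc n}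
    (ha : ∀ k, ContDiffOn ℝ 1 (a k) Ω) (hb : ∀ k, ContDiffOn ℝ 1 (b k) Ω)
    (hae : Tendsto (fun k => energy n n Ω (a k - v)) atTop (𝓝 0))
    (hbe : Tendsto (fun k => energy n n Ω (b k - v)) atTop (𝓝 0)) :
    Tendsto (fun k => (∫ x in Ω, (jacMat n (a k) x).det * ψ x) - ∫ x in Ω, (jacMat n (b k) x).det * ψ x) atTop (𝓝 0) := by
  obtain ⟨K, hK, hKΩ, h0, M, hM, Λ, hΛ⟩ := cc1_bd hψ
  obtain ⟨C, hC, est⟩ := estB_dom (by linarith [D.hn]) D.ho hK hKΩ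
  have hsub : ∀ c : Euc n → Euc n, ContDiffOn ℝ 1 c Ω → ∀ w : Euc n → Euc n,
      energy n n Ω (c - w) ≤ 2 ^ n * (energy n n Ω (c - v) + energy n n Ω (w - v)) ∧
      energy n n Ω c ≤ 2 ^ n * (energy n n Ω (c - v) + energy n n Ω v) := by
    intro c hc w
    have hm : Measurable (Ω.indicator c - v) := by
      refine Measurable.sub ?_ hv
      exact ind_meas D.ho hc.continuousOn
    have e1 : energy n n Ω (c - v) = energy n n Ω (Ω.indicator c - v) :=
      energy_congr D.ho.measurableSet fun x hx => by simp [hx]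
    constructor
    · have e2 : energy n n Ω (c - w) = energy n n Ω ((Ω.indicator c - v) - (w - v)) :=
        energy_congr D.ho.measurableSet fun x hx => by simp [hx]
      rw [e1, e2]; exact energy_sub_le hm
    · have e2 : energy n n Ω c = energy n n Ω ((Ω.indicator c - v) + v) :=
        energy_congr D.ho.measurableSet fun x hx => by simp [hx]
      rw [e1, e2]; exact energy_add_le hm
  have hbase : Tendsto (fun k => ENNReal.ofReal |∫ x in Ω, ψ x * ((jacMat n (a k) x).det - (jacMat n (b k) x).det)|)
      atTop (𝓝 0) := by
    refine young_tendsto (B := C * ENNReal.ofReal (Λ + M) * (2 ^ n * (1 + energy n n Ω v) + 2 ^ n * (1 + energy n n Ω v)))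
      (c := fun l => C * ENNReal.ofReal (Λ + M) * (l⁻¹ ^ (n - 1) * 2 ^ n))
      (e := fun k => energy n n Ω (a k - v) + energy n n Ω (b k - v)) (by finiteness)
      (fun l hl0 hlt => by
        have := ENNReal.inv_ne_top.2 hl0
        finiteness) ?_ (by simpa using hae.add hbe)
    intro l hl0 hlt
    filter_upwards [ENNReal.tendsto_nhds_zero.1 hae 1 one_pos, ENNReal.tendsto_nhds_zero.1 hbe 1 one_pos] with k h1 h2
    refine (est (a k) (b k) (ha k) (hb k) ψ hψ.1 h0 M hM Λ hΛ l hl0 hlt).trans ?_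
    have h3 := (hsub (a k) (ha k) (b k)).1
    have h4 := (hsub (a k) (ha k) (b k)).2
    have h5 := (hsub (b k) (hb k) (b k)).2
    calc _ ≤ C * ENNReal.ofReal (Λ + M) * (l * (2 ^ n * (1 + energy n n Ω v) + 2 ^ n * (1 + energy n n Ω v))
          + l⁻¹ ^ (n - 1) * (2 ^ n * (energy n n Ω (a k - v) + energy n n Ω (b k - v)))) := by
          refine mul_le_mul' le_rfl (add_le_add (mul_le_mul' le_rfl (add_le_add ?_ ?_)) (mul_le_mul' le_rfl h3))
          · exact h4.trans (mul_le_mul' le_rfl (add_le_add h1 le_rfl))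
          · exact h5.trans (mul_le_mul' le_rfl (add_le_add h2 le_rfl))
      _ = _ := by ring
  have h2 := (ENNReal.tendsto_toReal_iff (fun k => ENNReal.ofReal_ne_top) ENNReal.zero_ne_top).2 hbase
  simp only [ENNReal.toReal_ofReal (abs_nonneg _), ENNReal.toReal_zero] at h2
  have h3 := (tendsto_zero_iff_abs_tendsto_zero _).2 h2
  refine h3.congr fun k => ?_
  rw [← integral_sub]
  · congr 1; funext x; ring
  · exact int_det' D.ho (ha k) hψ.1.continuous hK hKΩ h0
  · exact int_det' D.ho (hb k) hψ.1.continuous hK hKΩ h0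

lemma hs_exp {n : ℕ} (hn : 2 ≤ n) : (n : ℝ) + (((n : ℝ) - 1) / n) * n = ((n + n - 1 : ℕ) : ℝ) := by
  have : (n : ℝ) ≠ 0 := by positivity
  rw [div_mul_cancel₀ _ this, Nat.cast_sub (by omega)]; push_cast; ring

lemma seq_tendsto {n : ℕ} {Ω : Set (Euc n)} (D : Dom n Ω) {v : Euc n → Euc n} (G : Good n Ω v) {a : ℕ → Euc n → Euc n}
    (ha : ∀ k, ContDiffOn ℝ 1 (a k) (closure Ω)) :
    Tendsto (fun k => sobNorm n (((n : ℝ) - 1) / n) n Ω (a k - v)) atTop (𝓝 0) ↔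
      Tendsto (fun k => ∫⁻ x in Ω, ‖a k x - v x‖ₑ ^ n) atTop (𝓝 0) ∧
      Tendsto (fun k => energy n n Ω (a k - v)) atTop (𝓝 0) := by
  have hn1 : 1 ≤ n := by linarith [D.hn]
  have hΩ := D.ho.measurableSet
  have hm : ∀ k, Measurable (Ω.indicator (a k)) := fun k =>
    ind_meas D.ho ((ha k).continuousOn.mono subset_closure)
  have hl : ∀ k, (∫⁻ x in Ω, ‖(Ω.indicator (a k) - v) x‖ₑ ^ n) ≠ ⊤ := fun k => by
    obtain ⟨M, hM⟩ := D.hb.isCompact_closure.exists_bound_of_continuousOn (ha k).continuousOn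
    have h1 : ∫⁻ x in Ω, ‖a k x‖ₑ ^ n ≠ ⊤ := by
      refine ne_top_of_le_ne_top (b := ENNReal.ofReal M ^ n * volume Ω) ?_ ?_
      · have := D.hb.measure_lt_top (μ := volume)
        finiteness
      · rw [← setLIntegral_const]
        refine setLIntegral_mono' hΩ fun x hx => ?_
        gcongr
        rw [← ofReal_norm]; exact ENNReal.ofReal_le_ofReal (hM x (subset_closure hx))
    refine ne_top_of_le_ne_top (b := 2 ^ n * ((∫⁻ x in Ω, ‖a k x‖ₑ ^ n) + ∫⁻ x in Ω, ‖v x‖ₑ ^ n)) ?_ ?_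
    · have := G.lp; finiteness
    · rw [← lintegral_add_right _ (G.meas.enorm.pow_const n), ← lintegral_const_mul' _ _ (by finiteness)]
      refine setLIntegral_mono' hΩ fun x hx => ?_
      refine le_trans ?_ (add_pow_enn _ _ _)
      gcongr
      simp only [Pi.sub_apply, Set.indicator_of_mem hx]
      exact enorm_sub_le
  have he : ∀ k, energy n n Ω (Ω.indicator (a k) - v) ≠ ⊤ := fun k => by
    obtain ⟨C, hC⟩ := lip_of_C1 D.ho D.hb D.hs (ha k)
    have h1 : energy n n Ω (Ω.indicator (a k)) ≠ ⊤ := by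
      refine energy_lip_fin hn1 hn1 hΩ D.hb (C := C) fun x hx y hy => ?_
      simpa [hx, hy] using hC x hx y hy
    refine ne_top_of_le_ne_top ?_ (energy_sub_le (hm k))
    have := G.en; finiteness
  have key := sobNorm_tendsto_iff hn1 (hs_exp D.hn) (fun k => (hm k).sub G.meas) hl he
  have e1 : (fun k => sobNorm n (((n : ℝ) - 1) / n) n Ω (a k - v)) =
      fun k => sobNorm n (((n : ℝ) - 1) / n) n Ω (Ω.indicator (a k) - v) := by
    funext k; exact sobNorm_congr hΩ fun x hx => by simp [hx]
  have e2 : (fun k => energy n n Ω (a k - v)) = fun k => energy n n Ω (Ω.indicator (a k) - v) := by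
    funext k; exact energy_congr hΩ fun x hx => by simp [hx]
  have e3 : (fun k => ∫⁻ x in Ω, ‖a k x - v x‖ₑ ^ n) = fun k => ∫⁻ x in Ω, ‖(Ω.indicator (a k) - v) x‖ₑ ^ n := by
    funext k; exact setLIntegral_congr_fun hΩ fun x hx => by simp [hx]
  rw [e1, e2, e3]; exact key

lemma app_good_tendsto {n : ℕ} {Ω : Set (Euc n)} (D : Dom n Ω) (S : ApproxSys n Ω) {v : Euc n → Euc n} (G : Good n Ω v)
    {Q : Euc n → Euc n} {L : NNReal} (hQ : LipschitzWith L Q) :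
    Tendsto (fun k => ∫⁻ x in Ω, ‖Q (app S v k x) - Q (v x)‖ₑ ^ n) atTop (𝓝 0) ∧
      Tendsto (fun k => energy n n Ω (Q ∘ app S v k - Q ∘ v)) atTop (𝓝 0) :=
  ⟨app_lp_tendsto (by linarith [D.hn]) D.ho.measurableSet S G.meas G.int G.cont G.lp hQ,
   app_energy_tendsto (by linarith [D.hn]) D.ho.measurableSet S G.meas G.int G.cont G.en hQ⟩

lemma jp_exists {n : ℕ} {Ω : Set (Euc n)} (D : Dom n Ω) {v : Euc n → Euc n} (G : Good n Ω v)
    {ψ : Euc n → ℝ} (hψ : Cc1 n Ω ψ) : ∃ J, JPairing n Ω v ψ J := by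
  obtain ⟨S⟩ := approxSys_exists D.ho D.hb D.hs
  have hC := fun k => app_contDiff D.ho.measurableSet S G.int k
  obtain ⟨hl, he⟩ := app_good_tendsto D S G LipschitzWith.id
  simp only [Function.id_comp, id] at hl he
  set f : ℕ → ℝ := fun k => ∫ x in Ω, (jacMat n (app S v k) x).det * ψ x with hf
  have hcau : CauchySeq f := by
    by_contra hcon
    rw [Metric.cauchySeq_iff'] at hcon
    push Not at hcon
    obtain ⟨ε, hε, h⟩ := hcon
    choose m hm1 hm2 using h
    have ht : Tendsto m atTop atTop := tendsto_atTop_mono hm1 tendsto_id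
    have h3 := jdiff_tendsto D G.meas G.en hψ (fun k => (hC (m k)).contDiffOn) (fun k => (hC k).contDiffOn)
      (he.comp ht) he
    obtain ⟨k, hk⟩ := ((Metric.tendsto_nhds.1 h3) ε hε).exists
    have := hm2 k
    rw [Real.dist_eq] at this hk
    simp only [hf, sub_zero] at this hk
    linarith
  obtain ⟨J, hJ⟩ := cauchySeq_tendsto_of_complete hcau
  refine ⟨J, ⟨app S v, fun k => (hC k).contDiffOn, (seq_tendsto D G fun k => (hC k).contDiffOn).2 ⟨hl, he⟩, hJ⟩, ?_⟩
  intro vk hvk hlim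
  have h1 := ((seq_tendsto D G hvk).1 hlim).2
  have h2 := jdiff_tendsto D G.meas G.en hψ (fun k => (hvk k).mono subset_closure) (fun k => (hC k).contDiffOn) h1 he
  have h3 := h2.add hJ
  rw [zero_add] at h3
  exact h3.congr fun k => by simp [hf]

lemma jp_unique {n : ℕ} {Ω : Set (Euc n)} {v : Euc n → Euc n} {ψ : Euc n → ℝ} {J J' : ℝ} (h : JPairing n Ω v ψ J)
    (h' : JPairing n Ω v ψ J') : J = J' := by
  obtain ⟨vk, h1, h2, h3⟩ := h.1
  exact tendsto_nhds_unique h3 (h'.2 vk h1 h2)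

/-- The value of the Jacobian pairing. -/
def JJ (n : ℕ) (Ω : Set (Euc n)) (v : Euc n → Euc n) (ψ : Euc n → ℝ) : ℝ := Classical.epsilon (JPairing n Ω v ψ)

lemma JJ_spec {n : ℕ} {Ω : Set (Euc n)} (D : Dom n Ω) {v : Euc n → Euc n} (G : Good n Ω v)
    {ψ : Euc n → ℝ} (hψ : Cc1 n Ω ψ) : JPairing n Ω v ψ (JJ n Ω v ψ) := Classical.epsilon_spec (jp_exists D G hψ)

lemma tvset_eq {n : ℕ} {Ω : Set (Euc n)} (D : Dom n Ω) {v : Euc n → Euc n} (G : Good n Ω v) :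
    TVset n Ω v = {r | ∃ ψ : Euc n → ℝ, Cc1 n Ω ψ ∧ (∀ x, |ψ x| ≤ 1) ∧ JJ n Ω v ψ = r} := by
  ext r
  constructor
  · rintro ⟨ψ, h1, h2, h3⟩; exact ⟨ψ, h1, h2, jp_unique (JJ_spec D G h1) h3⟩
  · rintro ⟨ψ, h1, h2, rfl⟩; exact ⟨ψ, h1, h2, JJ_spec D G h1⟩

lemma JJ_lim {n : ℕ} {Ω : Set (Euc n)} (D : Dom n Ω) {v : Euc n → Euc n} (G : Good n Ω v)
    {ψ : Euc n → ℝ} (hψ : Cc1 n Ω ψ) {a : ℕ → Euc n → Euc n} (ha : ∀ k, ContDiff ℝ 1 (a k))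
    (hl : Tendsto (fun k => ∫⁻ x in Ω, ‖a k x - v x‖ₑ ^ n) atTop (𝓝 0))
    (he : Tendsto (fun k => energy n n Ω (a k - v)) atTop (𝓝 0)) :
    Tendsto (fun k => ∫ x in Ω, (jacMat n (a k) x).det * ψ x) atTop (𝓝 (JJ n Ω v ψ)) :=
  (JJ_spec D G hψ).2 a (fun k => (ha k).contDiffOn) ((seq_tendsto D G fun k => (ha k).contDiffOn).2 ⟨hl, he⟩)

lemma JJ_app {n : ℕ} {Ω : Set (Euc n)} (D : Dom n Ω) (S : ApproxSys n Ω) {v : Euc n → Euc n} (G : Good n Ω v)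
    {ψ : Euc n → ℝ} (hψ : Cc1 n Ω ψ) :
    Tendsto (fun k => ∫ x in Ω, (jacMat n (app S v k) x).det * ψ x) atTop (𝓝 (JJ n Ω v ψ)) :=
  JJ_lim D G hψ (fun k => app_contDiff D.ho.measurableSet S G.int k) (app_good_tendsto D S G LipschitzWith.id).1
    (app_good_tendsto D S G LipschitzWith.id).2

lemma JJ_est {n : ℕ} {Ω : Set (Euc n)} (D : Dom n Ω) {K : Set (Euc n)} (hK : IsCompact K) (hKΩ : K ⊆ Ω) :
    ∃ C : ENNReal, C ≠ ⊤ ∧ ∀ v w, Good n Ω v → Good n Ω w → ∀ ψ, Cc1 n Ω ψ → (∀ x, x ∉ K → ψ x = 0) →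
      ∀ M : ℝ, (∀ x, |ψ x| ≤ M) → ∀ Λ : ℝ, (∀ x, ‖fderiv ℝ ψ x‖ ≤ Λ) → ∀ l : ENNReal, l ≠ 0 → l ≠ ⊤ →
      ENNReal.ofReal |JJ n Ω v ψ - JJ n Ω w ψ| ≤
        C * ENNReal.ofReal (Λ + M) * (l * (energy n n Ω v + energy n n Ω w) + l⁻¹ ^ (n - 1) * energy n n Ω (v - w)) := by
  obtain ⟨C, hC, est⟩ := estB_dom (by linarith [D.hn]) D.ho hK hKΩ
  refine ⟨C, hC, fun v w Gv Gw ψ hψ h0 M hM Λ hΛ l hl0 hlt => ?_⟩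
  obtain ⟨S⟩ := approxSys_exists D.ho D.hb D.hs
  have hn1 : 1 ≤ n := by linarith [D.hn]
  have hΩ := D.ho.measurableSet
  have hCv := fun k => app_contDiff hΩ S Gv.int k
  have hCw := fun k => app_contDiff hΩ S Gw.int k
  have h1 := ((JJ_app D S Gv hψ).sub (JJ_app D S Gw hψ)).abs
  have h2 := (ENNReal.continuous_ofReal.tendsto _).comp h1
  set R := C * ENNReal.ofReal (Λ + M) * (l * (energy n n Ω v + energy n n Ω w) + l⁻¹ ^ (n - 1) * energy n n Ω (v - w))
  have h3 : Tendsto (fun k => appC S (n + n - 1) k * R) atTop (𝓝 (1 * R)) :=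
    ENNReal.Tendsto.mul_const (appC_tendsto S _) (Or.inl one_ne_zero)
  rw [one_mul] at h3
  refine le_of_tendsto_of_tendsto' h2 h3 fun k => ?_
  simp only [Function.comp]
  rw [← integral_sub (by exact int_det' D.ho (hCv k).contDiffOn hψ.1.continuous hK hKΩ h0)
    (by exact int_det' D.ho (hCw k).contDiffOn hψ.1.continuous hK hKΩ h0)]
  have e : ∀ x, (jacMat n (app S v k) x).det * ψ x - (jacMat n (app S w k) x).det * ψ x
    = ψ x * ((jacMat n (app S v k) x).det - (jacMat n (app S w k) x).det) := fun x => by ring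
  simp_rw [e]
  refine (est _ _ (hCv k).contDiffOn (hCw k).contDiffOn ψ hψ.1 h0 M hM Λ hΛ l hl0 hlt).trans ?_
  rw [← app_sub hΩ S Gv.int Gw.int]
  calc _ ≤ C * ENNReal.ofReal (Λ + M) * (l * (appC S (n + n - 1) k * energy n n Ω v + appC S (n + n - 1) k * energy n n Ω w)
        + l⁻¹ ^ (n - 1) * (appC S (n + n - 1) k * energy n n Ω (v - w))) :=
        mul_le_mul' le_rfl (add_le_add (mul_le_mul' le_rfl (add_le_add (app_energy_le hn1 hΩ S Gv.meas Gv.int k)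
          (app_energy_le hn1 hΩ S Gw.meas Gw.int k))) (mul_le_mul' le_rfl
          (app_energy_le hn1 hΩ S (Gv.meas.sub Gw.meas) (Gv.int.sub Gw.int) k)))
    _ = _ := by ring

lemma cc1_comb {n : ℕ} {Ω : Set (Euc n)} {ψ φ : Euc n → ℝ} (h1 : Cc1 n Ω ψ) (h2 : Cc1 n Ω φ) (a b : ℝ) :
    Cc1 n Ω (a • ψ + b • φ) := by
  have hs : tsupport (a • ψ + b • φ) ⊆ tsupport ψ ∪ tsupport φ := by
    refine closure_minimal (fun x hx => ?_) ((isClosed_tsupport _).union (isClosed_tsupport _))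
    by_contra hcon
    rw [Set.mem_union, not_or] at hcon
    apply hx
    simp [image_eq_zero_of_notMem_tsupport hcon.1, image_eq_zero_of_notMem_tsupport hcon.2]
  exact ⟨(h1.1.const_smul a).add (h2.1.const_smul b),
    (h1.2.1.isCompact.union h2.2.1.isCompact).of_isClosed_subset (isClosed_tsupport _) hs, hs.trans (Set.union_subset h1.2.2 h2.2.2)⟩

lemma JJ_linear {n : ℕ} {Ω : Set (Euc n)} (D : Dom n Ω) {v : Euc n → Euc n} (G : Good n Ω v)
    {ψ φ : Euc n → ℝ} (h1 : Cc1 n Ω ψ) (h2 : Cc1 n Ω φ) (a b : ℝ) :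
    JJ n Ω v (a • ψ + b • φ) = a * JJ n Ω v ψ + b * JJ n Ω v φ := by
  obtain ⟨S⟩ := approxSys_exists D.ho D.hb D.hs
  refine tendsto_nhds_unique (JJ_app D S G (cc1_comb h1 h2 a b))
    ((((JJ_app D S G h1).const_mul a).add ((JJ_app D S G h2).const_mul b)).congr fun k => ?_)
  have hC := app_contDiff D.ho.measurableSet S G.int k
  have i1 : ∀ {ψ : Euc n → ℝ}, Cc1 n Ω ψ → IntegrableOn (fun x => (jacMat n (app S v k) x).det * ψ x) Ω := fun {ψ} h => by
    obtain ⟨K, hK, hKΩ, h0, -⟩ := cc1_bd h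
    exact int_det' D.ho hC.contDiffOn h.1.continuous hK hKΩ h0
  rw [← integral_const_mul, ← integral_const_mul, ← integral_add ((i1 h1).const_mul a) ((i1 h2).const_mul b)]
  congr 1; funext x; simp; ring

lemma good_zero {n : ℕ} {Ω : Set (Euc n)} (hn : 2 ≤ n) : Good n Ω 0 where
  meas := measurable_const
  cont := Eventually.of_forall fun x => continuousAt_const
  int := integrable_zero _ _ _
  lp := by simp [show n ≠ 0 by omega]
  en := by simp [energy_eq, eden, show n ≠ 0 by omega]

lemma JJ_zero {n : ℕ} {Ω : Set (Euc n)} (D : Dom n Ω) {ψ : Euc n → ℝ} (hψ : Cc1 n Ω ψ) : JJ n Ω 0 ψ = 0 := by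
  have := D.hn
  have h := JJ_lim D (good_zero D.hn) hψ (a := fun _ => 0) (fun k => contDiff_const) (by simp [show n ≠ 0 by omega])
    (by simp [energy_eq, eden, show n ≠ 0 by omega])
  refine tendsto_nhds_unique h ?_
  have e : ∀ x, (jacMat n (0 : Euc n → Euc n) x).det = 0 := fun x => by
    have : Nonempty (Fin n) := ⟨⟨0, by omega⟩⟩
    have e : jacMat n (0 : Euc n → Euc n) x = 0 := by
      ext i j; simp [jacMat]
    rw [e, Matrix.det_zero]
  simp [e]

lemma JJ_bound {n : ℕ} {Ω : Set (Euc n)} (D : Dom n Ω) {K : Set (Euc n)} (hK : IsCompact K) (hKΩ : K ⊆ Ω) :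
    ∃ C : ENNReal, C ≠ ⊤ ∧ ∀ v, Good n Ω v → ∀ ψ, Cc1 n Ω ψ → (∀ x, x ∉ K → ψ x = 0) →
      ∀ M : ℝ, (∀ x, |ψ x| ≤ M) → ∀ Λ : ℝ, (∀ x, ‖fderiv ℝ ψ x‖ ≤ Λ) →
      ENNReal.ofReal |JJ n Ω v ψ| ≤ C * ENNReal.ofReal (Λ + M) * energy n n Ω v := by
  obtain ⟨C, hC, est⟩ := JJ_est D hK hKΩ
  refine ⟨C * 2, by finiteness, fun v G ψ hψ h0 M hM Λ hΛ => ?_⟩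
  have h := est v 0 G (good_zero D.hn) ψ hψ h0 M hM Λ hΛ 1 one_ne_zero ENNReal.one_ne_top
  have e : energy n n Ω (0 : Euc n → Euc n) = 0 := by
    have := D.hn
    simp [energy_eq, eden, show n ≠ 0 by omega]
  rw [JJ_zero D hψ, e] at h
  simp only [sub_zero, add_zero, inv_one, one_pow, one_mul] at h
  exact h.trans (le_of_eq (by ring))

end

section

/-! ### The regularised projections -/

/-- `N_ε(z) = √(|z|² + ε²)`. -/
def NN {n : ℕ} (ε : ℝ) (z : Euc n) : ℝ := √(‖z‖ ^ 2 + ε ^ 2)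

/-- Regularised projection onto the sphere. -/
def Qe {n : ℕ} (ε : ℝ) (z : Euc n) : Euc n := (NN ε z)⁻¹ • z

lemma NN_sq {n : ℕ} (ε : ℝ) (z : Euc n) : NN ε z ^ 2 = ‖z‖ ^ 2 + ε ^ 2 := Real.sq_sqrt (by positivity)

lemma NN_nonneg {n : ℕ} (ε : ℝ) (z : Euc n) : 0 ≤ NN ε z := Real.sqrt_nonneg _

lemma norm_le_NN {n : ℕ} (ε : ℝ) (z : Euc n) : ‖z‖ ≤ NN ε z :=
  Real.le_sqrt_of_sq_le (by nlinarith [sq_nonneg ε])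

lemma eps_le_NN {n : ℕ} (ε : ℝ) (z : Euc n) : ε ≤ NN ε z :=
  Real.le_sqrt_of_sq_le (by nlinarith [sq_nonneg ‖z‖])

lemma NN_pos {n : ℕ} {ε : ℝ} (hε : 0 < ε) (z : Euc n) : 0 < NN ε z := hε.trans_le (eps_le_NN ε z)

lemma NN_lip {n : ℕ} (ε : ℝ) {z : Euc n} (w : Euc n) (hz : 0 < NN ε z) : |NN ε w - NN ε z| ≤ ‖z - w‖ := by
  have hw := NN_nonneg ε w
  have h1 : |NN ε w - NN ε z| * (NN ε w + NN ε z) = |‖w‖ - ‖z‖| * (‖w‖ + ‖z‖) := by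
    rw [← abs_of_nonneg (show 0 ≤ NN ε w + NN ε z by positivity), ← abs_mul,
      ← abs_of_nonneg (show 0 ≤ ‖w‖ + ‖z‖ by positivity), ← abs_mul]
    congr 1
    nlinarith [NN_sq ε w, NN_sq ε z]
  have h2 : |‖w‖ - ‖z‖| ≤ ‖z - w‖ := by rw [abs_sub_comm]; exact abs_norm_sub_norm_le z w
  have h3 : |‖w‖ - ‖z‖| * (‖w‖ + ‖z‖) ≤ |‖w‖ - ‖z‖| * (NN ε w + NN ε z) :=
    mul_le_mul_of_nonneg_left (add_le_add (norm_le_NN _ _) (norm_le_NN _ _)) (abs_nonneg _)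
  rw [← h1] at h3
  exact (le_of_mul_le_mul_right h3 (by positivity)).trans h2

lemma Qe_norm_le {n : ℕ} (ε : ℝ) (z : Euc n) : ‖Qe ε z‖ ≤ 1 := by
  rw [Qe, norm_smul, norm_inv, Real.norm_of_nonneg (NN_nonneg ε z), inv_mul_eq_div]
  exact div_le_one_of_le₀ (norm_le_NN ε z) (NN_nonneg ε z)

lemma Qe_sub_le {n : ℕ} (ε : ℝ) {z : Euc n} (w : Euc n) (hz : 0 < NN ε z) :
    ‖Qe ε z - Qe ε w‖ ≤ 2 * ‖z - w‖ / NN ε z := by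
  have e : Qe ε z - Qe ε w = (NN ε z)⁻¹ • (z - w) + ((NN ε z)⁻¹ * (NN ε w - NN ε z)) • Qe ε w := by
    unfold Qe
    rw [smul_smul, smul_sub]
    by_cases hw : NN ε w = 0
    · have : w = 0 := norm_le_zero_iff.1 (hw ▸ norm_le_NN ε w)
      simp [this]
    · have : (NN ε z)⁻¹ * (NN ε w - NN ε z) * (NN ε w)⁻¹ = (NN ε z)⁻¹ - (NN ε w)⁻¹ := by field_simp
      rw [this, sub_smul]; abel
  rw [e]
  refine (norm_add_le _ _).trans ?_
  rw [norm_smul, norm_smul, norm_mul, norm_inv, Real.norm_of_nonneg hz.le, Real.norm_eq_abs]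
  have h1 := NN_lip ε w hz
  have h2 := Qe_norm_le ε w
  calc _ ≤ (NN ε z)⁻¹ * ‖z - w‖ + (NN ε z)⁻¹ * ‖z - w‖ * 1 := by gcongr
    _ = _ := by rw [div_eq_mul_inv]; ring

lemma Qe_lip {n : ℕ} {ε : ℝ} (hε : 0 < ε) : LipschitzWith (Real.toNNReal (2 / ε)) (Qe (n := n) ε) := by
  refine LipschitzWith.of_dist_le_mul fun z w => ?_
  rw [dist_eq_norm, dist_eq_norm, Real.coe_toNNReal _ (by positivity)]
  refine (Qe_sub_le ε w (NN_pos hε z)).trans ?_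
  rw [mul_div_right_comm]
  have := eps_le_NN ε z
  gcongr

lemma Qe_contDiff {n : ℕ} {ε : ℝ} (hε : 0 < ε) : ContDiff ℝ (⊤ : ℕ∞) (Qe (n := n) ε) := by
  refine ContDiff.smul (ContDiff.inv (ContDiff.sqrt ?_ fun z => by positivity) fun z => (NN_pos hε z).ne') contDiff_id
  exact (contDiff_norm_sq ℝ).add contDiff_const

lemma NN_cont {n : ℕ} : Continuous (fun p : ℝ × Euc n => NN p.1 p.2) := by unfold NN; fun_prop

lemma Qe_contAt {n : ℕ} (ε : ℝ) {z : Euc n} (hz : z ≠ 0) : ContinuousAt (Qe ε) z := by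
  have h1 : ContinuousAt (fun z : Euc n => NN ε z) z := (NN_cont.comp (by fun_prop : Continuous fun z : Euc n => (ε, z))).continuousAt
  exact (h1.inv₀ ((norm_pos_iff.2 hz).trans_le (norm_le_NN ε z)).ne').smul continuousAt_id

lemma Qe_measurable {n : ℕ} (ε : ℝ) : Measurable (Qe (n := n) ε) := by
  unfold Qe NN; fun_prop

lemma Qe_tendsto {n : ℕ} {z : Euc n} (hz : z ≠ 0) {ε : ℕ → ℝ} (hε : Tendsto ε atTop (𝓝 0)) :
    Tendsto (fun k => Qe (ε k) z) atTop (𝓝 (Qe 0 z)) := by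
  have h1 : Continuous (fun t : ℝ => NN t z) := by unfold NN; fun_prop
  have h2 : Tendsto (fun k => NN (ε k) z) atTop (𝓝 (NN 0 z)) := (h1.tendsto 0).comp hε
  have h3 := h2.inv₀ ((norm_pos_iff.2 hz).trans_le (norm_le_NN 0 z)).ne'
  exact h3.smul_const z

lemma Qe_zero_proj {n : ℕ} (u : Euc n → Euc n) (a x : Euc n) : Qe 0 (u x - a) = proj n u a x := by
  simp [Qe, proj, NN]

/-- Exponent used in the interpolation. -/
def qx (n : ℕ) : ℝ := n - 1 / (2 * n)

lemma qx_facts {n : ℕ} (hn : 2 ≤ n) : 0 < qx n ∧ qx n < n ∧ 0 ≤ 2 * n - 1 - qx n / (n + 1 - qx n) ∧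
    2 * n - 1 - qx n / (n + 1 - qx n) < (n : ℝ) := by
  have h2 : (2 : ℝ) ≤ n := by exact_mod_cast hn
  have hd : (1 : ℝ) / (2 * n) ≤ 1 / 4 := one_div_le_one_div_of_le (by norm_num) (by linarith)
  have hd0 : 0 < (1 : ℝ) / (2 * n) := by positivity
  have hnd : (n : ℝ) * (1 / (2 * n)) = 1 / 2 := by field_simp
  unfold qx
  generalize (1 : ℝ) / (2 * n) = d at *
  have hp : 0 < (n : ℝ) + 1 - (n - d) := by linarith
  refine ⟨by linarith, by linarith, ?_, ?_⟩
  · have : (n - d) / ((n : ℝ) + 1 - (n - d)) ≤ n := by rw [div_le_iff₀ hp]; nlinarith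
    linarith
  · have : (n : ℝ) - 1 < (n - d) / ((n : ℝ) + 1 - (n - d)) := by rw [lt_div_iff₀ hp]; nlinarith
    linarith

/-- Dominating density. -/
def gden (n : ℕ) (u : Euc n → Euc n) (a : Euc n) (q : Euc n × Euc n) : ENNReal :=
  ENNReal.ofReal (‖u q.1 - u q.2‖ ^ qx n / dist q.1 q.2 ^ (2 * n - 1)) * ENNReal.ofReal (‖u q.1 - a‖ ^ (-qx n))

lemma gden_meas {n : ℕ} {u : Euc n → Euc n} (hu : Measurable u) :
    Measurable (fun p : Euc n × (Euc n × Euc n) => gden n u p.1 p.2) := by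
  unfold gden
  refine Measurable.mul (M := ENNReal) ?_ ?_
  · refine ENNReal.measurable_ofReal.comp (Measurable.div (Measurable.pow_const ?_ _) (Measurable.pow_const ?_ _)) <;> fun_prop
  · refine ENNReal.measurable_ofReal.comp (Measurable.pow_const ?_ _); fun_prop

lemma gden_meas' {n : ℕ} {u : Euc n → Euc n} (hu : Measurable u) (a : Euc n) : Measurable (gden n u a) := by
  have h : Measurable (fun q : Euc n × Euc n => (a, q)) := by fun_prop
  have := (gden_meas hu).comp h
  simpa only [Function.comp_def] using this

lemma interp {n : ℕ} (hn : 2 ≤ n) {d r : ℝ} (hd : 0 ≤ d) (hr : 0 < r) :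
    d ^ qx n / r ^ (2 * n - 1) ≤ d ^ (n + 1) / r ^ (n + (n + 1) - 1) + r ^ (-(2 * n - 1 - qx n / (n + 1 - qx n) : ℝ)) := by
  obtain ⟨h1, h2, h3, h4⟩ := qx_facts hn
  have hp : 0 < (n : ℝ) + 1 - qx n := by linarith
  rw [← Real.rpow_natCast r (2 * n - 1), ← Real.rpow_natCast r (n + (n + 1) - 1), ← Real.rpow_natCast d (n + 1)]
  have e1 : ((2 * n - 1 : ℕ) : ℝ) = 2 * n - 1 := by rw [Nat.cast_sub (by omega)]; push_cast; ring
  have e2 : ((n + (n + 1) - 1 : ℕ) : ℝ) = 2 * n := by rw [Nat.cast_sub (by omega)]; push_cast; ring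
  rw [e1, e2]; push_cast
  by_cases hc : r ≤ d ^ ((n : ℝ) + 1 - qx n)
  · have hd0 : 0 < d := by
      rcases hd.eq_or_lt with h | h
      · rw [← h, Real.zero_rpow hp.ne'] at hc; linarith
      · exact h
    refine le_trans ?_ (le_add_of_nonneg_right (by positivity))
    rw [div_le_div_iff₀ (by positivity) (by positivity)]
    have : r ^ (2 * n : ℝ) = r * r ^ (2 * n - 1 : ℝ) := by
      nth_rw 2 [← Real.rpow_one r]; rw [← Real.rpow_add hr]; congr 1; ring
    rw [this, show (n : ℝ) + 1 = qx n + (n + 1 - qx n) by ring, Real.rpow_add hd0, mul_assoc]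
    gcongr
  · push Not at hc
    refine le_trans ?_ (le_add_of_nonneg_left (by positivity))
    have : d ^ qx n ≤ r ^ (qx n / (n + 1 - qx n)) := by
      have h5 : d ^ qx n = (d ^ ((n : ℝ) + 1 - qx n)) ^ (qx n / (n + 1 - qx n)) := by
        rw [← Real.rpow_mul hd, mul_div_cancel₀ _ hp.ne']
      rw [h5]; exact Real.rpow_le_rpow (by positivity) hc.le (by positivity)
    calc _ ≤ r ^ (qx n / (n + 1 - qx n)) / r ^ (2 * n - 1 : ℝ) := by gcongr
      _ = _ := by rw [← Real.rpow_sub hr]; congr 1; ring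

/-- Standing assumptions on the (normalised) map `u`. -/
structure UU (n : ℕ) (Ω : Set (Euc n)) (u : Euc n → Euc n) : Prop where
  meas : Measurable u
  cont : ContinuousOn u Ω
  int : IntegrableOn u Ω
  lp : ∫⁻ x in Ω, ‖u x‖ₑ ^ (n + 1) ≠ ⊤
  en : energy n (n + 1) Ω u ≠ ⊤

/-- The dominating function of `a`. -/
def GG (n : ℕ) (Ω : Set (Euc n)) (u : Euc n → Euc n) (a : Euc n) : ENNReal :=
  2 ^ n * ∫⁻ q, gden n u a q ∂((volume.restrict Ω).prod (volume.restrict Ω))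

lemma GG_meas {n : ℕ} {Ω : Set (Euc n)} {u : Euc n → Euc n} (hu : Measurable u) : Measurable (GG n Ω u) :=
  ((gden_meas hu).lintegral_prod_right').const_mul _

lemma GG_loc {n : ℕ} {Ω : Set (Euc n)} (D : Dom n Ω) {u : Euc n → Euc n} (U : UU n Ω u) {B : Set (Euc n)}
    (hB : volume B ≠ ⊤) : ∫⁻ a in B, GG n Ω u a ≠ ⊤ := by
  have hn := D.hn
  obtain ⟨h1, h2, h3, h4⟩ := qx_facts hn
  obtain ⟨A, hA, hk⟩ := kernA (by omega : 1 ≤ n) h1.le h2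
  have hkB := kernB (by omega : 1 ≤ n) h3 h4 D.hb
  have hm := gden_meas U.meas
  unfold GG
  rw [lintegral_const_mul _ hm.lintegral_prod_right', lintegral_lintegral_swap hm.aemeasurable]
  refine ENNReal.mul_ne_top (by finiteness) ?_
  refine ne_top_of_le_ne_top (b := (volume B + A) * (energy n (n + 1) Ω u + ∫⁻ q : Euc n × Euc n,
    ENNReal.ofReal (dist q.1 q.2 ^ (-(2 * n - 1 - qx n / (n + 1 - qx n) : ℝ))) ∂(volume.restrict Ω).prod (volume.restrict Ω))) ?_ ?_
  · have := U.en; finiteness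
  · rw [energy_eq, ← lintegral_add_right _ (by fun_prop), ← lintegral_const_mul' _ _ (by finiteness)]
    refine lintegral_mono fun q => ?_
    simp only [gden]
    rw [lintegral_const_mul' _ _ ENNReal.ofReal_ne_top, mul_comm]
    refine mul_le_mul' (hk B (u q.1)) ?_
    by_cases hq : q.1 = q.2
    · rw [hq]; simp [Real.zero_rpow h1.ne']
    · have hd := dist_pos.2 hq
      rw [eden_le_real hq, ← ENNReal.ofReal_add (by positivity) (by positivity)]
      exact ENNReal.ofReal_le_ofReal (interp hn (norm_nonneg _) hd)

lemma pow_min_le {n : ℕ} {q t s : ℝ} (hq : 0 < q) (hqn : q ≤ n) (ht : 0 ≤ t) (hs : 0 ≤ s) (h1 : s ≤ 2) (h2 : s ≤ 2 * t) :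
    s ^ n ≤ 2 ^ n * t ^ q := by
  by_cases h : t ≤ 1
  · calc s ^ n ≤ (2 * t) ^ n := by gcongr
      _ = 2 ^ n * t ^ (n : ℝ) := by rw [mul_pow, Real.rpow_natCast]
      _ ≤ 2 ^ n * t ^ q := by
        rcases ht.eq_or_lt with h0 | h0
        · rw [← h0, Real.zero_rpow hq.ne', Real.zero_rpow (by linarith)]
        · exact mul_le_mul_of_nonneg_left (Real.rpow_le_rpow_of_exponent_ge h0 h hqn) (by positivity)
  · push Not at h
    calc s ^ n ≤ 2 ^ n * 1 := by rw [mul_one]; gcongr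
      _ ≤ 2 ^ n * t ^ q := by gcongr; exact Real.one_le_rpow h.le hq.le

lemma eden_Q_le {n : ℕ} (hn : 2 ≤ n) (u : Euc n → Euc n) {a : Euc n} (ε : ℝ) {q : Euc n × Euc n} (hq : u q.1 ≠ a) :
    eden n n (fun x => Qe ε (u x - a)) q ≤ 2 ^ n * gden n u a q := by
  obtain ⟨h1, h2, -, -⟩ := qx_facts hn
  by_cases hqq : q.1 = q.2
  · rw [eden_diag (by omega) hqq]; exact zero_le
  have hd := dist_pos.2 hqq
  have hz : 0 < ‖u q.1 - a‖ := norm_pos_iff.2 (sub_ne_zero.2 hq)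
  have hN : 0 < NN ε (u q.1 - a) := hz.trans_le (norm_le_NN _ _)
  rw [eden_le_real hqq, gden, ← ENNReal.ofReal_mul (by positivity),
    show (2 : ENNReal) ^ n = ENNReal.ofReal (2 ^ n) by rw [ENNReal.ofReal_pow (by norm_num)]; simp,
    ← ENNReal.ofReal_mul (by positivity)]
  refine ENNReal.ofReal_le_ofReal ?_
  have key := pow_min_le (n := n) (q := qx n) (t := ‖u q.1 - u q.2‖ / ‖u q.1 - a‖)
    (s := ‖Qe ε (u q.1 - a) - Qe ε (u q.2 - a)‖) h1 h2.le (by positivity) (norm_nonneg _)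
    ((norm_sub_le _ _).trans (by linarith [Qe_norm_le ε (u q.1 - a), Qe_norm_le ε (u q.2 - a)]))
    ((Qe_sub_le ε _ hN).trans (by
      rw [sub_sub_sub_cancel_right, mul_div_assoc]
      gcongr
      exact norm_le_NN _ _))
  rw [Real.div_rpow (norm_nonneg _) (norm_nonneg _)] at key
  rw [Real.rpow_neg hz.le, show n + n - 1 = 2 * n - 1 by omega]
  calc _ ≤ 2 ^ n * (‖u q.1 - u q.2‖ ^ qx n / ‖u q.1 - a‖ ^ qx n) / dist q.1 q.2 ^ (2 * n - 1) := by gcongr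
    _ = _ := by field_simp

lemma ae_ne {n : ℕ} {Ω : Set (Euc n)} {u : Euc n → Euc n} (hu : Measurable u) (hn : 2 ≤ n) :
    ∀ᵐ a : Euc n, ∀ᵐ x ∂(volume.restrict Ω), u x ≠ a := by
  have hN : Nontrivial (Euc n) := by
    have : Nontrivial (Fin n) := Fin.nontrivial_iff_two_le.2 hn
    have : Nonempty (Fin n) := inferInstance
    infer_instance
  have hset : MeasurableSet {p : Euc n × Euc n | u p.2 ≠ p.1} :=
    (measurableSet_eq_fun (hu.comp measurable_snd) measurable_fst).compl
  rw [Measure.ae_ae_comm (p := fun a x => u x ≠ a) hset]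
  refine Eventually.of_forall fun x => ?_
  rw [ae_iff]
  have e : {a | ¬ u x ≠ a} = {u x} := by ext a; simp [eq_comm]
  rw [e]; exact measure_singleton _

/-- The properties of a generic value `a`. -/
structure Gen (n : ℕ) (Ω : Set (Euc n)) (u : Euc n → Euc n) (a : Euc n) : Prop where
  fin : GG n Ω u a ≠ ⊤
  ne : ∀ᵐ x ∂(volume.restrict Ω), u x ≠ a

lemma ae_gen {n : ℕ} {Ω : Set (Euc n)} (D : Dom n Ω) {u : Euc n → Euc n} (U : UU n Ω u) : ∀ᵐ a : Euc n, Gen n Ω u a := by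
  have h1 : ∀ᵐ a : Euc n, GG n Ω u a ≠ ⊤ := by
    have h2 : ∀ R : ℕ, ∀ᵐ a : Euc n, a ∈ ball (0 : Euc n) R → GG n Ω u a < ⊤ := fun R =>
      (ae_restrict_iff' measurableSet_ball).1 (ae_lt_top (GG_meas U.meas) (GG_loc D U measure_ball_lt_top.ne))
    filter_upwards [ae_all_iff.2 h2] with a ha
    obtain ⟨R, hR⟩ := exists_nat_gt ‖a‖
    exact (ha R (by simpa using hR)).ne
  filter_upwards [h1, ae_ne U.meas D.hn] with a h1 h2 using ⟨h1, h2⟩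

lemma Q_energy_le {n : ℕ} {Ω : Set (Euc n)} (D : Dom n Ω) {u : Euc n → Euc n} {a : Euc n} (A : Gen n Ω u a) (ε : ℝ) :
    energy n n Ω (fun x => Qe ε (u x - a)) ≤ GG n Ω u a := by
  rw [energy_eq, GG, ← lintegral_const_mul' _ _ (by finiteness)]
  refine lintegral_mono_ae ?_
  filter_upwards [ae_prod_restrict A.ne] with q hq using eden_Q_le D.hn u ε hq.1

lemma UU.contAt {n : ℕ} {Ω : Set (Euc n)} (D : Dom n Ω) {u : Euc n → Euc n} (U : UU n Ω u) {x : Euc n} (hx : x ∈ Ω) :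
    ContinuousAt u x := U.cont.continuousAt (D.ho.mem_nhds hx)

lemma Q_good {n : ℕ} {Ω : Set (Euc n)} (D : Dom n Ω) {u : Euc n → Euc n} (U : UU n Ω u) {a : Euc n} (A : Gen n Ω u a) (ε : ℝ) :
    Good n Ω (fun x => Qe ε (u x - a)) := by
  have hm : Measurable (fun x => Qe ε (u x - a)) := (Qe_measurable ε).comp (U.meas.sub_const a)
  have hvol : volume Ω ≠ ⊤ := (D.hb.measure_lt_top (μ := volume)).ne
  refine ⟨hm, ?_, ?_, ?_, ne_top_of_le_ne_top A.fin (Q_energy_le D A ε)⟩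
  · filter_upwards [A.ne, ae_restrict_mem D.ho.measurableSet] with x hx hxΩ
    exact ContinuousAt.comp (f := fun x => u x - a) (Qe_contAt ε (sub_ne_zero.2 hx)) ((U.contAt D hxΩ).sub continuousAt_const)
  · refine Measure.integrableOn_of_bounded (M := 1) hvol hm.aestronglyMeasurable (Eventually.of_forall fun x => Qe_norm_le _ _)
  · refine ne_top_of_le_ne_top hvol ?_
    rw [← setLIntegral_one]
    refine lintegral_mono fun x => ?_
    refine pow_le_one₀ zero_le ?_
    rw [← ofReal_norm]; exact ENNReal.ofReal_le_one.2 (Qe_norm_le _ _)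

lemma dom_tendsto {n : ℕ} (hn : 2 ≤ n) {Ω : Set (Euc n)} {w : ℕ → Euc n → Euc n} {P : Euc n → Prop} {g : Euc n × Euc n → ENNReal}
    (hm : ∀ k, Measurable (w k)) (hg : Measurable g) (hP : ∀ᵐ x ∂(volume.restrict Ω), P x)
    (hle : ∀ k q, P q.1 → eden n n (w k) q ≤ g q)
    (hlim : ∀ x, P x → Tendsto (fun k => w k x) atTop (𝓝 0))
    (hfin : ∫⁻ q, g q ∂((volume.restrict Ω).prod (volume.restrict Ω)) ≠ ⊤) :
    Tendsto (fun k => energy n n Ω (w k)) atTop (𝓝 0) := by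
  simp only [energy_eq]
  rw [show (0 : ENNReal) = ∫⁻ q : Euc n × Euc n, 0 ∂((volume.restrict Ω).prod (volume.restrict Ω)) by simp]
  refine tendsto_lintegral_of_dominated_convergence' g (fun k => (measurable_eden (hm k)).aemeasurable) ?_ hfin ?_
  · intro k
    filter_upwards [ae_prod_restrict hP] with q hq using hle k q hq.1
  · filter_upwards [ae_prod_restrict hP] with q hq
    have := eden_tendsto (n := n) (p := n) (v := 0) (by omega) (hlim _ hq.1) (hlim _ hq.2)
    have e : eden n n (0 : Euc n → Euc n) q = 0 := by simp [eden, show n ≠ 0 by omega]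
    rwa [e] at this

lemma Q_tendsto {n : ℕ} {Ω : Set (Euc n)} (D : Dom n Ω) {u : Euc n → Euc n} (U : UU n Ω u) {a : Euc n} (A : Gen n Ω u a)
    {ε : ℕ → ℝ} (hε : Tendsto ε atTop (𝓝 0)) :
    Tendsto (fun k => energy n n Ω ((fun x => Qe (ε k) (u x - a)) - fun x => Qe 0 (u x - a))) atTop (𝓝 0) := by
  have hn := D.hn
  have hm : ∀ ε : ℝ, Measurable (fun x => Qe ε (u x - a)) := fun ε => (Qe_measurable ε).comp (U.meas.sub_const a)
  have hgm : Measurable (gden n u a) := gden_meas' U.meas a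
  have hfin := A.fin
  unfold GG at hfin
  refine dom_tendsto hn (P := fun x => u x ≠ a) (g := fun q => 2 ^ n * (2 ^ n * gden n u a q + 2 ^ n * gden n u a q))
    (fun k => (hm _).sub (hm _)) (((hgm.const_mul _).add (hgm.const_mul _)).const_mul _) A.ne ?_ ?_ ?_
  · intro k q hq
    rw [sub_eq_add_neg]
    refine (eden_add_le _ _ q).trans ?_
    rw [eden_neg]
    exact mul_le_mul' le_rfl (add_le_add (eden_Q_le hn u _ hq) (eden_Q_le hn u _ hq))
  · intro x hx
    have := (Qe_tendsto (sub_ne_zero.2 hx) hε).sub_const (Qe 0 (u x - a))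
    rw [sub_self] at this
    exact this
  · rw [lintegral_const_mul' _ _ (by finiteness), lintegral_add_left (hgm.const_mul _), lintegral_const_mul' _ _ (by finiteness)]
    exact ENNReal.mul_ne_top (by finiteness) (ENNReal.add_ne_top.2 ⟨hfin, hfin⟩)

lemma UU.good {n : ℕ} {Ω : Set (Euc n)} (D : Dom n Ω) {u : Euc n → Euc n} (U : UU n Ω u) : Good n Ω u := by
  refine ⟨U.meas, ?_, U.int, ?_, energy_embed (by linarith [D.hn]) D.hb U.en⟩
  · filter_upwards [ae_restrict_mem D.ho.measurableSet] with x hx using U.contAt D hx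
  · have hvol : volume Ω ≠ ⊤ := (D.hb.measure_lt_top (μ := volume)).ne
    refine ne_top_of_le_ne_top (b := volume Ω + ∫⁻ x in Ω, ‖u x‖ₑ ^ (n + 1)) (ENNReal.add_ne_top.2 ⟨hvol, U.lp⟩) ?_
    rw [← setLIntegral_one, ← lintegral_add_left measurable_const]
    refine lintegral_mono fun x => ?_
    rcases le_total ‖u x‖ₑ 1 with h | h
    · exact (pow_le_one₀ zero_le h).trans le_self_add
    · exact (pow_le_pow_right₀ h (by omega)).trans le_add_self

/-- Convergence of the pairing as `ε → 0`. -/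
lemma JJ_Q_tendsto {n : ℕ} {Ω : Set (Euc n)} (D : Dom n Ω) {u : Euc n → Euc n} (U : UU n Ω u) {a : Euc n} (A : Gen n Ω u a)
    {ε : ℕ → ℝ} (hε : Tendsto ε atTop (𝓝 0)) {ψ : Euc n → ℝ} (hψ : Cc1 n Ω ψ) :
    Tendsto (fun k => JJ n Ω (fun x => Qe (ε k) (u x - a)) ψ) atTop (𝓝 (JJ n Ω (fun x => Qe 0 (u x - a)) ψ)) := by
  obtain ⟨K, hK, hKΩ, h0, M, hM, Λ, hΛ⟩ := cc1_bd hψ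
  obtain ⟨C, hC, est⟩ := JJ_est D hK hKΩ
  have hbase : Tendsto (fun k => ENNReal.ofReal |JJ n Ω (fun x => Qe (ε k) (u x - a)) ψ - JJ n Ω (fun x => Qe 0 (u x - a)) ψ|)
      atTop (𝓝 0) := by
    refine young_tendsto (B := C * ENNReal.ofReal (Λ + M) * (GG n Ω u a + GG n Ω u a))
      (c := fun l => C * ENNReal.ofReal (Λ + M) * (l⁻¹ ^ (n - 1)))
      (e := fun k => energy n n Ω ((fun x => Qe (ε k) (u x - a)) - fun x => Qe 0 (u x - a)))
      (by have := A.fin; finiteness)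
      (fun l hl0 hlt => by
        have := ENNReal.inv_ne_top.2 hl0
        finiteness) ?_ (Q_tendsto D U A hε)
    intro l hl0 hlt
    refine Eventually.of_forall fun k => ?_
    refine (est _ _ (Q_good D U A (ε k)) (Q_good D U A 0) ψ hψ h0 M hM Λ hΛ l hl0 hlt).trans ?_
    calc _ ≤ C * ENNReal.ofReal (Λ + M) * (l * (GG n Ω u a + GG n Ω u a) + l⁻¹ ^ (n - 1) *
          energy n n Ω ((fun x => Qe (ε k) (u x - a)) - fun x => Qe 0 (u x - a))) :=
          mul_le_mul' le_rfl (add_le_add (mul_le_mul' le_rfl (add_le_add (Q_energy_le D A _) (Q_energy_le D A _))) le_rfl)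
      _ = _ := by ring
  have h2 := (ENNReal.tendsto_toReal_iff (fun k => ENNReal.ofReal_ne_top) ENNReal.zero_ne_top).2 hbase
  simp only [ENNReal.toReal_ofReal (abs_nonneg _), ENNReal.toReal_zero] at h2
  have h3 := (tendsto_zero_iff_abs_tendsto_zero _).2 h2
  simpa using h3.add_const (JJ n Ω (fun x => Qe 0 (u x - a)) ψ)

end

section

/-! ### The Jacobian of the regularised projections -/

lemma jac_det {n : ℕ} (v : Euc n → Euc n) (x : Euc n) : (jacMat n v x).det = (fderiv ℝ v x).det := by
  rw [ContinuousLinearMap.det, ← LinearMap.det_toMatrix (EuclideanSpace.basisFun (Fin n) ℝ).toBasis]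
  congr 1

lemma jac_comp {n : ℕ} {Q v : Euc n → Euc n} {x : Euc n} (hQ : DifferentiableAt ℝ Q (v x)) (hv : DifferentiableAt ℝ v x) :
    (jacMat n (fun x => Q (v x)) x).det = (jacMat n Q (v x)).det * (jacMat n v x).det := by
  rw [jac_det, jac_det, jac_det, show (fun x => Q (v x)) = Q ∘ v from rfl, fderiv_comp x hQ hv]
  exact LinearMap.det_comp _ _

/-- The Jacobian determinant of `Qe`. -/
def rho (n : ℕ) (ε : ℝ) (z : Euc n) : ℝ := ε ^ 2 * (NN ε z)⁻¹ ^ (n + 2)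

lemma Qe_fderiv {n : ℕ} {ε : ℝ} (hε : 0 < ε) (z h : Euc n) :
    fderiv ℝ (Qe ε) z h = (NN ε z)⁻¹ • h - ((NN ε z)⁻¹ ^ 3 * inner ℝ z h) • z := by
  have hN := NN_pos hε z
  have h1 : HasFDerivAt (fun z : Euc n => ‖z‖ ^ 2 + ε ^ 2) (2 • (innerSL ℝ z)) z := by
    simpa using (hasStrictFDerivAt_norm_sq z).hasFDerivAt.add_const (ε ^ 2)
  have h2 := h1.sqrt (by positivity)
  have h3 : HasFDerivAt (fun z : Euc n => (NN ε z)⁻¹) _ z := (hasDerivAt_inv hN.ne').comp_hasFDerivAt z h2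
  have h4 : HasFDerivAt (Qe ε) _ z := h3.fun_smul (hasFDerivAt_id z)
  rw [h4.fderiv]
  have e : √(‖z‖ ^ 2 + ε ^ 2) = NN ε z := rfl
  simp only [ContinuousLinearMap.add_apply, ContinuousLinearMap.smul_apply, ContinuousLinearMap.id_apply,
    ContinuousLinearMap.smulRight_apply, innerSL_apply_apply, id, e, smul_eq_mul, nsmul_eq_mul]
  rw [sub_eq_add_neg, ← neg_smul]
  congr 2
  push_cast
  field_simp

lemma Qe_det {n : ℕ} {ε : ℝ} (hε : 0 < ε) (z : Euc n) : (jacMat n (Qe ε) z).det = rho n ε z := by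
  have hN := NN_pos hε z
  have e : jacMat n (Qe ε) z = (NN ε z)⁻¹ • (1 - Matrix.vecMulVec (fun i => (NN ε z)⁻¹ ^ 2 * z i) (fun j => z j)) := by
    ext i j
    simp only [jacMat, Matrix.of_apply, Qe_fderiv hε, Matrix.smul_apply, Matrix.sub_apply, Matrix.vecMulVec_apply,
      smul_eq_mul, PiLp.sub_apply, PiLp.smul_apply]
    rw [EuclideanSpace.inner_single_right, Matrix.one_apply]
    by_cases h : i = j
    · subst h; simp; ring
    · simp [h]; ring
  rw [e, Matrix.det_smul]
  have e2 : (1 - Matrix.vecMulVec (fun i => (NN ε z)⁻¹ ^ 2 * z i) (fun j => z j) : Matrix (Fin n) (Fin n) ℝ) =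
      1 + Matrix.replicateCol Unit (fun i => -((NN ε z)⁻¹ ^ 2 * z i)) * Matrix.replicateRow Unit (fun j => z j) := by
    ext i j
    simp [Matrix.vecMulVec_apply, Matrix.mul_apply]
    ring
  rw [e2, Matrix.det_one_add_replicateCol_mul_replicateRow]
  have e3 : (fun j => z j) ⬝ᵥ (fun i => -((NN ε z)⁻¹ ^ 2 * z i)) = -((NN ε z)⁻¹ ^ 2 * ‖z‖ ^ 2) := by
    rw [EuclideanSpace.norm_sq_eq, Finset.mul_sum, ← Finset.sum_neg_distrib]
    refine Finset.sum_congr rfl fun i _ => ?_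
    rw [Real.norm_eq_abs, sq_abs]; ring
  rw [e3, show ‖z‖ ^ 2 = NN ε z ^ 2 - ε ^ 2 by rw [NN_sq]; ring, rho, pow_add, Fintype.card_fin]
  field_simp
  ring

lemma rho_nonneg {n : ℕ} (ε : ℝ) (z : Euc n) : 0 ≤ rho n ε z := by
  have := NN_nonneg ε z
  unfold rho; positivity

lemma rho_le {n : ℕ} {ε : ℝ} (hε : 0 < ε) (z : Euc n) : rho n ε z ≤ ε ^ 2 * ε⁻¹ ^ (n + 2) := by
  have := NN_pos hε z
  have := eps_le_NN ε z
  unfold rho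
  gcongr

lemma rho_contDiff {n : ℕ} {ε : ℝ} (hε : 0 < ε) : ContDiff ℝ 1 (rho n ε) := by
  unfold rho NN
  refine contDiff_const.mul (ContDiff.pow (ContDiff.inv (ContDiff.sqrt ?_ ?_) ?_) _)
  · exact (contDiff_norm_sq ℝ).add contDiff_const
  · intro x; positivity
  · intro x; positivity

lemma rho_lip {n : ℕ} {ε : ℝ} (hε : 0 < ε) : ∃ Λ, 0 ≤ Λ ∧ ∀ z w, |rho n ε z - rho n ε w| ≤ Λ * ‖z - w‖ := by
  refine ⟨ε ^ 2 * (ε⁻¹ ^ 2 * (n + 2 : ℕ) * ε⁻¹ ^ (n + 1)), by positivity, fun z w => ?_⟩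
  have hz := NN_pos hε z
  have hw := NN_pos hε w
  have hz' := eps_le_NN ε z
  have hw' := eps_le_NN ε w
  have h1 := abs_pow_sub_pow_le (NN ε z)⁻¹ (NN ε w)⁻¹ (n + 2)
  have h2 : |(NN ε z)⁻¹ - (NN ε w)⁻¹| ≤ ε⁻¹ ^ 2 * ‖z - w‖ := by
    rw [inv_sub_inv hz.ne' hw.ne', abs_div, abs_of_pos (mul_pos hz hw), div_eq_mul_inv, mul_comm]
    have := NN_lip ε w hz
    gcongr
    rw [mul_inv, sq]
    gcongr
  have h3 : max |(NN ε z)⁻¹| |(NN ε w)⁻¹| ≤ ε⁻¹ := by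
    rw [abs_of_pos (inv_pos.2 hz), abs_of_pos (inv_pos.2 hw)]
    exact max_le (by gcongr) (by gcongr)
  unfold rho
  rw [← mul_sub, abs_mul, abs_of_pos (by positivity : 0 < ε ^ 2), mul_assoc]
  refine mul_le_mul_of_nonneg_left (h1.trans ?_) (by positivity)
  calc _ ≤ ε⁻¹ ^ 2 * ‖z - w‖ * (n + 2 : ℕ) * ε⁻¹ ^ (n + 2 - 1) := by gcongr
    _ = _ := by rw [show n + 2 - 1 = n + 1 by omega]; ring

lemma Qe_normsq {n : ℕ} {ε : ℝ} (hε : 0 < ε) (z : Euc n) : 1 - ‖Qe ε z‖ ^ 2 = (ε * (NN ε z)⁻¹) ^ 2 := by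
  have hN := NN_pos hε z
  rw [Qe, norm_smul, norm_inv, Real.norm_eq_abs, abs_of_pos hN, mul_pow, show ‖z‖ ^ 2 = NN ε z ^ 2 - ε ^ 2 by rw [NN_sq]; ring]
  field_simp
  ring

lemma Qe_inj {n : ℕ} {ε : ℝ} (hε : 0 < ε) : Function.Injective (Qe (n := n) ε) := by
  intro z w h
  have hz := NN_pos hε z
  have hw := NN_pos hε w
  have h1 := Qe_normsq hε z
  rw [h, Qe_normsq hε w, sq_eq_sq₀ (by positivity) (by positivity)] at h1
  have h2 := mul_left_cancel₀ hε.ne' h1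
  unfold Qe at h
  rw [h2] at h
  exact smul_right_injective _ (inv_pos.2 hz).ne' h

lemma Qe_range {n : ℕ} {ε : ℝ} (hε : 0 < ε) : Qe (n := n) ε '' Set.univ = ball 0 1 := by
  ext y
  rw [Set.image_univ, mem_ball_zero_iff]
  constructor
  · rintro ⟨z, rfl⟩
    have h1 := Qe_normsq hε z
    have hz := NN_pos hε z
    have : 0 < (ε * (NN ε z)⁻¹) ^ 2 := by positivity
    nlinarith [norm_nonneg (Qe ε z)]
  · intro hy
    have h0 : 0 < 1 - ‖y‖ ^ 2 := by nlinarith [norm_nonneg y]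
    have hs := Real.sqrt_pos.2 h0
    have hs2 := Real.sq_sqrt h0.le
    set s := √(1 - ‖y‖ ^ 2)
    refine ⟨(ε / s) • y, ?_⟩
    have : NN ε ((ε / s) • y) = ε / s := by
      unfold NN
      rw [show ‖(ε / s) • y‖ ^ 2 + ε ^ 2 = (ε / s) ^ 2 by
        rw [norm_smul, Real.norm_eq_abs, abs_of_pos (by positivity), mul_pow, div_pow, hs2]
        field_simp
        ring]
      exact Real.sqrt_sq (by positivity)
    rw [Qe, this, smul_smul, inv_mul_cancel₀ (by positivity), one_smul]

lemma rho_lint {n : ℕ} {ε : ℝ} (hε : 0 < ε) : ∫⁻ z : Euc n, ENNReal.ofReal (rho n ε z) = volume (ball (0 : Euc n) 1) := by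
  have h := lintegral_abs_det_fderiv_eq_addHaar_image (μ := volume) (s := Set.univ) (f := Qe (n := n) ε) (f' := fderiv ℝ (Qe ε))
    MeasurableSet.univ (fun x _ => ((Qe_contDiff hε).differentiable (by simp) x).hasFDerivAt.hasFDerivWithinAt)
    (Qe_inj hε).injOn
  rw [Qe_range hε, setLIntegral_univ] at h
  rw [← h]
  refine lintegral_congr fun z => ?_
  rw [← jac_det, Qe_det hε, abs_of_nonneg (rho_nonneg ε z)]

lemma rho_integrable {n : ℕ} {ε : ℝ} (hε : 0 < ε) : Integrable (rho n ε) := by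
  refine ⟨(rho_contDiff hε).continuous.aestronglyMeasurable, ?_⟩
  rw [hasFiniteIntegral_iff_ofReal (.of_forall (rho_nonneg ε)), rho_lint hε]
  exact measure_ball_lt_top

lemma rho_integral {n : ℕ} {ε : ℝ} (hε : 0 < ε) : ∫ z : Euc n, rho n ε z = ballVol n := by
  rw [integral_eq_lintegral_of_nonneg_ae (.of_forall (rho_nonneg ε)) (rho_integrable hε).1, rho_lint hε, ballVol]

lemma rho_scale {n : ℕ} {ε : ℝ} (hε : 0 < ε) (z : Euc n) : ε ^ n * rho n ε (ε • z) = rho n 1 z := by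
  have : NN ε (ε • z) = ε * NN 1 z := by
    unfold NN
    rw [norm_smul, Real.norm_eq_abs, abs_of_pos hε, show (ε * ‖z‖) ^ 2 + ε ^ 2 = ε ^ 2 * (‖z‖ ^ 2 + 1 ^ 2) by ring,
      Real.sqrt_mul (by positivity), Real.sqrt_sq hε.le]
  have h1 := NN_pos one_pos z
  unfold rho
  rw [this, mul_inv, mul_pow, inv_pow ε, pow_add ε n 2]
  field_simp

/-- Uniform approximate identity. -/
lemma rho_approx {n : ℕ} {φ : Euc n → ℝ} (hc : Continuous φ) {M Λ : ℝ} (hΛ0 : 0 ≤ Λ) (hM : ∀ x, |φ x| ≤ M)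
    (hΛ : ∀ x y, |φ x - φ y| ≤ Λ * ‖x - y‖) {ε : ℕ → ℝ} (hε : ∀ k, 0 < ε k) (h0 : Tendsto ε atTop (𝓝 0)) :
    ∃ e : ℕ → ℝ, Tendsto e atTop (𝓝 0) ∧ ∀ k y, |(∫ a, φ a * rho n (ε k) (y - a)) - ballVol n * φ y| ≤ e k := by
  have hM0 : 0 ≤ M := (abs_nonneg _).trans (hM 0)
  have h2 : ∀ x y, |φ x - φ y| ≤ 2 * M := fun x y => (abs_sub _ _).trans (by linarith [hM x, hM y])
  refine ⟨fun k => ∫ z, min (2 * M) (Λ * (ε k * ‖z‖)) * rho n 1 z, ?_, fun k y => ?_⟩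
  · have hz : Tendsto (fun k => ∫ z, min (2 * M) (Λ * (ε k * ‖z‖)) * rho n 1 z) atTop (𝓝 (∫ z : Euc n, (0 : ℝ))) := by
      refine tendsto_integral_of_dominated_convergence (fun z => 2 * M * rho n 1 z) (fun k => ?_)
        ((rho_integrable one_pos).const_mul _) (fun k => .of_forall fun z => ?_) (.of_forall fun z => ?_)
      · have := (rho_contDiff (n := n) one_pos).continuous
        exact Continuous.aestronglyMeasurable (by fun_prop)
      · have h1 := hε k
        have : 0 ≤ min (2 * M) (Λ * (ε k * ‖z‖)) := le_min (by positivity) (by positivity)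
        rw [Real.norm_eq_abs, abs_of_nonneg (mul_nonneg this (rho_nonneg 1 z))]
        exact mul_le_mul_of_nonneg_right (min_le_left _ _) (rho_nonneg 1 z)
      · have h1 : Tendsto (fun k => min (2 * M) (Λ * (ε k * ‖z‖)) * rho n 1 z) atTop
            (𝓝 (min (2 * M) (Λ * (0 * ‖z‖)) * rho n 1 z)) :=
          (tendsto_const_nhds.min ((h0.mul_const _).const_mul _)).mul_const _
        have e : min (2 * M) (Λ * (0 * ‖z‖)) * rho n 1 z = 0 := by
          rw [zero_mul, mul_zero, min_eq_right (by positivity), zero_mul]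
        rwa [e] at h1
    simpa using hz
  · have hr := rho_integrable (n := n) one_pos
    have e1 : ∫ a, φ a * rho n (ε k) (y - a) = ∫ z, φ (y - z) * rho n (ε k) z := by
      rw [← integral_sub_left_eq_self _ volume y]
      simp
    have e2 : ∫ a, φ a * rho n (ε k) (y - a) = ∫ z, φ (y - ε k • z) * rho n 1 z := by
      rw [e1]
      have := Measure.integral_comp_smul (volume : Measure (Euc n)) (fun z => φ (y - z) * rho n (ε k) z) (ε k)
      have hp : 0 < ε k ^ n := pow_pos (hε k) n
      rw [finrank_euclideanSpace_fin, abs_of_pos (inv_pos.2 hp), smul_eq_mul] at this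
      simp_rw [← rho_scale (hε k)]
      rw [eq_inv_mul_iff_mul_eq₀ hp.ne'] at this
      rw [← this, ← integral_const_mul]
      refine integral_congr_ae (.of_forall fun z => ?_)
      dsimp only
      ring
    have hi : Integrable (fun z => φ (y - ε k • z) * rho n 1 z) :=
      hr.bdd_mul (c := M) (Continuous.aestronglyMeasurable (by fun_prop)) (.of_forall fun z => hM _)
    rw [e2, ← rho_integral (n := n) one_pos, ← integral_mul_const, ← integral_sub hi (hr.mul_const _)]
    refine (abs_integral_le_integral_abs).trans (integral_mono_of_nonneg (.of_forall fun z => abs_nonneg _) ?_ (.of_forall fun z => ?_))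
    · have := (rho_contDiff (n := n) one_pos).continuous
      refine hr.bdd_mul (c := 2 * M) (Continuous.aestronglyMeasurable (by fun_prop)) (.of_forall fun z => ?_)
      have h1 := hε k
      have : 0 ≤ min (2 * M) (Λ * (ε k * ‖z‖)) := le_min (by positivity) (by positivity)
      rw [Real.norm_eq_abs, abs_of_nonneg this]
      exact min_le_left _ _
    · dsimp only
      rw [mul_comm (rho n 1 z), ← sub_mul, abs_mul, abs_of_nonneg (rho_nonneg 1 z)]
      refine mul_le_mul_of_nonneg_right (le_min (h2 _ _) ((hΛ _ _).trans (le_of_eq ?_))) (rho_nonneg 1 z)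
      rw [show y - ε k • z - y = -(ε k • z) by abel, norm_neg, norm_smul, Real.norm_eq_abs, abs_of_pos (hε k)]

end

section

/-! ### The extension of the Jacobian to bounded continuous functions and the chain rule -/

/-- Bundle a bounded continuous function (junk value `0`). -/
def cb {n : ℕ} (f : Euc n → ℝ) : BoundedContinuousFunction (Euc n) ℝ :=
  open Classical in
  if h : Continuous f ∧ ∃ C, ∀ x, ‖f x‖ ≤ C then
    BoundedContinuousFunction.ofNormedAddCommGroup f h.1 h.2.choose h.2.choose_spec else 0

lemma cb_apply {n : ℕ} {f : Euc n → ℝ} (hc : Continuous f) {C : ℝ} (hb : ∀ x, |f x| ≤ C) : ⇑(cb f) = f := by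
  unfold cb
  rw [dif_pos ⟨hc, C, hb⟩]
  rfl

lemma Cc1.cb {n : ℕ} {Ω : Set (Euc n)} {f : Euc n → ℝ} (h : Cc1 n Ω f) : ⇑(cb f) = f := by
  obtain ⟨K, -, -, -, M, hM, -⟩ := cc1_bd h
  exact cb_apply h.1.continuous hM

lemma cc1_zero {n : ℕ} {Ω : Set (Euc n)} : Cc1 n Ω 0 := by
  refine ⟨contDiff_const, HasCompactSupport.zero, ?_⟩
  simp [tsupport]

lemma JJ_abs_le {n : ℕ} {Ω : Set (Euc n)} (D : Dom n Ω) {v : Euc n → Euc n} (G : Good n Ω v) (hTV : BddAbove (TVset n Ω v))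
    {ψ : Euc n → ℝ} (hψ : Cc1 n Ω ψ) {M : ℝ} (hM0 : 0 ≤ M) (hM : ∀ x, |ψ x| ≤ M) : |JJ n Ω v ψ| ≤ sSup (TVset n Ω v) * M := by
  rw [tvset_eq D G] at hTV ⊢
  have key : ∀ c : ℝ, (∀ x, |c * ψ x| ≤ 1) → c * JJ n Ω v ψ ≤
      sSup {r | ∃ ψ : Euc n → ℝ, Cc1 n Ω ψ ∧ (∀ x, |ψ x| ≤ 1) ∧ JJ n Ω v ψ = r} := by
    intro c hc
    refine le_csSup hTV ⟨c • ψ + (0 : ℝ) • ψ, cc1_comb hψ hψ c 0, fun x => by simpa using hc x, ?_⟩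
    rw [JJ_linear D G hψ hψ]; ring
  rcases hM0.eq_or_lt with h0 | h0
  · subst h0
    have h : ψ = 0 := by
      funext x
      simpa using hM x
    have := JJ_linear D G hψ hψ 0 0
    have e : (0 : ℝ) • ψ + (0 : ℝ) • ψ = ψ := by rw [h]; simp
    rw [e] at this
    rw [this]; simp
  · have h1 := key M⁻¹ (fun x => by
      rw [abs_mul, abs_of_pos (inv_pos.2 h0), inv_mul_le_iff₀ h0, mul_one]; exact hM x)
    have h2 := key (-M⁻¹) (fun x => by
      rw [neg_mul, abs_neg, abs_mul, abs_of_pos (inv_pos.2 h0), inv_mul_le_iff₀ h0, mul_one]; exact hM x)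
    rw [inv_mul_le_iff₀ h0] at h1
    rw [neg_mul, ← mul_neg, inv_mul_le_iff₀ h0] at h2
    rw [abs_le, mul_comm]
    constructor <;> linarith

lemma hahn_ext {E : Type*} [NormedAddCommGroup E] [NormedSpace ℝ E] (p : Submodule ℝ E) (f : p →ₗ[ℝ] ℝ) {M : ℝ} (hM : 0 ≤ M)
    (h : ∀ x : p, ‖f x‖ ≤ M * ‖x.1‖) : ∃ L : E →L[ℝ] ℝ, ‖L‖ ≤ M ∧ ∀ x : p, L x.1 = f x := by
  obtain ⟨L, hL, hn⟩ := exists_extension_norm_eq p (LinearMap.mkContinuous f M h)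
  exact ⟨L, hn.trans_le (LinearMap.mkContinuous_norm_le f hM h), hL⟩

lemma exists_L {n : ℕ} {Ω : Set (Euc n)} (D : Dom n Ω) {v : Euc n → Euc n} (G : Good n Ω v) (hTV : BddAbove (TVset n Ω v)) :
    ∃ L : BoundedContinuousFunction (Euc n) ℝ →L[ℝ] ℝ, ‖L‖ ≤ sSup (TVset n Ω v) ∧
      ∀ f, Cc1 n Ω f → L (cb f) = JJ n Ω v f := by
  have h0 : 0 ≤ sSup (TVset n Ω v) := by
    have := JJ_abs_le D G hTV cc1_zero zero_le_one (by simp)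
    linarith [abs_nonneg (JJ n Ω v 0)]
  let p : Submodule ℝ (BoundedContinuousFunction (Euc n) ℝ) :=
    { carrier := {f | Cc1 n Ω f}
      add_mem' := fun {a b} ha hb => by
        have := cc1_comb ha hb 1 1
        rw [one_smul, one_smul] at this
        exact this
      zero_mem' := cc1_zero
      smul_mem' := fun c a ha => by
        have := cc1_comb ha ha c 0
        rw [zero_smul, add_zero] at this
        exact this }
  let f0 : p →ₗ[ℝ] ℝ :=
    { toFun := fun f => JJ n Ω v f.1
      map_add' := fun a b => by
        have := JJ_linear D G a.2 b.2 1 1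
        rw [one_smul, one_smul, one_mul, one_mul] at this
        exact this
      map_smul' := fun c a => by
        have := JJ_linear D G a.2 a.2 c 0
        rw [zero_smul, add_zero, zero_mul, add_zero] at this
        exact this }
  have hb : ∀ f : p, ‖f0 f‖ ≤ sSup (TVset n Ω v) * ‖f.1‖ := fun f =>
    JJ_abs_le D G hTV f.2 (norm_nonneg f.1) fun x => f.1.norm_coe_le_norm x
  obtain ⟨L, hn, hL⟩ := hahn_ext p f0 h0 hb
  refine ⟨L, hn, fun f hf => ?_⟩
  · have e := hf.cb
    have hm : cb f ∈ p := by
      show Cc1 n Ω (cb f)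
      rw [e]; exact hf
    have := hL ⟨cb f, hm⟩
    rw [this]
    show JJ n Ω v (cb f) = _
    rw [e]

lemma prod_cont {n : ℕ} {Ω : Set (Euc n)} (ho : IsOpen Ω) {u : Euc n → Euc n} (hu : ContinuousOn u Ω) {g : Euc n → ℝ} (hg : Continuous g)
    {ψ : Euc n → ℝ} (hψ : Cc1 n Ω ψ) : Continuous (fun x => g (u x) * ψ x) := by
  rw [continuous_iff_continuousAt]
  intro x
  by_cases hx : x ∈ Ω
  · exact (hg.continuousAt.comp (hu.continuousAt (ho.mem_nhds hx))).mul hψ.1.continuous.continuousAt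
  · have hx' : x ∉ tsupport ψ := fun h => hx (hψ.2.2 h)
    have h1 : (fun x => g (u x) * ψ x) =ᶠ[𝓝 x] fun _ => 0 := by
      filter_upwards [(isClosed_tsupport ψ).isOpen_compl.mem_nhds hx'] with y hy
      rw [image_eq_zero_of_notMem_tsupport hy, mul_zero]
    exact (continuousAt_const).congr h1.symm

lemma prod_cc1 {n : ℕ} {Ω : Set (Euc n)} {u : Euc n → Euc n} (hu : ContDiff ℝ 1 u) {g : Euc n → ℝ} (hg : ContDiff ℝ 1 g)
    {ψ : Euc n → ℝ} (hψ : Cc1 n Ω ψ) : Cc1 n Ω (fun x => g (u x) * ψ x) :=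
  ⟨(hg.comp hu).mul hψ.1, hψ.2.1.mul_left, (closure_mono (Function.support_mul_subset_right _ _)).trans hψ.2.2⟩

lemma prod_energy {n p : ℕ} {S : Set (Euc n)} {v : Euc n → Euc n} (hv : Measurable v) {g ψ : Euc n → ℝ} {Mg Lg Mp Lp : ℝ}
    (hg : ∀ z, |g z| ≤ Mg) (hgl : ∀ z w, |g z - g w| ≤ Lg * ‖z - w‖) (hp : ∀ z, |ψ z| ≤ Mp) (hpl : ∀ z w, |ψ z - ψ w| ≤ Lp * ‖z - w‖) :
    energy n p S (fun x => g (v x) * ψ x) ≤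
      2 ^ p * (ENNReal.ofReal (Mp * Lg) ^ p * energy n p S v + ENNReal.ofReal (Mg * Lp) ^ p * energy n p S (fun x => x)) := by
  simp only [energy_eq]
  rw [← lintegral_const_mul' _ _ (by finiteness), ← lintegral_const_mul' _ _ (by finiteness),
    ← lintegral_add_left ((measurable_eden hv).const_mul _), ← lintegral_const_mul' _ _ (by finiteness)]
  refine lintegral_mono fun q => ?_
  have hM : 0 ≤ Mp := (abs_nonneg _).trans (hp 0)
  have hM' : 0 ≤ Mg := (abs_nonneg _).trans (hg 0)
  simp only [eden]
  rw [← mul_div_assoc, ← mul_div_assoc, ← ENNReal.add_div, ← mul_div_assoc, ← mul_pow, ← mul_pow]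
  refine ENNReal.div_le_div_right ?_ _
  refine le_trans (pow_le_pow_left' ?_ p) (add_pow_enn _ _ _)
  rw [← ofReal_norm, ← ofReal_norm, ← ofReal_norm, ← ENNReal.ofReal_mul' (norm_nonneg _), ← ENNReal.ofReal_mul' (norm_nonneg _)]
  refine (ENNReal.ofReal_le_ofReal ?_).trans ENNReal.ofReal_add_le
  rw [Real.norm_eq_abs, show g (v q.1) * ψ q.1 - g (v q.2) * ψ q.2 = ψ q.1 * (g (v q.1) - g (v q.2)) + g (v q.2) * (ψ q.1 - ψ q.2) by ring]
  refine (abs_add_le _ _).trans ?_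
  rw [abs_mul, abs_mul, mul_assoc, mul_assoc]
  exact add_le_add (mul_le_mul (hp _) (hgl _ _) (abs_nonneg _) hM) (mul_le_mul (hg _) (hpl _ _) (abs_nonneg _) hM')


set_option maxHeartbeats 200000 in
lemma chain_aux {n : ℕ} {Ω : Set (Euc n)} (D : Dom n Ω) {u : Euc n → Euc n} (U : UU n Ω u) (S : ApproxSys n Ω)
    {ψ : Euc n → ℝ} (hψ : Cc1 n Ω ψ) {g : Euc n → ℝ} (hgC : ContDiff ℝ 1 g) {Mg Lg : ℝ}
    (hg : ∀ z, |g z| ≤ Mg) (hgl : ∀ z w, |g z - g w| ≤ Lg * ‖z - w‖) :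
    Tendsto (fun k => (∫ x in Ω, (g (app S u k x) * ψ x) * (jacMat n (app S u k) x).det) -
      JJ n Ω u (fun x => g (app S u k x) * ψ x)) atTop (𝓝 0) := by
  obtain ⟨K, hK, hKΩ, h0, Mp, hp, Lp, hΛ⟩ := cc1_bd hψ
  obtain ⟨C, hC, est⟩ := estB'_dom (by linarith [D.hn]) D.ho hK hKΩ
  have G := U.good D
  have hCD := fun k => app_contDiff D.ho.measurableSet S U.int k
  have hpl : ∀ z w, |ψ z - ψ w| ≤ Lp * ‖z - w‖ := fun z w =>
    Convex.norm_image_sub_le_of_norm_fderiv_le (s := Set.univ) (fun x _ => (hψ.1.differentiable (by simp)) x)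
      (fun x _ => hΛ x) convex_univ (Set.mem_univ _) (Set.mem_univ _)
  have hMp : 0 ≤ Mp := (abs_nonneg _).trans (hp 0)
  have hMg : 0 ≤ Mg := (abs_nonneg _).trans (hg 0)
  have hE := U.en
  have hid : energy n (n + 1) Ω (fun x : Euc n => x) ≠ ⊤ :=
    energy_lip_fin (by linarith [D.hn]) (by omega) D.ho.measurableSet D.hb (C := 1) (fun x _ y _ => by rw [one_mul, dist_eq_norm])
  have hev : ∀ᶠ k in atTop, energy n (n + 1) Ω (app S u k) ≤ 2 * energy n (n + 1) Ω u := by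
    have := (appC_tendsto S (n + (n + 1) - 1)).eventually_le_const (show (1 : ENNReal) < 2 by norm_num)
    filter_upwards [this] with k hk
    exact (app_energy_le (p := n + 1) (by omega) D.ho.measurableSet S U.meas U.int k).trans (mul_le_mul' hk le_rfl)
  have het : Tendsto (fun k => energy n (n + 1) Ω (app S u k - u)) atTop (𝓝 0) := by
    have := app_energy_tendsto (p := n + 1) (by omega) D.ho.measurableSet S U.meas U.int G.cont U.en LipschitzWith.id
    simpa only [Function.id_comp] using this
  set φ : ℕ → Euc n → ℝ := fun k x => g (app S u k x) * ψ x with hφ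
  have hφC : ∀ k, Cc1 n Ω (φ k) := fun k => prod_cc1 (hCD k) hgC hψ
  have hφ0 : ∀ k x, x ∉ K → φ k x = 0 := fun k x hx => by simp [hφ, h0 x hx]
  have hφM : ∀ k x, |φ k x| ≤ Mg * Mp := fun k x => by
    rw [hφ, abs_mul]; exact mul_le_mul (hg _) (hp _) (abs_nonneg _) hMg
  have hI : ∀ k m, Integrable (fun x => φ k x * (jacMat n (app S u m) x).det) (volume.restrict Ω) := fun k m =>
    int_det D.ho (hCD m).contDiffOn (hφC k).1.continuous hK hKΩ (hφ0 k)
  have key : Tendsto (fun q : ℕ × ℕ => ENNReal.ofReal |∫ x in Ω, φ q.1 x * ((jacMat n (app S u q.1) x).det - (jacMat n (app S u q.2) x).det)|)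
      (atTop ×ˢ atTop) (𝓝 0) := by
    set Eφ : ENNReal := 2 ^ (n + 1) * (ENNReal.ofReal (Mp * Lg) ^ (n + 1) * (2 * energy n (n + 1) Ω u) +
      ENNReal.ofReal (Mg * Lp) ^ (n + 1) * energy n (n + 1) Ω (fun x => x))
    have hEφ : Eφ ≠ ⊤ := by simp only [Eφ]; finiteness
    refine young_tendsto (B := C * (2 * energy n (n + 1) Ω u + 2 * energy n (n + 1) Ω u + (Eφ + ENNReal.ofReal (Mg * Mp) ^ (n + 1))))
      (c := fun l => C * l⁻¹ ^ n)
      (e := fun q => 2 ^ (n + 1) * (energy n (n + 1) Ω (app S u q.1 - u) + energy n (n + 1) Ω (app S u q.2 - u)))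
      (by finiteness)
      (fun l hl0 hlt => by
        have := ENNReal.inv_ne_top.2 hl0
        finiteness) ?_ ?_
    · intro l hl0 hlt
      filter_upwards [hev.prod_inl atTop, hev.prod_inr atTop] with q h1 h2
      refine (est _ _ (hCD q.1).contDiffOn (hCD q.2).contDiffOn (φ q.1) (hφC q.1).1 (hφ0 q.1) _ (hφM q.1) l hl0 hlt).trans ?_
      have h3 : energy n (n + 1) Ω (φ q.1) ≤ Eφ := (prod_energy (hCD q.1).continuous.measurable hg hgl hp hpl).trans
        (mul_le_mul' le_rfl (add_le_add (mul_le_mul' le_rfl h1) le_rfl))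
      have h4 : energy n (n + 1) Ω (app S u q.1 - app S u q.2) ≤
          2 ^ (n + 1) * (energy n (n + 1) Ω (app S u q.1 - u) + energy n (n + 1) Ω (app S u q.2 - u)) := by
        have := energy_sub_le (n := n) (p := n + 1) (S := Ω) (v := app S u q.1 - u) (w := app S u q.2 - u)
          ((hCD q.1).continuous.measurable.sub U.meas)
        rwa [sub_sub_sub_cancel_right] at this
      calc _ ≤ C * (l * (2 * energy n (n + 1) Ω u + 2 * energy n (n + 1) Ω u + (Eφ + ENNReal.ofReal (Mg * Mp) ^ (n + 1))) + l⁻¹ ^ n *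
            (2 ^ (n + 1) * (energy n (n + 1) Ω (app S u q.1 - u) + energy n (n + 1) Ω (app S u q.2 - u)))) :=
            mul_le_mul' le_rfl (add_le_add (mul_le_mul' le_rfl (add_le_add (add_le_add h1 h2) (add_le_add h3 le_rfl)))
              (mul_le_mul' le_rfl h4))
        _ = _ := by ring
    · have h1 := het.comp (tendsto_fst (f := (atTop : Filter ℕ)) (g := (atTop : Filter ℕ)))
      have h2 := het.comp (tendsto_snd (f := (atTop : Filter ℕ)) (g := (atTop : Filter ℕ)))
      have := ENNReal.Tendsto.const_mul (a := 2 ^ (n + 1)) (h1.add h2) (Or.inr (by finiteness))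
      rw [add_zero, mul_zero] at this
      exact this
  rw [Metric.tendsto_nhds]
  intro δ hδ
  have hk := (ENNReal.tendsto_nhds_zero.1 key) (ENNReal.ofReal (δ / 2)) (by simpa using hδ)
  filter_upwards [hk.curry] with k hk
  have hlim := JJ_app D S G (hφC k)
  have h2 : Tendsto (fun m => |(∫ x in Ω, φ k x * (jacMat n (app S u k) x).det) - ∫ x in Ω, (jacMat n (app S u m) x).det * φ k x|)
      atTop (𝓝 |(∫ x in Ω, φ k x * (jacMat n (app S u k) x).det) - JJ n Ω u (φ k)|) := (tendsto_const_nhds.sub hlim).abs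
  have h3 := le_of_tendsto h2 (b := δ / 2) (by
    filter_upwards [hk] with m hm
    rw [ENNReal.ofReal_le_ofReal_iff (by positivity)] at hm
    refine le_trans (le_of_eq ?_) hm
    rw [show (∫ x in Ω, (jacMat n (app S u m) x).det * φ k x) = ∫ x in Ω, φ k x * (jacMat n (app S u m) x).det by simp_rw [mul_comm],
      ← integral_sub (hI k k) (hI k m)]
    simp_rw [mul_sub])
  rw [Real.dist_eq, sub_zero]
  linarith

end

section

/-! ### Chain rule and weak coarea formula -/

lemma cb_dist {n : ℕ} {f g : Euc n → ℝ} (hf : Continuous f) {C : ℝ} (hfb : ∀ x, |f x| ≤ C) (hg : Continuous g) {C' : ℝ}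
    (hgb : ∀ x, |g x| ≤ C') {e : ℝ} (he : 0 ≤ e) (h : ∀ x, |f x - g x| ≤ e) : ‖cb f - cb g‖ ≤ e := by
  rw [BoundedContinuousFunction.norm_le he]
  intro x
  rw [BoundedContinuousFunction.sub_apply, cb_apply hf hfb, cb_apply hg hgb]
  exact h x

lemma prod_bd {n : ℕ} {u : Euc n → Euc n} {g ψ : Euc n → ℝ} {Mg Mp : ℝ}
    (hg : ∀ z, |g z| ≤ Mg) (hp : ∀ z, |ψ z| ≤ Mp) (x : Euc n) : |g (u x) * ψ x| ≤ Mg * Mp := by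
  rw [abs_mul]
  exact mul_le_mul (hg _) (hp _) (abs_nonneg _) ((abs_nonneg _).trans (hg 0))

lemma chain {n : ℕ} {Ω : Set (Euc n)} (D : Dom n Ω) {u : Euc n → Euc n} (U : UU n Ω u) {a : Euc n} (A : Gen n Ω u a)
    {ε : ℝ} (hε : 0 < ε) {ψ : Euc n → ℝ} (hψ : Cc1 n Ω ψ) {L : BoundedContinuousFunction (Euc n) ℝ →L[ℝ] ℝ}
    (hL : ∀ f, Cc1 n Ω f → L (cb f) = JJ n Ω u f) :
    JJ n Ω (fun x => Qe ε (u x - a)) ψ = L (cb (fun x => rho n ε (u x - a) * ψ x)) := by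
  obtain ⟨S⟩ := approxSys_exists D.ho D.hb D.hs
  have G := U.good D
  have hCD := fun k => app_contDiff D.ho.measurableSet S U.int k
  obtain ⟨Lg, hLg0, hLg⟩ := rho_lip (n := n) hε
  set g : Euc n → ℝ := fun z => rho n ε (z - a) with hg
  have hgC : ContDiff ℝ 1 g := (rho_contDiff hε).comp (contDiff_id.sub contDiff_const)
  have hgM : ∀ z, |g z| ≤ ε ^ 2 * ε⁻¹ ^ (n + 2) := fun z => by
    rw [abs_of_nonneg (rho_nonneg _ _)]; exact rho_le hε _
  have hgl : ∀ z w, |g z - g w| ≤ Lg * ‖z - w‖ := fun z w => by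
    have := hLg (z - a) (w - a)
    rwa [sub_sub_sub_cancel_right] at this
  obtain ⟨K, hK, hKΩ, h0, Mp, hp, -⟩ := cc1_bd hψ
  have hMp : 0 ≤ Mp := (abs_nonneg _).trans (hp 0)
  have h1 := chain_aux D U S hψ hgC hgM hgl
  have hQ : LipschitzWith (Real.toNNReal (2 / ε)) (fun z : Euc n => Qe ε (z - a)) := by
    intro z w
    have := (Qe_lip (n := n) hε).edist_le_mul (z - a) (w - a)
    rwa [edist_sub_right] at this
  obtain ⟨t1, t2⟩ := app_good_tendsto D S G hQ
  have h2 := JJ_lim D (Q_good D U A ε) hψ (a := fun k x => Qe ε (app S u k x - a))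
    (fun k => ((Qe_contDiff hε).of_le (by norm_cast)).comp ((hCD k).sub contDiff_const)) t1 t2
  have e1 : ∀ k x, (jacMat n (fun x => Qe ε (app S u k x - a)) x).det * ψ x =
      (g (app S u k x) * ψ x) * (jacMat n (app S u k) x).det := by
    intro k x
    have hd := (hCD k).differentiable (by simp) x
    have e2 := jac_comp (Q := Qe ε) (v := fun x => app S u k x - a) (x := x)
      ((Qe_contDiff hε).differentiable (by simp) _) (hd.sub_const a)
    have e3 : jacMat n (fun x => app S u k x - a) x = jacMat n (app S u k) x := by
      unfold jacMat; rw [fderiv_sub_const]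
    rw [e2, e3, Qe_det hε]
    ring
  simp_rw [e1] at h2
  have h3 : Tendsto (fun k => JJ n Ω u (fun x => g (app S u k x) * ψ x)) atTop (𝓝 (JJ n Ω (fun x => Qe ε (u x - a)) ψ)) := by
    have := h2.sub h1
    simpa using this
  have h4 : Tendsto (fun k => cb (fun x => g (app S u k x) * ψ x)) atTop (𝓝 (cb (fun x => g (u x) * ψ x))) := by
    rw [tendsto_iff_norm_sub_tendsto_zero, Metric.tendsto_nhds]
    intro δ hδ
    have hd : 0 < δ / 2 / (Lg * Mp + 1) := by positivity
    filter_upwards [app_unif D.ho S U.int U.cont hK hKΩ hd] with k hk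
    have : ‖cb (fun x => g (app S u k x) * ψ x) - cb (fun x => g (u x) * ψ x)‖ ≤ δ / 2 := by
      refine cb_dist (prod_cc1 (hCD k) hgC hψ).1.continuous (prod_bd hgM hp) (prod_cont D.ho U.cont hgC.continuous hψ)
        (prod_bd hgM hp) (by positivity) fun x => ?_
      by_cases hx : x ∈ K
      · rw [← sub_mul, abs_mul]
        calc _ ≤ Lg * (δ / 2 / (Lg * Mp + 1)) * Mp := by
              refine mul_le_mul ((hgl _ _).trans (mul_le_mul_of_nonneg_left (hk x hx) hLg0)) (hp x) (abs_nonneg _) (by positivity)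
          _ = δ / 2 * ((Lg * Mp) / (Lg * Mp + 1)) := by ring
          _ ≤ δ / 2 * 1 := by
              refine mul_le_mul_of_nonneg_left ?_ (by positivity)
              rw [div_le_one (by positivity)]; linarith
          _ = δ / 2 := mul_one _
      · rw [h0 x hx]; simp; positivity
    rw [Real.dist_eq, sub_zero, abs_of_nonneg (norm_nonneg _)]
    linarith
  have h5 := (L.continuous.tendsto _).comp h4
  refine tendsto_nhds_unique h3 (h5.congr fun k => ?_)
  exact hL _ (prod_cc1 (hCD k) hgC hψ)

/-- The bundled integrand. -/
def RB (n : ℕ) (ε : ℝ) (u : Euc n → Euc n) (ψ : Euc n → ℝ) (a : Euc n) : BoundedContinuousFunction (Euc n) ℝ :=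
  cb (fun x => rho n ε (u x - a) * ψ x)

lemma RB_facts {n : ℕ} {Ω : Set (Euc n)} (ho : IsOpen Ω) {u : Euc n → Euc n} (hu : ContinuousOn u Ω)
    {ε : ℝ} (hε : 0 < ε) {ψ : Euc n → ℝ} (hψ : Cc1 n Ω ψ) :
    Continuous (RB n ε u ψ) ∧ ∀ a x, RB n ε u ψ a x = rho n ε (u x - a) * ψ x := by
  obtain ⟨Lg, hLg0, hLg⟩ := rho_lip (n := n) hε
  obtain ⟨K, hK, hKΩ, h0, Mp, hp, -⟩ := cc1_bd hψ
  have hMp : 0 ≤ Mp := (abs_nonneg _).trans (hp 0)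
  have hgM : ∀ a z : Euc n, |rho n ε (z - a)| ≤ ε ^ 2 * ε⁻¹ ^ (n + 2) := fun a z => by
    rw [abs_of_nonneg (rho_nonneg _ _)]; exact rho_le hε _
  have hc : ∀ a, Continuous (fun x => rho n ε (u x - a) * ψ x) := fun a =>
    prod_cont ho hu (g := fun z => rho n ε (z - a)) ((rho_contDiff hε).continuous.comp (by fun_prop)) hψ
  have hb : ∀ a x, |rho n ε (u x - a) * ψ x| ≤ ε ^ 2 * ε⁻¹ ^ (n + 2) * Mp := fun a => prod_bd (g := fun z => rho n ε (z - a)) (hgM a) hp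
  refine ⟨?_, fun a x => ?_⟩
  · refine (LipschitzWith.of_dist_le_mul (K := Real.toNNReal (Lg * Mp)) fun a b => ?_).continuous
    rw [dist_eq_norm, Real.coe_toNNReal _ (by positivity)]
    refine cb_dist (hc a) (hb a) (hc b) (hb b) (by positivity) fun x => ?_
    rw [← sub_mul, abs_mul]
    calc _ ≤ Lg * dist a b * Mp := by
          refine mul_le_mul ((hLg _ _).trans (le_of_eq ?_)) (hp x) (abs_nonneg _) (by positivity)
          rw [sub_sub_sub_cancel_left, dist_comm, dist_eq_norm]
      _ = _ := by ring
  · unfold RB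
    rw [cb_apply (hc a) (hb a)]

lemma RB_int {n : ℕ} {Ω : Set (Euc n)} (ho : IsOpen Ω) {u : Euc n → Euc n} (hu : ContinuousOn u Ω)
    {ψ : Euc n → ℝ} (hψ : Cc1 n Ω ψ) {φ : Euc n → ℝ} (hφ : Continuous φ) (hφs : HasCompactSupport φ) {Λ : ℝ} (hΛ0 : 0 ≤ Λ)
    (hΛ : ∀ x y, |φ x - φ y| ≤ Λ * ‖x - y‖) {ε : ℕ → ℝ} (hε : ∀ k, 0 < ε k) (h0 : Tendsto ε atTop (𝓝 0))
    (L : BoundedContinuousFunction (Euc n) ℝ →L[ℝ] ℝ) :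
    Tendsto (fun k => ∫ a, φ a * L (RB n (ε k) u ψ a)) atTop (𝓝 (ballVol n * L (cb (fun x => φ (u x) * ψ x)))) := by
  obtain ⟨M, hM⟩ := hφ.bounded_above_of_compact_support hφs
  obtain ⟨e, he, hest⟩ := rho_approx hφ hΛ0 hM hΛ hε h0
  obtain ⟨K, hK, hKΩ, hK0, Mp, hp, -⟩ := cc1_bd hψ
  have hMp : 0 ≤ Mp := (abs_nonneg _).trans (hp 0)
  have hcont : ∀ k, Continuous fun a => φ a • RB n (ε k) u ψ a := fun k => hφ.smul (RB_facts ho hu (hε k) hψ).1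
  have hintg : ∀ k, Integrable (fun a => φ a • RB n (ε k) u ψ a) := fun k =>
    (hcont k).integrable_of_hasCompactSupport hφs.smul_right
  have e1 : ∀ k, ∫ a, φ a * L (RB n (ε k) u ψ a) = L (∫ a, φ a • RB n (ε k) u ψ a) := fun k => by
    rw [← ContinuousLinearMap.integral_comp_comm L (hintg k)]
    simp
  simp_rw [e1]
  have e2 : ballVol n * L (cb (fun x => φ (u x) * ψ x)) = L (ballVol n • cb (fun x => φ (u x) * ψ x)) := by simp
  rw [e2]
  refine (L.continuous.tendsto _).comp ?_
  rw [tendsto_iff_norm_sub_tendsto_zero]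
  refine squeeze_zero (fun k => norm_nonneg _) (fun k => ?_) (by simpa using he.mul_const Mp)
  have hek : 0 ≤ e k := (abs_nonneg _).trans (hest k 0)
  rw [BoundedContinuousFunction.norm_le (by positivity)]
  intro x
  have e3 : (∫ a, φ a • RB n (ε k) u ψ a) x = (∫ a, φ a * rho n (ε k) (u x - a)) * ψ x := by
    have := ContinuousLinearMap.integral_comp_comm (BoundedContinuousFunction.evalCLM ℝ x) (hintg k)
    rw [BoundedContinuousFunction.evalCLM_apply] at this
    rw [← this, ← integral_mul_const]
    refine integral_congr_ae (.of_forall fun a => ?_)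
    simp only [BoundedContinuousFunction.evalCLM_apply, BoundedContinuousFunction.smul_apply, smul_eq_mul]
    rw [(RB_facts ho hu (hε k) hψ).2]; ring
  rw [BoundedContinuousFunction.sub_apply, BoundedContinuousFunction.smul_apply, e3,
    cb_apply (prod_cont ho hu hφ hψ) (prod_bd hM hp), smul_eq_mul, ← mul_assoc, ← sub_mul, norm_mul]
  exact mul_le_mul (hest k _) (hp x) (abs_nonneg _) hek

end

section

/-! ### The weak coarea formula -/

/-- The pairing of the Jacobian of `u^a`. -/
def hh (n : ℕ) (Ω : Set (Euc n)) (u : Euc n → Euc n) (ψ : Euc n → ℝ) (a : Euc n) : ℝ :=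
  JJ n Ω (fun x => Qe 0 (u x - a)) ψ

lemma cc1_lip {n : ℕ} {Ω : Set (Euc n)} {φ : Euc n → ℝ} (h : Cc1 n Ω φ) :
    ∃ Λ, 0 ≤ Λ ∧ ∀ x y, |φ x - φ y| ≤ Λ * ‖x - y‖ := by
  obtain ⟨K, -, -, -, M, hM, Λ, hΛ⟩ := cc1_bd h
  refine ⟨Λ, (norm_nonneg _).trans (hΛ 0), fun z w => ?_⟩
  exact Convex.norm_image_sub_le_of_norm_fderiv_le (s := Set.univ) (fun x _ => (h.1.differentiable (by simp)) x)
      (fun x _ => hΛ x) convex_univ (Set.mem_univ _) (Set.mem_univ _)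

lemma hh_bound {n : ℕ} {Ω : Set (Euc n)} (D : Dom n Ω) {u : Euc n → Euc n} (U : UU n Ω u) {ψ : Euc n → ℝ} (hψ : Cc1 n Ω ψ) :
    ∃ C : ENNReal, C ≠ ⊤ ∧ ∀ a, Gen n Ω u a → ∀ ε, ENNReal.ofReal |JJ n Ω (fun x => Qe ε (u x - a)) ψ| ≤ C * GG n Ω u a := by
  obtain ⟨K, hK, hKΩ, h0, M, hM, Λ, hΛ⟩ := cc1_bd hψ
  obtain ⟨C, hC, h⟩ := JJ_bound D hK hKΩ
  refine ⟨C * ENNReal.ofReal (Λ + M), by finiteness, fun a A ε => ?_⟩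
  exact (h _ (Q_good D U A ε) ψ hψ h0 M hM Λ hΛ).trans (mul_le_mul' le_rfl (Q_energy_le D A ε))

lemma seq_eps : ∃ ε : ℕ → ℝ, (∀ k, 0 < ε k) ∧ Tendsto ε atTop (𝓝 0) :=
  ⟨fun k => 1 / ((k : ℝ) + 1), fun k => by positivity, tendsto_one_div_add_atTop_nhds_zero_nat⟩

section
variable {n : ℕ} {Ω : Set (Euc n)} {u : Euc n → Euc n} {L : BoundedContinuousFunction (Euc n) ℝ →L[ℝ] ℝ}

lemma hh_lim (D : Dom n Ω) (U : UU n Ω u) (hL : ∀ f, Cc1 n Ω f → L (cb f) = JJ n Ω u f) {ψ : Euc n → ℝ} (hψ : Cc1 n Ω ψ)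
    {ε : ℕ → ℝ} (hε : ∀ k, 0 < ε k) (h0 : Tendsto ε atTop (𝓝 0)) {a : Euc n} (A : Gen n Ω u a) :
    Tendsto (fun k => L (RB n (ε k) u ψ a)) atTop (𝓝 (hh n Ω u ψ a)) :=
  (JJ_Q_tendsto D U A h0 hψ).congr fun k => chain D U A (hε k) hψ hL

lemma hh_meas (D : Dom n Ω) (U : UU n Ω u) (hL : ∀ f, Cc1 n Ω f → L (cb f) = JJ n Ω u f) {ψ : Euc n → ℝ} (hψ : Cc1 n Ω ψ) :
    AEStronglyMeasurable (hh n Ω u ψ) volume := by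
  obtain ⟨ε, hε, h0⟩ := seq_eps
  refine aestronglyMeasurable_of_tendsto_ae atTop (f := fun k a => L (RB n (ε k) u ψ a)) (fun k => ?_) ?_
  · exact (L.continuous.comp (RB_facts D.ho U.cont (hε k) hψ).1).aestronglyMeasurable
  · filter_upwards [ae_gen D U] with a A using hh_lim D U hL hψ hε h0 A

lemma GG_bd_int (D : Dom n Ω) (U : UU n Ω u) {C : ENNReal} (hC : C ≠ ⊤) {B : Set (Euc n)} (hB : IsCompact B) :
    Integrable (fun a => (C * GG n Ω u a).toReal) (volume.restrict B) := by
  refine integrable_toReal_of_lintegral_ne_top ((GG_meas U.meas).const_mul C).aemeasurable ?_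
  rw [lintegral_const_mul' _ _ hC]
  exact ENNReal.mul_ne_top hC (GG_loc D U hB.measure_lt_top.ne)

lemma hh_abs_le (D : Dom n Ω) (U : UU n Ω u) {ψ : Euc n → ℝ} (hψ : Cc1 n Ω ψ) :
    ∃ C : ENNReal, C ≠ ⊤ ∧ ∀ a, Gen n Ω u a → ∀ ε, |JJ n Ω (fun x => Qe ε (u x - a)) ψ| ≤ (C * GG n Ω u a).toReal := by
  obtain ⟨C, hC, h⟩ := hh_bound D U hψ
  refine ⟨C, hC, fun a A ε => ?_⟩
  rw [← ENNReal.ofReal_le_iff_le_toReal (ENNReal.mul_ne_top hC A.fin)]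
  exact h a A ε

lemma hh_int (D : Dom n Ω) (U : UU n Ω u) (hL : ∀ f, Cc1 n Ω f → L (cb f) = JJ n Ω u f) {ψ : Euc n → ℝ} (hψ : Cc1 n Ω ψ)
    {B : Set (Euc n)} (hB : IsCompact B) : IntegrableOn (hh n Ω u ψ) B := by
  obtain ⟨C, hC, h⟩ := hh_abs_le D U hψ
  refine (GG_bd_int D U hC hB).mono' (hh_meas D U hL hψ).restrict ?_
  filter_upwards [ae_restrict_of_ae (ae_gen D U)] with a A using h a A 0

lemma weak (D : Dom n Ω) (U : UU n Ω u) (hL : ∀ f, Cc1 n Ω f → L (cb f) = JJ n Ω u f) {ψ : Euc n → ℝ} (hψ : Cc1 n Ω ψ)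
    {φ : Euc n → ℝ} (hφ : Cc1 n Set.univ φ) :
    ∫ a, φ a * hh n Ω u ψ a = ballVol n * L (cb (fun x => φ (u x) * ψ x)) := by
  obtain ⟨ε, hε, h0⟩ := seq_eps
  obtain ⟨Λ, hΛ0, hΛ⟩ := cc1_lip hφ
  obtain ⟨B, hB, -, hB0, M, hM, -⟩ := cc1_bd hφ
  have hM0 : 0 ≤ M := (abs_nonneg _).trans (hM 0)
  have h1 := RB_int D.ho U.cont hψ hφ.1.continuous hφ.2.1 hΛ0 hΛ hε h0 L
  refine tendsto_nhds_unique ?_ h1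
  obtain ⟨C, hC, h⟩ := hh_abs_le D U hψ
  refine tendsto_integral_of_dominated_convergence (B.indicator fun a => M * (C * GG n Ω u a).toReal) (fun k => ?_) ?_ (fun k => ?_) ?_
  · exact (hφ.1.continuous.mul (L.continuous.comp (RB_facts D.ho U.cont (hε k) hψ).1)).aestronglyMeasurable
  · rw [integrable_indicator_iff hB.measurableSet]
    exact (GG_bd_int D U hC hB).const_mul M
  · filter_upwards [ae_gen D U] with a A
    by_cases ha : a ∈ B
    · rw [Set.indicator_of_mem ha, norm_mul]
      have := h a A (ε k)
      rw [chain D U A (hε k) hψ hL] at this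
      exact mul_le_mul (hM a) this (abs_nonneg _) hM0
    · rw [hB0 a ha, zero_mul, norm_zero, Set.indicator_of_notMem ha]
  · filter_upwards [ae_gen D U] with a A using (hh_lim D U hL hψ hε h0 A).const_mul _

lemma weak_family (D : Dom n Ω) (U : UU n Ω u) (hL : ∀ f, Cc1 n Ω f → L (cb f) = JJ n Ω u f) {M : ℝ} (hM : ‖L‖ ≤ M)
    (N : ℕ) (ψ φ : ℕ → Euc n → ℝ) (hψ : ∀ i, Cc1 n Ω (ψ i)) (hψ1 : ∀ i x, |ψ i x| ≤ 1) (hφ : ∀ i, Cc1 n Set.univ (φ i))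
    (hφ0 : ∀ i x, 0 ≤ φ i x) (hφ1 : ∀ x, ∑ i ∈ Finset.range N, φ i x ≤ 1) :
    ∑ i ∈ Finset.range N, ∫ a, φ i a * hh n Ω u (ψ i) a ≤ ballVol n * M := by
  simp_rw [weak D U hL (hψ _) (hφ _)]
  rw [← Finset.mul_sum, ← map_sum]
  refine mul_le_mul_of_nonneg_left ?_ ENNReal.toReal_nonneg
  refine (le_abs_self _).trans ((L.le_opNorm _).trans ?_)
  have : ‖∑ i ∈ Finset.range N, cb (fun x => φ i (u x) * ψ i x)‖ ≤ 1 := by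
    rw [BoundedContinuousFunction.norm_le zero_le_one]
    intro x
    rw [BoundedContinuousFunction.sum_apply]
    refine (norm_sum_le _ _).trans (le_trans (Finset.sum_le_sum fun i _ => ?_) (hφ1 (u x)))
    obtain ⟨B, hB, -, hB0, C, hC, -⟩ := cc1_bd (hφ i)
    rw [cb_apply (prod_cont D.ho U.cont (hφ i).1.continuous (hψ i)) (prod_bd hC (hψ1 i)), norm_mul, Real.norm_eq_abs,
      abs_of_nonneg (hφ0 i _)]
    exact mul_le_of_le_one_right (hφ0 i _) (hψ1 i x)
  calc _ ≤ M * 1 := mul_le_mul hM this (norm_nonneg _) ((norm_nonneg L).trans hM)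
    _ = M := mul_one M

lemma weak_conv (D : Dom n Ω) (U : UU n Ω u) (hL : ∀ f, Cc1 n Ω f → L (cb f) = JJ n Ω u f) {ψ : Euc n → ℝ} (hψ : Cc1 n Ω ψ) :
    ∃ φ, Cc1 n Set.univ φ ∧ (∀ a, 0 ≤ φ a) ∧ (∀ a, φ a ≤ 1) ∧ ∫ a, φ a * hh n Ω u ψ a = ballVol n * JJ n Ω u ψ := by
  obtain ⟨K, hK, hKΩ, h0, -⟩ := cc1_bd hψ
  obtain ⟨R, hR⟩ := (hK.image_of_continuousOn (U.cont.mono hKΩ)).isBounded.exists_norm_le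
  let φ : ContDiffBump (0 : Euc n) := ⟨|R| + 1, |R| + 2, by positivity, by linarith⟩
  have hφ : Cc1 n Set.univ φ := ⟨φ.contDiff, φ.hasCompactSupport, Set.subset_univ _⟩
  refine ⟨φ, hφ, fun a => φ.nonneg, fun a => φ.le_one, ?_⟩
  rw [weak D U hL hψ hφ, ← hL ψ hψ]
  congr 3
  funext x
  by_cases hx : x ∈ K
  · have h1 : φ (u x) = 1 := by
      refine φ.one_of_mem_closedBall ?_
      rw [mem_closedBall_zero_iff]
      show ‖u x‖ ≤ |R| + 1
      linarith [hR _ (Set.mem_image_of_mem u hx), le_abs_self R]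
    rw [h1, one_mul]
  · rw [h0 x hx, mul_zero]

end

end

section

/-- test families for the supremum lemma -/
def Fam (n : ℕ) (h : ℕ → Euc n → ℝ) (B : ℝ) : Prop :=
  ∀ (N : ℕ) (φ : ℕ → Euc n → ℝ), (∀ i, Cc1 n Set.univ (φ i)) → (∀ i x, 0 ≤ φ i x) →
    (∀ x, ∑ i ∈ Finset.range N, φ i x ≤ 1) → ∑ i ∈ Finset.range N, ∫ a, φ i a * h i a ≤ B

variable {n : ℕ}

/-- shrinking bumps -/
def bmp (n : ℕ) (k : ℕ) : ContDiffBump (0 : Euc n) :=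
  ⟨1 / ((k : ℝ) + 1) / 2, 1 / ((k : ℝ) + 1), by positivity, half_lt_self (by positivity)⟩

open scoped Convolution in
/-- mollified indicator -/
def mol (n : ℕ) (k : ℕ) (A : Set (Euc n)) : Euc n → ℝ :=
  ((bmp n k).normed volume) ⋆[ContinuousLinearMap.lsmul ℝ ℝ, volume] (A.indicator fun _ => (1 : ℝ))

lemma mol_apply (k : ℕ) (A : Set (Euc n)) (x : Euc n) :
    mol n k A x = ∫ t, (bmp n k).normed volume t * A.indicator (fun _ => (1 : ℝ)) (x - t) := rfl

lemma ind_nonneg (A : Set (Euc n)) (x : Euc n) : 0 ≤ A.indicator (fun _ => (1 : ℝ)) x :=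
  Set.indicator_nonneg (fun _ _ => zero_le_one) x

lemma ind_le (A : Set (Euc n)) (x : Euc n) : A.indicator (fun _ => (1 : ℝ)) x ≤ 1 :=
  Set.indicator_le_self' (fun _ _ => zero_le_one) x

lemma mol_nonneg (k : ℕ) (A : Set (Euc n)) (x : Euc n) : 0 ≤ mol n k A x := by
  rw [mol_apply]
  exact integral_nonneg fun t => mul_nonneg ((bmp n k).nonneg_normed t) (ind_nonneg A _)

lemma mol_int (k : ℕ) {A : Set (Euc n)} (hA : MeasurableSet A) (x : Euc n) :
    Integrable (fun t => (bmp n k).normed volume t * A.indicator (fun _ => (1 : ℝ)) (x - t)) := by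
  refine ((bmp n k).integrable_normed (μ := volume)).mono ?_ (ae_of_all _ fun t => ?_)
  · refine ((bmp n k).continuous_normed.aestronglyMeasurable).mul ?_
    exact ((measurable_const.indicator hA).comp (measurable_const.sub measurable_id)).aestronglyMeasurable
  · rw [norm_mul, Real.norm_eq_abs (A.indicator _ _), abs_of_nonneg (ind_nonneg A _)]
    exact mul_le_of_le_one_right (norm_nonneg _) (ind_le A _)

lemma mol_sum (k N : ℕ) {A : ℕ → Set (Euc n)} (hA : ∀ i, MeasurableSet (A i))
    (h1 : ∀ x, ∑ i ∈ Finset.range N, (A i).indicator (fun _ => (1 : ℝ)) x ≤ 1) (x : Euc n) :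
    ∑ i ∈ Finset.range N, mol n k (A i) x ≤ 1 := by
  simp_rw [mol_apply]
  rw [← integral_finset_sum _ fun i _ => mol_int k (hA i) x]
  refine le_trans ?_ (le_of_eq ((bmp n k).integral_normed (μ := volume)))
  refine integral_mono (integrable_finset_sum _ fun i _ => mol_int k (hA i) x) (bmp n k).integrable_normed fun t => ?_
  simp only [← Finset.mul_sum]
  exact mul_le_of_le_one_right ((bmp n k).nonneg_normed t) (h1 _)

lemma mol_le (k : ℕ) {A : Set (Euc n)} (hA : MeasurableSet A) (x : Euc n) : mol n k A x ≤ 1 := by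
  have := mol_sum k 1 (A := fun _ => A) (fun _ => hA) (fun x => by simpa using ind_le A x) x
  simpa using this

lemma mol_zero (k : ℕ) {A : Set (Euc n)} {R : ℝ} (hR : A ⊆ closedBall 0 R) {x : Euc n}
    (hx : x ∉ closedBall (0 : Euc n) (R + 1)) : mol n k A x = 0 := by
  rw [mol_apply]
  rw [← integral_zero (Euc n) ℝ]
  congr 1
  funext t
  by_cases ht : x - t ∈ A
  · have h1 := hR ht
    have : t ∉ Function.support ((bmp n k).normed (volume : Measure (Euc n))) := by
      rw [(bmp n k).support_normed_eq, mem_ball_zero_iff]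
      rw [mem_closedBall_zero_iff] at h1 hx
      show ¬ ‖t‖ < 1 / ((k : ℝ) + 1)
      have h2 : 1 / ((k : ℝ) + 1) ≤ 1 := by
        rw [div_le_one (by positivity)]
        linarith [k.cast_nonneg (α := ℝ)]
      have h3 : ‖x‖ ≤ ‖x - t‖ + ‖t‖ := by simpa using norm_add_le (x - t) t
      intro h
      exact hx (by linarith)
    rw [Function.notMem_support.1 this, zero_mul]
  · rw [Set.indicator_of_notMem ht, mul_zero]

lemma mol_cc1 (k : ℕ) {A : Set (Euc n)} (hA : MeasurableSet A) {R : ℝ} (hR : A ⊆ closedBall 0 R) :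
    Cc1 n Set.univ (mol n k A) := by
  refine ⟨?_, ?_, Set.subset_univ _⟩
  · refine HasCompactSupport.contDiff_convolution_left _ (bmp n k).hasCompactSupport_normed
      (bmp n k).contDiff_normed ?_
    exact ((integrable_indicator_iff hA).2 (integrableOn_const (measure_ne_top_of_subset hR
      (isCompact_closedBall 0 R).measure_ne_top))).locallyIntegrable
  · exact HasCompactSupport.intro (isCompact_closedBall 0 (R + 1)) fun x hx => mol_zero k hR hx

lemma mol_tendsto {A : Set (Euc n)} (hA : MeasurableSet A) {R : ℝ} (hR : A ⊆ closedBall 0 R) :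
    ∀ᵐ x, Tendsto (fun k => mol n k A x) atTop (𝓝 (A.indicator (fun _ => (1 : ℝ)) x)) := by
  refine ContDiffBump.ae_convolution_tendsto_right_of_locallyIntegrable (φ := fun k => bmp n k) (K := 2) ?_ ?_ ?_
  · exact tendsto_one_div_add_atTop_nhds_zero_nat
  · refine Eventually.of_forall fun k => ?_
    show 1 / ((k : ℝ) + 1) ≤ 2 * (1 / ((k : ℝ) + 1) / 2)
    linarith
  · exact ((integrable_indicator_iff hA).2 (integrableOn_const (measure_ne_top_of_subset hR
      (isCompact_closedBall 0 R).measure_ne_top))).locallyIntegrable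

lemma fam_ind {h : ℕ → Euc n → ℝ} {B : ℝ} (hF : Fam n h B) (hm : ∀ i, AEStronglyMeasurable (h i) volume)
    (hi : ∀ i K, IsCompact K → IntegrableOn (h i) K) (N : ℕ) {A : ℕ → Set (Euc n)} (hA : ∀ i, MeasurableSet (A i))
    {R : ℝ} (hR : ∀ i, A i ⊆ closedBall 0 R)
    (h1 : ∀ x, ∑ i ∈ Finset.range N, (A i).indicator (fun _ => (1 : ℝ)) x ≤ 1) :
    ∑ i ∈ Finset.range N, ∫ a in A i, h i a ≤ B := by
  have key : ∀ i, Tendsto (fun k => ∫ a, mol n k (A i) a * h i a) atTop (𝓝 (∫ a in A i, h i a)) := by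
    intro i
    rw [← integral_indicator (hA i)]
    refine tendsto_integral_of_dominated_convergence ((closedBall 0 (R + 1)).indicator fun a => ‖h i a‖) ?_ ?_ ?_ ?_
    · exact fun k => (mol_cc1 k (hA i) (hR i)).1.continuous.aestronglyMeasurable.mul (hm i)
    · rw [integrable_indicator_iff isClosed_closedBall.measurableSet]
      exact (hi i _ (isCompact_closedBall 0 (R + 1))).norm
    · refine fun k => ae_of_all _ fun a => ?_
      by_cases ha : a ∈ closedBall (0 : Euc n) (R + 1)
      · rw [Set.indicator_of_mem ha, norm_mul, Real.norm_eq_abs (mol _ _ _ _), abs_of_nonneg (mol_nonneg _ _ _)]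
        exact mul_le_of_le_one_left (norm_nonneg _) (mol_le k (hA i) a)
      · rw [Set.indicator_of_notMem ha, mol_zero k (hR i) ha, zero_mul, norm_zero]
    · filter_upwards [mol_tendsto (hA i) (hR i)] with a ha
      have := ha.mul_const (h i a)
      convert this using 2
      by_cases hx : a ∈ A i
      · rw [Set.indicator_of_mem hx, Set.indicator_of_mem hx, one_mul]
      · rw [Set.indicator_of_notMem hx, Set.indicator_of_notMem hx, zero_mul]
  refine le_of_tendsto (tendsto_finset_sum (Finset.range N) fun i _ => key i) (Eventually.of_forall fun k => ?_)
  exact hF N _ (fun i => mol_cc1 k (hA i) (hR i)) (fun i => mol_nonneg k _) (mol_sum k N hA h1)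

/-- first-argmax partition -/
def amax (h : ℕ → Euc n → ℝ) (N : ℕ) (i : ℕ) : Set (Euc n) :=
  closedBall 0 N ∩ {a | (∀ j < N, h j a ≤ h i a) ∧ ∀ j < i, h j a < h i a}

lemma amax_meas {h : ℕ → Euc n → ℝ} (hm : ∀ i, Measurable (h i)) (N i : ℕ) : MeasurableSet (amax h N i) := by
  refine isClosed_closedBall.measurableSet.inter ?_
  rw [Set.setOf_and]
  simp only [Set.setOf_forall]
  exact (MeasurableSet.iInter fun j => MeasurableSet.iInter fun _ => measurableSet_le (hm j) (hm i)).inter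
    (MeasurableSet.iInter fun j => MeasurableSet.iInter fun _ => measurableSet_lt (hm j) (hm i))

lemma amax_disj {h : ℕ → Euc n → ℝ} {N i j : ℕ} (hi : i < N) (hj : j < N) {a : Euc n} (h1 : a ∈ amax h N i)
    (h2 : a ∈ amax h N j) : i = j := by
  rcases lt_trichotomy i j with h | h | h
  · exact absurd (h1.2.1 j hj) (not_le.2 (h2.2.2 i h))
  · exact h
  · exact absurd (h2.2.1 i hi) (not_le.2 (h1.2.2 j h))

lemma amax_sum {h : ℕ → Euc n → ℝ} {N : ℕ} (x : Euc n) :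
    ∑ i ∈ Finset.range N, (amax h N i).indicator (fun _ => (1 : ℝ)) x ≤ 1 := by
  by_cases H : ∃ i < N, x ∈ amax h N i
  · obtain ⟨i, hi, hx⟩ := H
    rw [Finset.sum_eq_single i]
    · exact ind_le _ _
    · intro j hj hji
      refine Set.indicator_of_notMem (fun h => hji ?_) _
      exact amax_disj (Finset.mem_range.1 hj) hi h hx
    · exact fun h => absurd (Finset.mem_range.2 hi) h
  · push Not at H
    rw [Finset.sum_eq_zero]
    · exact zero_le_one
    · exact fun i hi => Set.indicator_of_notMem (H i (Finset.mem_range.1 hi)) _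

lemma amax_exists (h : ℕ → Euc n → ℝ) {N : ℕ} {a : Euc n} (ha : a ∈ closedBall (0 : Euc n) N) {j : ℕ} (hj : j < N) :
    ∃ i < N, a ∈ amax h N i := by
  classical
  have hex : ∃ i, i < N ∧ ∀ j < N, h j a ≤ h i a := by
    obtain ⟨i, hi, H⟩ := Finset.exists_max_image (Finset.range N) (fun i => h i a) ⟨j, Finset.mem_range.2 hj⟩
    exact ⟨i, Finset.mem_range.1 hi, fun j hj => H j (Finset.mem_range.2 hj)⟩
  refine ⟨Nat.find hex, (Nat.find_spec hex).1, ha, (Nat.find_spec hex).2, fun j hj => ?_⟩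
  by_contra hc
  push Not at hc
  exact Nat.find_min hex hj ⟨hj.trans (Nat.find_spec hex).1, fun k hk => ((Nat.find_spec hex).2 k hk).trans hc⟩

lemma sup_meas {h : ℕ → Euc n → ℝ} {B : ℝ} (hF : Fam n h B) (hm : ∀ i, Measurable (h i)) (h0 : ∀ a, h 0 a = 0)
    (hi : ∀ i K, IsCompact K → IntegrableOn (h i) K) : ∫⁻ a, ⨆ i, ENNReal.ofReal (h i a) ≤ ENNReal.ofReal B := by
  let F : ℕ → Euc n → ENNReal := fun N => (closedBall 0 (N : ℝ)).indicator fun a =>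
    ⨆ i ∈ Finset.range N, ENNReal.ofReal (h i a)
  have hF1 : ∀ a, ⨆ i, ENNReal.ofReal (h i a) ≤ ⨆ N, F N a := by
    intro a
    refine iSup_le fun i => ?_
    obtain ⟨M, hM⟩ := exists_nat_ge ‖a‖
    refine le_trans ?_ (le_iSup (fun N => F N a) (max M (i + 1)))
    have : a ∈ closedBall (0 : Euc n) ((max M (i + 1) : ℕ) : ℝ) := by
      rw [mem_closedBall_zero_iff]
      exact hM.trans (by exact_mod_cast le_max_left _ _)
    simp only [F]
    rw [Set.indicator_of_mem this]
    refine le_iSup₂_of_le i (Finset.mem_range.2 ?_) le_rfl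
    exact lt_of_lt_of_le (Nat.lt_succ_self i) (le_max_right _ _)
  have hFm : ∀ N, Measurable (F N) := by
    intro N
    refine Measurable.indicator ?_ isClosed_closedBall.measurableSet
    exact Measurable.biSup _ (Finset.range N).countable_toSet fun i _ => (hm i).ennreal_ofReal
  have hmono : Monotone F := by
    intro N M hNM a
    by_cases ha : a ∈ closedBall (0 : Euc n) (N : ℝ)
    swap
    · simp only [F]
      rw [Set.indicator_of_notMem ha]
      exact zero_le
    simp only [F]
    rw [Set.indicator_of_mem ha]
    have : a ∈ closedBall (0 : Euc n) (M : ℝ) := closedBall_subset_closedBall (by exact_mod_cast hNM) ha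
    rw [Set.indicator_of_mem this]
    refine iSup₂_le fun i hi => le_iSup₂_of_le i ?_ le_rfl
    exact Finset.mem_range.2 ((Finset.mem_range.1 hi).trans_le hNM)
  refine (lintegral_mono hF1).trans ?_
  rw [lintegral_iSup hFm hmono]
  refine iSup_le fun N => ?_
  have hpt : ∀ a, F N a ≤ ∑ i ∈ Finset.range N, (amax h N i).indicator (fun a => ENNReal.ofReal (h i a)) a := by
    intro a
    by_cases ha : a ∈ closedBall (0 : Euc n) (N : ℝ)
    swap
    · simp only [F]
      rw [Set.indicator_of_notMem ha]
      exact zero_le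
    simp only [F]
    rw [Set.indicator_of_mem ha]
    refine iSup₂_le fun j hj => ?_
    obtain ⟨i, hiN, hia⟩ := amax_exists h ha (Finset.mem_range.1 hj)
    refine le_trans ?_ (Finset.single_le_sum (f := fun i => (amax h N i).indicator (fun a => ENNReal.ofReal (h i a)) a)
      (fun _ _ => zero_le) (Finset.mem_range.2 hiN))
    rw [Set.indicator_of_mem hia]
    exact ENNReal.ofReal_le_ofReal (hia.2.1 j (Finset.mem_range.1 hj))
  refine (lintegral_mono hpt).trans ?_
  rw [lintegral_finset_sum _ fun i _ => (hm i).ennreal_ofReal.indicator (amax_meas hm N i)]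
  have hnn : ∀ i ∈ Finset.range N, ∀ a ∈ amax h N i, 0 ≤ h i a := by
    intro i hi a ha
    have := ha.2.1 0 ((Nat.zero_le i).trans_lt (Finset.mem_range.1 hi))
    rwa [h0] at this
  have hsub : ∀ i, amax h N i ⊆ closedBall 0 (N : ℝ) := fun i => Set.inter_subset_left
  calc _ = ∑ i ∈ Finset.range N, ENNReal.ofReal (∫ a in amax h N i, h i a) := by
        refine Finset.sum_congr rfl fun i hiN => ?_
        rw [lintegral_indicator (amax_meas hm N i), ofReal_integral_eq_lintegral_ofReal]
        · exact (hi i _ (isCompact_closedBall 0 (N : ℝ))).mono_set (hsub i)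
        · exact (ae_restrict_iff' (amax_meas hm N i)).2 (ae_of_all _ (hnn i hiN))
    _ = ENNReal.ofReal (∑ i ∈ Finset.range N, ∫ a in amax h N i, h i a) := by
        rw [ENNReal.ofReal_sum_of_nonneg]
        exact fun i hiN => setIntegral_nonneg (amax_meas hm N i) (hnn i hiN)
    _ ≤ _ := ENNReal.ofReal_le_ofReal (fam_ind hF (fun i => (hm i).aestronglyMeasurable) hi N (amax_meas hm N) hsub amax_sum)

lemma sup_lemma {h : ℕ → Euc n → ℝ} {B : ℝ} (hF : Fam n h B) (hm : ∀ i, AEStronglyMeasurable (h i) volume)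
    (h0 : ∀ a, h 0 a = 0) (hi : ∀ i K, IsCompact K → IntegrableOn (h i) K) :
    ∫⁻ a, ⨆ i, ENNReal.ofReal (h i a) ≤ ENNReal.ofReal B := by
  have hex : ∀ i, ∃ g : Euc n → ℝ, Measurable g ∧ h i =ᵐ[volume] g ∧ (i = 0 → ∀ a, g a = 0) := by
    intro i
    by_cases hi0 : i = 0
    · subst hi0
      exact ⟨fun _ => 0, measurable_const, ae_of_all _ h0, fun _ _ => rfl⟩
    · exact ⟨(hm i).mk _, (hm i).stronglyMeasurable_mk.measurable, (hm i).ae_eq_mk, fun h => absurd h hi0⟩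
  choose g hg hgh hg0 using hex
  have : ∫⁻ a, ⨆ i, ENNReal.ofReal (h i a) = ∫⁻ a, ⨆ i, ENNReal.ofReal (g i a) := by
    refine lintegral_congr_ae ?_
    filter_upwards [ae_all_iff.2 hgh] with a ha
    simp_rw [ha]
  rw [this]
  refine sup_meas ?_ hg (hg0 0 rfl) fun i K hK => ?_
  · intro N φ h1 h2 h3
    refine le_trans (le_of_eq (Finset.sum_congr rfl fun i _ => ?_)) (hF N φ h1 h2 h3)
    refine integral_congr_ae ?_
    filter_upwards [hgh i] with a ha
    rw [ha]
  · exact (hi i K hK).congr_fun_ae (ae_restrict_of_ae (hgh i))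

end

section

section
variable {n : ℕ} {Ω : Set (Euc n)}

/-- compact exhaustion -/
def exh (Ω : Set (Euc n)) (j : ℕ) : Set (Euc n) := (thickening (1 / ((j : ℝ) + 1)) Ωᶜ)ᶜ

lemma exh_sub (j : ℕ) : exh Ω j ⊆ Ω := by
  rw [exh, Set.compl_subset_comm]
  exact self_subset_thickening (by positivity) _

lemma exh_compact (hb : Bornology.IsBounded Ω) (j : ℕ) : IsCompact (exh Ω j) :=
  isCompact_of_isClosed_isBounded isOpen_thickening.isClosed_compl (hb.subset (exh_sub j))

lemma exh_exists (ho : IsOpen Ω) {K : Set (Euc n)} (hK : IsCompact K) (hKΩ : K ⊆ Ω) : ∃ j, K ⊆ exh Ω j := by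
  obtain ⟨δ, hδ, h⟩ := hK.exists_thickening_subset_open ho hKΩ
  obtain ⟨j, hj⟩ := exists_nat_one_div_lt hδ
  refine ⟨j, fun x hx hx' => ?_⟩
  obtain ⟨y, hy, hxy⟩ := mem_thickening_iff.1 hx'
  exact hy (h (mem_thickening_iff.2 ⟨x, hx, by rw [dist_comm]; exact hxy.trans hj⟩))

lemma fderiv_off {K : Set (Euc n)} (hK : IsClosed K) {ψ : Euc n → ℝ} (h : ∀ x, x ∉ K → ψ x = 0) {x : Euc n} (hx : x ∉ K) :
    fderiv ℝ ψ x = 0 := by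
  have : ψ =ᶠ[𝓝 x] fun _ => 0 := by
    filter_upwards [hK.isOpen_compl.mem_nhds hx] with y hy using h y hy
  rw [this.fderiv_eq, fderiv_fun_const]
  rfl

/-- one-jets of admissible test functions -/
def jets (Ω : Set (Euc n)) (j : ℕ) : Set C(Euc n, ℝ × (Euc n →L[ℝ] ℝ)) :=
  {f | ∃ ψ, Cc1 n Ω ψ ∧ (∀ x, |ψ x| ≤ 1) ∧ (∀ x, x ∉ exh Ω j → ψ x = 0) ∧ ∀ x, f x = (ψ x, fderiv ℝ ψ x)}

lemma jets_mk {j : ℕ} {ψ : Euc n → ℝ} (h1 : Cc1 n Ω ψ) (h2 : ∀ x, |ψ x| ≤ 1) (h3 : ∀ x, x ∉ exh Ω j → ψ x = 0) :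
    ∃ f ∈ jets Ω j, ∀ x, f x = (ψ x, fderiv ℝ ψ x) :=
  ⟨⟨fun x => (ψ x, fderiv ℝ ψ x), h1.1.continuous.prodMk (h1.1.continuous_fderiv (by simp))⟩, ⟨ψ, h1, h2, h3, fun _ => rfl⟩,
    fun _ => rfl⟩

lemma dense_j (hb : Bornology.IsBounded Ω) (j : ℕ) : ∃ d : ℕ → Euc n → ℝ, (∀ i, Cc1 n Ω (d i)) ∧ (∀ i x, |d i x| ≤ 1) ∧
    (∀ i x, x ∉ exh Ω j → d i x = 0) ∧ ∀ ψ, Cc1 n Ω ψ → (∀ x, |ψ x| ≤ 1) → (∀ x, x ∉ exh Ω j → ψ x = 0) →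
      ∀ δ > 0, ∃ i, (∀ x, |ψ x - d i x| ≤ δ) ∧ ∀ x, ‖fderiv ℝ ψ x - fderiv ℝ (d i) x‖ ≤ δ := by
  obtain ⟨f0, hf0, -⟩ := jets_mk (Ω := Ω) (j := j) cc1_zero (by simp) (fun x _ => rfl)
  haveI : Nonempty (jets Ω j) := ⟨⟨f0, hf0⟩⟩
  obtain ⟨F, hF⟩ := TopologicalSpace.exists_dense_seq (jets Ω j)
  choose d hd1 hd2 hd3 hd4 using fun i => (F i).2
  refine ⟨d, hd1, hd2, hd3, fun ψ h1 h2 h3 δ hδ => ?_⟩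
  obtain ⟨f, hf, hfψ⟩ := jets_mk h1 h2 h3
  obtain ⟨y, hy, hlim⟩ := mem_closure_iff_seq_limit.1 (hF ⟨f, hf⟩)
  have hlim' : Tendsto (fun k => (y k : C(Euc n, ℝ × (Euc n →L[ℝ] ℝ)))) atTop (𝓝 f) :=
    (continuous_subtype_val.tendsto _).comp hlim
  have hu := ContinuousMap.tendsto_iff_forall_isCompact_tendstoUniformlyOn.1 hlim' _ (exh_compact hb j)
  obtain ⟨k, hk⟩ := (Metric.tendstoUniformlyOn_iff.1 hu δ hδ).exists
  obtain ⟨i, hi⟩ := hy k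
  have hcl : IsClosed (exh Ω j) := (exh_compact hb j).isClosed
  have key : ∀ x, dist (ψ x, fderiv ℝ ψ x) (d i x, fderiv ℝ (d i) x) ≤ δ := by
    intro x
    by_cases hx : x ∈ exh Ω j
    · have := (hk x hx).le
      rwa [← hi, hfψ, hd4] at this
    · rw [h3 x hx, hd3 i x hx, fderiv_off hcl h3 hx, fderiv_off hcl (hd3 i) hx, dist_self]
      exact hδ.le
  refine ⟨i, fun x => ?_, fun x => ?_⟩
  · have := (le_max_left _ _).trans (key x)
    rwa [Real.dist_eq] at this
  · have := (le_max_right _ _).trans (key x)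
    rwa [dist_eq_norm] at this

lemma dense_all (ho : IsOpen Ω) (hb : Bornology.IsBounded Ω) : ∃ d : ℕ → Euc n → ℝ, d 0 = 0 ∧ (∀ i, Cc1 n Ω (d i)) ∧
    (∀ i x, |d i x| ≤ 1) ∧ ∀ ψ, Cc1 n Ω ψ → (∀ x, |ψ x| ≤ 1) → ∃ K, IsCompact K ∧ K ⊆ Ω ∧ (∀ x, x ∉ K → ψ x = 0) ∧
      ∀ δ > 0, ∃ i, (∀ x, x ∉ K → d i x = 0) ∧ (∀ x, |ψ x - d i x| ≤ δ) ∧ ∀ x, ‖fderiv ℝ ψ x - fderiv ℝ (d i) x‖ ≤ δ := by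
  choose e e1 e2 e3 e4 using fun j => dense_j hb (Ω := Ω) j
  refine ⟨fun i => Nat.casesOn i 0 fun m => e (Nat.unpair m).1 (Nat.unpair m).2, rfl, ?_, ?_, ?_⟩
  · rintro (_ | m)
    · exact cc1_zero
    · exact e1 _ _
  · rintro (_ | m) x
    · simp
    · exact e2 _ _ _
  · intro ψ h1 h2
    obtain ⟨K, hK, hKΩ, h0, -⟩ := cc1_bd h1
    obtain ⟨j, hj⟩ := exh_exists ho hK hKΩ
    have h3 : ∀ x, x ∉ exh Ω j → ψ x = 0 := fun x hx => h0 x fun h => hx (hj h)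
    refine ⟨exh Ω j, exh_compact hb j, exh_sub j, h3, fun δ hδ => ?_⟩
    obtain ⟨i, hi1, hi2⟩ := e4 j ψ h1 h2 h3 δ hδ
    refine ⟨Nat.pair j i + 1, ?_⟩
    simp only [Nat.unpair_pair]
    exact ⟨e3 j i, hi1, hi2⟩

/-- The supremum over the countable family. -/
def HH (n : ℕ) (Ω : Set (Euc n)) (u : Euc n → Euc n) (d : ℕ → Euc n → ℝ) (a : Euc n) : ENNReal :=
  ⨆ i, ENNReal.ofReal (hh n Ω u (d i) a)

lemma hh_le_sup (D : Dom n Ω) {u : Euc n → Euc n} (U : UU n Ω u) {d : ℕ → Euc n → ℝ} (hd : ∀ i, Cc1 n Ω (d i))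
    {ψ : Euc n → ℝ} (hψ : Cc1 n Ω ψ) {K : Set (Euc n)} (hK : IsCompact K) (hKΩ : K ⊆ Ω) (h0 : ∀ x, x ∉ K → ψ x = 0)
    (hap : ∀ δ > 0, ∃ i, (∀ x, x ∉ K → d i x = 0) ∧ (∀ x, |ψ x - d i x| ≤ δ) ∧
      ∀ x, ‖fderiv ℝ ψ x - fderiv ℝ (d i) x‖ ≤ δ) {a : Euc n} (A : Gen n Ω u a) (hH : HH n Ω u d a ≠ ⊤) :
    hh n Ω u ψ a ≤ (HH n Ω u d a).toReal := by
  obtain ⟨C, hC, hb⟩ := JJ_bound D hK hKΩ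
  have hne : C * GG n Ω u a ≠ ⊤ := ENNReal.mul_ne_top hC A.fin
  refine le_of_forall_pos_le_add fun ε hε => ?_
  obtain ⟨c, hc⟩ : ∃ c, c = (C * GG n Ω u a).toReal := ⟨_, rfl⟩
  have hc0 : 0 ≤ c := hc ▸ ENNReal.toReal_nonneg
  have hδ : 0 < ε / (2 * c + 1) := by positivity
  obtain ⟨i, hi0, hi1, hi2⟩ := hap _ hδ
  set δ := ε / (2 * c + 1) with hδe
  have G := Q_good D U A 0
  have hlin := JJ_linear D G hψ (hd i) 1 (-1)
  have hbd := hb _ G _ (cc1_comb hψ (hd i) 1 (-1)) (fun x hx => by simp [h0 x hx, hi0 x hx]) δ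
    (fun x => by simpa [← sub_eq_add_neg] using hi1 x) δ (fun x => by
      have e : (1 : ℝ) • ψ + (-1 : ℝ) • d i = ψ - d i := by rw [one_smul, neg_one_smul, sub_eq_add_neg]
      rw [e, fderiv_sub ((hψ.1.differentiable (by simp)) x) (((hd i).1.differentiable (by simp)) x)]
      exact hi2 x)
  have h1 : ENNReal.ofReal |JJ n Ω (fun x => Qe 0 (u x - a)) ((1 : ℝ) • ψ + (-1 : ℝ) • d i)| ≤ ENNReal.ofReal ((δ + δ) * c) := by
    refine hbd.trans ?_
    rw [ENNReal.ofReal_mul (by positivity), hc, ENNReal.ofReal_toReal hne, mul_comm C, mul_assoc]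
    exact mul_le_mul' le_rfl (mul_le_mul' le_rfl (Q_energy_le D A 0))
  rw [ENNReal.ofReal_le_ofReal_iff (by positivity), hlin] at h1
  have h2 : hh n Ω u (d i) a ≤ (HH n Ω u d a).toReal := by
    rw [← ENNReal.ofReal_le_iff_le_toReal hH]
    exact le_iSup (fun i => ENNReal.ofReal (hh n Ω u (d i) a)) i
  have h3 : (δ + δ) * c ≤ ε := by
    rw [hδe]
    have : (ε / (2 * c + 1) + ε / (2 * c + 1)) * c = ε * (2 * c / (2 * c + 1)) := by ring
    rw [this]
    refine mul_le_of_le_one_right hε.le ?_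
    rw [div_le_one (by positivity)]
    linarith
  have h4 := (le_abs_self _).trans h1
  unfold hh at h2 ⊢
  linarith

end

end

section

lemma ballVol_pos (n : ℕ) : 0 < ballVol n :=
  ENNReal.toReal_pos (measure_ball_pos volume _ one_pos).ne' measure_ball_lt_top.ne

lemma coarea_UU {n : ℕ} {Ω : Set (Euc n)} (D : Dom n Ω) {u : Euc n → Euc n} (U : UU n Ω u) (hTV : BddAbove (TVset n Ω u)) :
    (∀ᵐ a : Euc n, MemWsp n (((n : ℝ) - 1) / n) n Ω (proj n u a) ∧ BddAbove (TVset n Ω (proj n u a))) ∧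
    Integrable (fun a => sSup (TVset n Ω (proj n u a))) volume ∧
    sSup (TVset n Ω u) = (ballVol n)⁻¹ * ∫ a : Euc n, sSup (TVset n Ω (proj n u a)) := by
  have G := UU.good D U
  obtain ⟨L, hLM, hL⟩ := exists_L D G hTV
  obtain ⟨d, hd0, hd, hd1, hdens⟩ := dense_all D.ho D.hb
  have hω := ballVol_pos n
  have hh0 : ∀ a, Gen n Ω u a → hh n Ω u (d 0) a = 0 := by
    intro a A
    have := JJ_linear D (Q_good D U A 0) (hd 0) (hd 0) 0 0
    unfold hh
    simpa [hd0] using this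
  have hmeas : ∀ i, AEStronglyMeasurable (hh n Ω u (d i)) volume := fun i => hh_meas D U hL (hd i)
  -- a version with vanishing zeroth member
  have hsup : ∫⁻ a, HH n Ω u d a ≤ ENNReal.ofReal (ballVol n * sSup (TVset n Ω u)) := by
    let g : ℕ → Euc n → ℝ := fun i => if i = 0 then fun _ => 0 else hh n Ω u (d i)
    have hg : ∀ i, g i =ᵐ[volume] hh n Ω u (d i) := by
      intro i
      by_cases hi : i = 0
      · subst hi
        filter_upwards [ae_gen D U] with a A
        rw [hh0 a A]
        rfl
      · simp only [g, if_neg hi]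
        exact EventuallyEq.rfl
    have e : ∫⁻ a, HH n Ω u d a = ∫⁻ a, ⨆ i, ENNReal.ofReal (g i a) := by
      refine lintegral_congr_ae ?_
      filter_upwards [ae_all_iff.2 hg] with a ha
      simp_rw [HH, ha]
    rw [e]
    refine sup_lemma ?_ (fun i => (hmeas i).congr (hg i).symm) (fun a => rfl) (fun i K hK => ?_)
    · intro N φ h1 h2 h3
      refine le_trans (le_of_eq (Finset.sum_congr rfl fun i _ => ?_)) (weak_family D U hL hLM N d φ hd hd1 h1 h2 h3)
      refine integral_congr_ae ?_
      filter_upwards [hg i] with a ha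
      rw [ha]
    · exact (hh_int D U hL (hd i) hK).congr_fun_ae (ae_restrict_of_ae (hg i).symm)
  have hHm : AEMeasurable (HH n Ω u d) volume := AEMeasurable.iSup fun i => (hmeas i).aemeasurable.ennreal_ofReal
  have hHfin : ∫⁻ a, HH n Ω u d a ≠ ⊤ := ne_top_of_le_ne_top ENNReal.ofReal_ne_top hsup
  have hHae : ∀ᵐ a, HH n Ω u d a < ⊤ := ae_lt_top' hHm hHfin
  have hpr : ∀ a, (fun x => Qe 0 (u x - a)) = proj n u a := fun a => funext fun x => Qe_zero_proj u a x
  have hle : ∀ ψ, Cc1 n Ω ψ → (∀ x, |ψ x| ≤ 1) → ∀ a, Gen n Ω u a → HH n Ω u d a ≠ ⊤ →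
      hh n Ω u ψ a ≤ (HH n Ω u d a).toReal := by
    intro ψ h1 h2 a A hH
    obtain ⟨K, hK, hKΩ, h0, hap⟩ := hdens ψ h1 h2
    exact hh_le_sup D U hd h1 hK hKΩ h0 hap A hH
  have hset : ∀ a, Gen n Ω u a → TVset n Ω (proj n u a) =
      {r | ∃ ψ : Euc n → ℝ, Cc1 n Ω ψ ∧ (∀ x, |ψ x| ≤ 1) ∧ hh n Ω u ψ a = r} := by
    intro a A
    rw [← hpr a, tvset_eq D (Q_good D U A 0)]
    rfl
  have hbdd : ∀ a, Gen n Ω u a → HH n Ω u d a ≠ ⊤ → BddAbove (TVset n Ω (proj n u a)) := by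
    intro a A hH
    rw [hset a A]
    refine ⟨(HH n Ω u d a).toReal, ?_⟩
    rintro r ⟨ψ, h1, h2, rfl⟩
    exact hle ψ h1 h2 a A hH
  have hval : ∀ a, Gen n Ω u a → HH n Ω u d a ≠ ⊤ → sSup (TVset n Ω (proj n u a)) = (HH n Ω u d a).toReal := by
    intro a A hH
    have hmem : ∀ i, hh n Ω u (d i) a ∈ TVset n Ω (proj n u a) := fun i => by
      rw [hset a A]
      exact ⟨d i, hd i, hd1 i, rfl⟩
    have hB := hbdd a A hH
    refine le_antisymm (csSup_le ⟨_, hmem 0⟩ ?_) ?_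
    · rw [hset a A]
      rintro r ⟨ψ, h1, h2, rfl⟩
      exact hle ψ h1 h2 a A hH
    · refine ENNReal.toReal_le_of_le_ofReal ?_ (iSup_le fun i => ENNReal.ofReal_le_ofReal (le_csSup hB (hmem i)))
      rw [← hh0 a A]
      exact le_csSup hB (hmem 0)
  have hae : (fun a => sSup (TVset n Ω (proj n u a))) =ᵐ[volume] fun a => (HH n Ω u d a).toReal := by
    filter_upwards [ae_gen D U, hHae] with a A hH using hval a A hH.ne
  have hintg : Integrable (fun a => (HH n Ω u d a).toReal) volume := integrable_toReal_of_lintegral_ne_top hHm hHfin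
  refine ⟨?_, hintg.congr hae.symm, ?_⟩
  · filter_upwards [ae_gen D U, hHae] with a A hH
    refine ⟨?_, hbdd a A hH.ne⟩
    have GQ := Q_good D U A 0
    rw [← hpr a]
    exact (memWsp_iff (by have := D.hn; omega) (hs_exp D.hn) GQ.meas).2 ⟨GQ.lp, GQ.en⟩
  · rw [integral_congr_ae hae]
    have hM0 : 0 ≤ sSup (TVset n Ω u) := (norm_nonneg L).trans hLM
    have hS0 : 0 ≤ ∫ a, (HH n Ω u d a).toReal := integral_nonneg fun _ => ENNReal.toReal_nonneg
    have up : ∫ a, (HH n Ω u d a).toReal ≤ ballVol n * sSup (TVset n Ω u) := by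
      rw [integral_toReal hHm hHae]
      exact ENNReal.toReal_le_of_le_ofReal (mul_nonneg hω.le hM0) hsup
    have low : sSup (TVset n Ω u) ≤ (ballVol n)⁻¹ * ∫ a, (HH n Ω u d a).toReal := by
      rw [tvset_eq D G]
      refine csSup_le ⟨_, 0, cc1_zero, by simp, rfl⟩ ?_
      rintro r ⟨ψ, h1, h2, rfl⟩
      rw [le_inv_mul_iff₀ hω]
      obtain ⟨φ, -, hφ0, hφ1, hφ⟩ := weak_conv D U hL h1
      rw [← hφ]
      by_cases hi : Integrable (fun a => φ a * hh n Ω u ψ a) volume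
      · refine integral_mono_ae hi hintg ?_
        filter_upwards [ae_gen D U, hHae] with a A hH
        exact (mul_le_mul_of_nonneg_left (hle ψ h1 h2 a A hH.ne) (hφ0 a)).trans
          (mul_le_of_le_one_left ENNReal.toReal_nonneg (hφ1 a))
      · rw [integral_undef hi]
        exact hS0
    refine le_antisymm low ?_
    rw [inv_mul_le_iff₀ hω]
    exact up

lemma coarea_main (n : ℕ) (hn : 2 ≤ n) (Ω : Set (Euc n)) (hΩo : IsOpen Ω)
    (hΩb : Bornology.IsBounded Ω) (hΩs : SmoothBoundary n Ω)
    (u : Euc n → Euc n) (hucont : ContinuousOn u Ω)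
    (hu : MemWsp n ((n : ℝ) / ((n : ℝ) + 1)) ((n : ℝ) + 1) Ω u)
    (hTV : BddAbove (TVset n Ω u)) :
    (∀ᵐ a : Euc n, MemWsp n (((n : ℝ) - 1) / n) n Ω (proj n u a) ∧
        BddAbove (TVset n Ω (proj n u a))) ∧
    Integrable (fun a => sSup (TVset n Ω (proj n u a))) volume ∧
    sSup (TVset n Ω u) = (ballVol n)⁻¹ * ∫ a : Euc n, sSup (TVset n Ω (proj n u a)) := by
  have D : Dom n Ω := ⟨hn, hΩo, hΩb, hΩs⟩
  have hΩm := hΩo.measurableSet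
  have huw : ∀ x ∈ Ω, u x = Ω.indicator u x := fun x hx => (Set.indicator_of_mem hx u).symm
  have hpw : ∀ a, ∀ x ∈ Ω, proj n u a x = proj n (Ω.indicator u) a x := fun a x hx => by
    unfold proj
    rw [← huw x hx]
  rw [memWsp_congr hΩm huw] at hu
  rw [tvset_congr hΩm huw] at hTV ⊢
  simp_rw [memWsp_congr hΩm (hpw _), tvset_congr hΩm (hpw _)]
  have hm := ind_meas hΩo hucont
  have hcont : ContinuousOn (Ω.indicator u) Ω := hucont.congr fun x hx => (huw x hx).symm
  have hn0 : (n : ℝ) + 1 ≠ 0 := by positivity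
  have hex : (n : ℝ) + ((n : ℝ) / ((n : ℝ) + 1)) * ((n + 1 : ℕ) : ℝ) = ((n + (n + 1) - 1 : ℕ) : ℝ) := by
    rw [show n + (n + 1) - 1 = n + n by omega]
    push_cast
    field_simp
  have hcast : ((n : ℝ) + 1) = ((n + 1 : ℕ) : ℝ) := by push_cast; rfl
  have hu' : MemWsp n ((n : ℝ) / ((n : ℝ) + 1)) ((n + 1 : ℕ) : ℝ) Ω (Ω.indicator u) := by
    rw [← hcast]
    exact hu
  obtain ⟨hlp, hen⟩ := (memWsp_iff (p := n + 1) (by omega) hex hm).1 hu'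
  have hintg : IntegrableOn (Ω.indicator u) Ω := by
    refine ⟨hm.aestronglyMeasurable, ?_⟩
    have hvol : volume Ω ≠ ⊤ := (hΩb.measure_lt_top (μ := volume)).ne
    have : ∫⁻ x in Ω, ‖Ω.indicator u x‖ₑ ≤ ∫⁻ x in Ω, (1 + ‖Ω.indicator u x‖ₑ ^ (n + 1)) := by
      refine lintegral_mono fun x => ?_
      rcases le_total ‖Ω.indicator u x‖ₑ 1 with h | h
      · exact h.trans le_self_add
      · exact (le_self_pow₀ h (by omega)).trans le_add_self
    refine lt_of_le_of_lt this ?_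
    rw [lintegral_add_left measurable_const, lintegral_const, Measure.restrict_apply MeasurableSet.univ, Set.univ_inter, one_mul]
    exact ENNReal.add_lt_top.2 ⟨hvol.lt_top, hlp.lt_top⟩
  exact coarea_UU D ⟨hm, hcont, hintg, hlp, hen⟩ hTV

end

/-- (Strong coarea formula.) -/
theorem strong_coarea_formula
    (n : ℕ) (hn : 2 ≤ n) (Ω : Set (Euc n)) (hΩo : IsOpen Ω)
    (hΩb : Bornology.IsBounded Ω) (hΩs : SmoothBoundary n Ω)
    (u : Euc n → Euc n) (hucont : ContinuousOn u Ω)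
    (hu : MemWsp n ((n : ℝ) / ((n : ℝ) + 1)) ((n : ℝ) + 1) Ω u)
    (hTV : BddAbove (TVset n Ω u)) :
    (∀ᵐ a : Euc n, MemWsp n (((n : ℝ) - 1) / n) n Ω (proj n u a) ∧
        BddAbove (TVset n Ω (proj n u a))) ∧
    Integrable (fun a => sSup (TVset n Ω (proj n u a))) volume ∧
    sSup (TVset n Ω u) = (ballVol n)⁻¹ * ∫ a : Euc n, sSup (TVset n Ω (proj n u a)) :=
  coarea_main n hn Ω hΩo hΩb hΩs u hucont hu hTV

end
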